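/- arXiv:2406.06501 — 15 statements merged into one kernel-verified Lean document; each statement's English description precedes it below -/
import Mathlib

section
/- Let k ≥ 6 and let m be an integer with k/2 ≤ m ≤ k−2. Let H be a k-uniform hypergraph with ν^(m)(H) = 1. Then τ^(m)(H) ≤ C(k,m) − m, where C(k,m) denotes the binomial coefficient k choose m. -/
open Finset

/-- `M` is an `m`-matching of the hypergraph `H`. -/
def IsMatching {V : Type*} [DecidableEq V] (m : ℕ) (H M : Finset (Finset V)) : Prop :=
  M ⊆ H ∧ ∀ e ∈ M, ∀ f ∈ M, e ≠ f → (e ∩ f).card < m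

/-- `C` is an `m`-cover of the hypergraph `H`. -/
def IsCover {V : Type*} (m : ℕ) (H C : Finset (Finset V)) : Prop :=
  (∀ c ∈ C, c.card = m) ∧ ∀ e ∈ H, ∃ c ∈ C, c ⊆ e

/-- If `f` and `g` trace on `e` two `m`-sets whose union is `e`, then `f` and `g` agree
outside `e`. -/
lemma sdiff_eq_of_inter_union_eq {V : Type*} [DecidableEq V] {k m : ℕ} {e f g : Finset V}
    (he : e.card = k) (hf : f.card = k) (hg : g.card = k) (hfg : m ≤ (f ∩ g).card)
    (hfe : (f ∩ e).card = m) (hge : (g ∩ e).card = m) (hu : f ∩ e ∪ g ∩ e = e) :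
    f \ e = g \ e := by
  have h1 := card_union_add_card_inter (f ∩ e) (g ∩ e)
  rw [hu] at h1
  have h2 := card_inter_add_card_sdiff (f ∩ g) e
  have h3 := card_inter_add_card_sdiff f e
  have h4 := card_inter_add_card_sdiff g e
  have h5 : f ∩ e ∩ (g ∩ e) = f ∩ g ∩ e := by
    ext x
    simp only [mem_inter]
    tauto
  rw [h5] at h1
  have h6 : (f ∩ g) \ e = f \ e :=
    eq_of_subset_of_card_le (sdiff_subset_sdiff inter_subset_left le_rfl) (by omega)
  have h7 : (f ∩ g) \ e = g \ e :=
    eq_of_subset_of_card_le (sdiff_subset_sdiff inter_subset_right le_rfl) (by omega)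
  rw [← h6, h7]

/-- In an `m`-intersecting `k`-uniform hypergraph, all edges whose trace on the edge `e` is one of
two given `m`-sets with union `e` share a common `m`-set. -/
lemma exists_common_subset {V : Type*} [DecidableEq V] {k m : ℕ} {H : Finset (Finset V)}
    (hH : ∀ e ∈ H, e.card = k) (hint : ∀ e ∈ H, ∀ f ∈ H, m ≤ (e ∩ f).card)
    {e S T : Finset V} (he : e ∈ H) (hS : S.card = m) (hT : T.card = m) (hST : S ∪ T = e) :
    ∃ P : Finset V, P.card = m ∧ ∀ f ∈ H, f ∩ e = S ∨ f ∩ e = T → P ⊆ f := by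
  by_cases h1 : ∃ f ∈ H, f ∩ e = S
  swap
  · refine ⟨T, hT, fun f hf h => ?_⟩
    rcases h with h | h
    · exact absurd ⟨f, hf, h⟩ h1
    · exact h ▸ inter_subset_left
  by_cases h2 : ∃ f ∈ H, f ∩ e = T
  swap
  · refine ⟨S, hS, fun f hf h => ?_⟩
    rcases h with h | h
    · exact h ▸ inter_subset_left
    · exact absurd ⟨f, hf, h⟩ h2
  obtain ⟨f₁, hf₁, hS₁⟩ := h1
  obtain ⟨f₂, hf₂, hT₂⟩ := h2
  have key : ∀ f ∈ H, ∀ g ∈ H, f ∩ e = S → g ∩ e = T → f \ e = g \ e := fun f hf g hg h h' =>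
    sdiff_eq_of_inter_union_eq (hH e he) (hH f hf) (hH g hg) (hint f hf g hg)
      (h ▸ hS) (h' ▸ hT) (by rw [h, h', hST])
  refine ⟨S ∩ T ∪ f₁ \ e, ?_, fun f hf h => ?_⟩
  · have hd : Disjoint (S ∩ T) (f₁ \ e) :=
      disjoint_of_subset_left (inter_subset_left.trans (hST ▸ subset_union_left)) disjoint_sdiff
    have h3 := card_union_add_card_inter S T
    have h4 := card_inter_add_card_sdiff f₁ e
    rw [hST, hH e he] at h3
    rw [hS₁, hH f₁ hf₁] at h4
    rw [card_union_of_disjoint hd]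
    omega
  · rcases h with h | h
    · have h5 : f₁ \ e = f \ e :=
        (key f₁ hf₁ f₂ hf₂ hS₁ hT₂).trans (key f hf f₂ hf₂ h hT₂).symm
      rw [h5]
      exact union_subset (inter_subset_left.trans (h ▸ inter_subset_left)) sdiff_subset
    · rw [key f₁ hf₁ f hf hS₁ h]
      exact union_subset (inter_subset_right.trans (h ▸ inter_subset_left)) sdiff_subset

/-- A system of `m` disjoint pairs of `m`-subsets of `e`, each pair having union `e`. -/
lemma exists_covering_pairs {V : Type*} [DecidableEq V] {k m : ℕ} (hm0 : 0 < m)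
    (hm1 : k ≤ 2 * m) (hm2 : m + 2 ≤ k) {e : Finset V} (he : e.card = k) :
    ∃ (I : Finset (ZMod (m + 1))) (S T : ZMod (m + 1) → Finset V), I.card = m ∧
      (∀ i, (S i).card = m) ∧ (∀ i, (T i).card = m) ∧ (∀ i, S i ∪ T i = e) ∧
      S.Injective ∧ T.Injective ∧ ∀ i j, S i ≠ T j := by
  obtain ⟨Y, hYe, hY⟩ := exists_subset_card_eq (s := e) (n := m + 1) (by omega)
  have hc : Fintype.card (ZMod (m + 1)) = Fintype.card Y := by
    rw [ZMod.card, Fintype.card_coe, hY]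
  let y := Fintype.equivOfCardEq hc
  have hy : Function.Injective fun i => (y i : V) := Subtype.val_injective.comp y.injective
  let D : ZMod (m + 1) → Finset (ZMod (m + 1)) := fun i =>
    (range (k - m)).image fun j : ℕ => i + 1 + (j : ZMod (m + 1))
  have hcast : ∀ a b : ℕ, a < m + 1 → b < m + 1 → (a : ZMod (m + 1)) = b → a = b := by
    intro a b ha hb h
    rwa [ZMod.natCast_eq_natCast_iff', Nat.mod_eq_of_lt ha, Nat.mod_eq_of_lt hb] at h
  have hDcard : ∀ i, (D i).card = k - m := by
    intro i
    rw [card_image_of_injOn, card_range]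
    intro a ha b hb h
    simp only [coe_range, Set.mem_Iio] at ha hb
    exact hcast a b (by omega) (by omega) (add_left_cancel h)
  have hDself : ∀ i, i ∉ D i := by
    intro i h
    obtain ⟨j, hj, hij⟩ := mem_image.1 h
    rw [mem_range] at hj
    have h0 : ((j + 1 : ℕ) : ZMod (m + 1)) = (0 : ℕ) := by
      push_cast
      linear_combination hij
    have := hcast _ _ (by omega) (by omega) h0
    omega
  have hDinj : D.Injective := by
    intro i j hij
    have h1 : i + 1 ∈ D j :=
      hij ▸ mem_image.2 ⟨0, mem_range.2 (by omega), by simp⟩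
    obtain ⟨t, ht, hti⟩ := mem_image.1 h1
    rw [mem_range] at ht
    rcases t with _ | t
    · simpa using hti.symm
    · refine absurd (?_ : i ∈ D i) (hDself i)
      rw [hij]
      refine mem_image.2 ⟨t, mem_range.2 (by omega), ?_⟩
      push_cast at hti
      linear_combination hti
  let E : ZMod (m + 1) → Finset V := fun i => (D i).image fun j => (y j : V)
  have hEY : ∀ i, E i ⊆ Y := fun i => image_subset_iff.2 fun j _ => (y j).2
  have hEe : ∀ i, E i ⊆ e := fun i => (hEY i).trans hYe
  refine ⟨univ.erase 0, fun i => Y.erase (y i), fun i => e \ E i, ?_, ?_, ?_, ?_, ?_, ?_, ?_⟩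
  · rw [card_erase_of_mem (mem_univ _), card_univ, ZMod.card]
    rfl
  · intro i
    rw [card_erase_of_mem (y i).2, hY]
    rfl
  · intro i
    rw [card_sdiff_of_subset (hEe i), card_image_of_injective _ hy, hDcard, he]
    omega
  · intro i
    refine Subset.antisymm (union_subset ((erase_subset _ _).trans hYe) sdiff_subset) ?_
    intro x hx
    by_cases hxE : x ∈ E i
    · refine mem_union_left _ (mem_erase.2 ⟨?_, hEY i hxE⟩)
      rintro rfl
      obtain ⟨j, hj, hji⟩ := mem_image.1 hxE
      exact hDself i (hy hji ▸ hj)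
    · exact mem_union_right _ (mem_sdiff.2 ⟨hx, hxE⟩)
  · intro i j hij
    by_contra hne
    have h1 : (y i : V) ∈ Y.erase (y j) := mem_erase.2 ⟨fun h => hne (hy h), (y i).2⟩
    rw [← (show Y.erase (y i : V) = Y.erase (y j) from hij)] at h1
    exact notMem_erase _ _ h1
  · intro i j hij
    have h1 : E i = E j := by
      rw [← Finset.sdiff_sdiff_eq_self (hEe i), ← Finset.sdiff_sdiff_eq_self (hEe j)]
      exact congrArg (e \ ·) hij
    exact hDinj (image_injective hy h1)
  · intro i j hij
    have h1 : e ⊆ Y := by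
      intro x hx
      by_cases hxE : x ∈ E j
      · exact hEY j hxE
      · have h2 : x ∈ Y.erase (y i : V) := by
          rw [show Y.erase (y i : V) = e \ E j from hij]
          exact mem_sdiff.2 ⟨hx, hxE⟩
        exact mem_of_mem_erase h2
    have := card_le_card h1
    omega

/-- For `k ≥ 6` and `k/2 ≤ m ≤ k - 2`, if `H` is a `k`-uniform hypergraph with
`ν^(m)(H) = 1`, then `τ^(m)(H) ≤ C(k,m) - m`. -/
theorem stmt4 {V : Type*} [DecidableEq V] (k m : ℕ) (hk : 6 ≤ k)
    (hm1 : k ≤ 2 * m) (hm2 : m ≤ k - 2)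
    (H : Finset (Finset V)) (hH : ∀ e ∈ H, e.card = k)
    (hex : ∃ M, IsMatching m H M ∧ M.card = 1)
    (hmax : ∀ M, IsMatching m H M → M.card ≤ 1) :
    ∃ C, IsCover m H C ∧ C.card ≤ k.choose m - m := by
  have hint : ∀ e ∈ H, ∀ f ∈ H, m ≤ (e ∩ f).card := by
    intro e he f hf
    by_cases hef : e = f
    · subst hef
      rw [inter_self, hH e he]
      omega
    by_contra! hlt
    have h1 := hmax {e, f} ⟨by simp [insert_subset_iff, he, hf], by
      intro a ha b hb hab
      simp only [mem_insert, mem_singleton] at ha hb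
      rcases ha with rfl | rfl <;> rcases hb with rfl | rfl
      · exact absurd rfl hab
      · exact hlt
      · rwa [inter_comm]
      · exact absurd rfl hab⟩
    rw [card_pair hef] at h1
    omega
  obtain ⟨M, hM, hM1⟩ := hex
  obtain ⟨e, rfl⟩ := card_eq_one.1 hM1
  have he : e ∈ H := hM.1 (mem_singleton_self e)
  obtain ⟨I, S, T, hI, hS, hT, hST, hSinj, hTinj, hne⟩ :=
    exists_covering_pairs (by omega) hm1 (by omega) (hH e he)
  choose P hPcard hP using fun i => exists_common_subset hH hint he (hS i) (hT i) (hST i)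
  set R : Finset (Finset V) := I.image S ∪ I.image T with hR
  have hRmem : ∀ A, A ∈ R ↔ ∃ i ∈ I, A = S i ∨ A = T i := by
    intro A
    simp only [hR, mem_union, mem_image]
    constructor
    · rintro (⟨i, hi, rfl⟩ | ⟨i, hi, rfl⟩)
      · exact ⟨i, hi, Or.inl rfl⟩
      · exact ⟨i, hi, Or.inr rfl⟩
    · rintro ⟨i, hi, rfl | rfl⟩
      · exact Or.inl ⟨i, hi, rfl⟩
      · exact Or.inr ⟨i, hi, rfl⟩
  have hRcard : R.card = 2 * m := by
    rw [hR, card_union_of_disjoint, card_image_of_injective _ hSinj,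
      card_image_of_injective _ hTinj, hI, two_mul]
    rw [disjoint_left]
    intro A hA hA'
    obtain ⟨i, -, rfl⟩ := mem_image.1 hA
    obtain ⟨j, -, hj⟩ := mem_image.1 hA'
    exact hne i j hj.symm
  have hRsub : R ⊆ powersetCard m e := by
    intro A hA
    obtain ⟨i, -, rfl | rfl⟩ := (hRmem A).1 hA
    · exact mem_powersetCard.2 ⟨hST i ▸ subset_union_left, hS i⟩
    · exact mem_powersetCard.2 ⟨hST i ▸ subset_union_right, hT i⟩
  refine ⟨powersetCard m e \ R ∪ I.image P, ⟨?_, ?_⟩, ?_⟩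
  · intro c hc
    rcases mem_union.1 hc with hc | hc
    · exact (mem_powersetCard.1 (mem_sdiff.1 hc).1).2
    · obtain ⟨i, -, rfl⟩ := mem_image.1 hc
      exact hPcard i
  · intro f hf
    rcases (hint f hf e he).eq_or_lt with hfe | hfe
    · by_cases hmem : f ∩ e ∈ R
      · obtain ⟨i, hi, h⟩ := (hRmem _).1 hmem
        exact ⟨P i, mem_union_right _ (mem_image_of_mem _ hi), hP i f hf h⟩
      · exact ⟨f ∩ e, mem_union_left _ (mem_sdiff.2
          ⟨mem_powersetCard.2 ⟨inter_subset_right, hfe.symm⟩, hmem⟩), inter_subset_left⟩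
    · obtain ⟨Y, hYs, hY⟩ := exists_subset_card_eq (s := f ∩ e) (n := m + 1) hfe
      -- The `m + 1` facets of `Y` lie in distinct pairs, so one of them is not in `R`.
      have hex : ∃ A ∈ powersetCard m Y, A ∉ R := by
        by_contra! hall
        choose! φ hφI hφ using fun A hA => (hRmem A).1 (hall A hA)
        obtain ⟨A, hA, B, hB, hAB, heq⟩ :=
          exists_ne_map_eq_of_card_lt_of_maps_to (s := powersetCard m Y) (t := I) (f := φ)
            (by rw [card_powersetCard, hY, hI, Nat.choose_succ_self_right]; omega) hφI
        have hsub : e ⊆ Y := by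
          have hA' := (mem_powersetCard.1 hA).1
          have hB' := (mem_powersetCard.1 hB).1
          have h1 := hφ A hA
          have h2 := hφ B hB
          rw [← heq] at h2
          rw [← hST (φ A)]
          rcases h1 with h1 | h1 <;> rcases h2 with h2 | h2
          · exact absurd (h1.trans h2.symm) hAB
          · exact union_subset (h1 ▸ hA') (h2 ▸ hB')
          · exact union_subset (h2 ▸ hB') (h1 ▸ hA')
          · exact absurd (h1.trans h2.symm) hAB
        have := card_le_card hsub
        rw [hH e he] at this
        omega
      obtain ⟨A, hA, hAR⟩ := hex
      obtain ⟨hAY, hAm⟩ := mem_powersetCard.1 hA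
      have hAf := hAY.trans hYs
      exact ⟨A, mem_union_left _ (mem_sdiff.2
        ⟨mem_powersetCard.2 ⟨hAf.trans inter_subset_right, hAm⟩, hAR⟩),
        hAf.trans inter_subset_left⟩
  · have h1 := card_union_le (powersetCard m e \ R) (I.image P)
    have h2 : (I.image P).card ≤ m := card_image_le.trans_eq hI
    have h3 := card_le_card hRsub
    rw [card_sdiff_of_subset hRsub] at h1
    rw [card_powersetCard, hH e he] at h1 h3
    omega
end

section
/- Let k ≥ 3 and let H be a k-uniform hypergraph with ν^(k−2)(H) = 1. Then τ^(k−2)(H) ≤ ⌈k²/4⌉, i.e., τ^(k−2)(H) ≤ (k² + 3)/4 if k is odd and τ^(k−2)(H) ≤ k²/4 if k is even. -/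
open Finset

section

variable {V : Type*} [DecidableEq V]

/-- If no `(k - 2)`-matching has two edges, any two edges meet in at least `k - 2` vertices. -/
theorem le_card_inter_of_matching_le_one {k : ℕ} {H : Finset (Finset V)}
    (hH : ∀ e ∈ H, e.card = k) (hmax : ∀ M, IsMatching (k - 2) H M → M.card ≤ 1)
    {e f : Finset V} (he : e ∈ H) (hf : f ∈ H) : k - 2 ≤ (e ∩ f).card := by
  by_contra! hlt
  have hne : e ≠ f := by
    rintro rfl
    rw [inter_self, hH e he] at hlt
    omega
  have h := hmax {e, f} ⟨by simp [insert_subset_iff, he, hf], by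
    intro x hx y hy hxy
    simp only [mem_insert, mem_singleton] at hx hy
    rcases hx with rfl | rfl <;> rcases hy with rfl | rfl
    · exact absurd rfl hxy
    · exact hlt
    · rwa [inter_comm]
    · exact absurd rfl hxy⟩
  rw [card_pair hne] at h
  omega

theorem card_sdiff_le_two {k : ℕ} {e f : Finset V} (he : e.card = k)
    (hef : k - 2 ≤ (e ∩ f).card) : (e \ f).card ≤ 2 := by
  have := card_sdiff_add_card_inter e f
  omega

/-- Pairs of vertices of `e` that contain every `e \ f` give a cover by their complements in `e`. -/
theorem exists_cover_of_pairs {k : ℕ} {H : Finset (Finset V)} {e : Finset V} (he : e.card = k)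
    (T : Finset (Finset V)) (hT : ∀ p ∈ T, p ⊆ e ∧ p.card = 2)
    (hcov : ∀ f ∈ H, ∃ p ∈ T, e \ f ⊆ p) :
    ∃ C, IsCover (k - 2) H C ∧ C.card ≤ T.card := by
  refine ⟨T.image (e \ ·), ⟨?_, ?_⟩, card_image_le⟩
  · intro c hc
    obtain ⟨p, hp, rfl⟩ := mem_image.1 hc
    rw [card_sdiff_of_subset (hT p hp).1, he, (hT p hp).2]
  · intro f hf
    obtain ⟨p, hp, hfp⟩ := hcov f hf
    refine ⟨e \ p, mem_image_of_mem _ hp, ?_⟩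
    intro x hx
    rw [mem_sdiff] at hx
    by_contra hxf
    exact hx.2 (hfp (mem_sdiff.2 ⟨hx.1, hxf⟩))

/-- If `f` misses two vertices of `e`, and `g` misses only other ones, then `g` leaves `e` only
inside `f`. -/
theorem sdiff_subset_sdiff_of_disjoint {k : ℕ} {e f g : Finset V} (he : e.card = k)
    (hg : g.card = k) (hfg : k - 2 ≤ (f ∩ g).card) (h2 : (e \ f).card = 2)
    (hd : Disjoint (e \ f) (e \ g)) : g \ e ⊆ f \ e := by
  have h1 : (e ∩ (f ∩ g)).card + ((e \ f) ∪ (e \ g)).card = e.card := by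
    have : (e \ f) ∪ (e \ g) = e \ (f ∩ g) := by grind
    rw [this, add_comm]
    exact card_sdiff_add_card_inter e (f ∩ g)
  rw [card_union_of_disjoint hd] at h1
  have h3 : ((f ∩ g) \ e).card + (e ∩ (f ∩ g)).card = (f ∩ g).card := by
    rw [inter_comm e]
    exact card_sdiff_add_card_inter (f ∩ g) e
  have h4 := card_sdiff_add_card_inter e g
  have h5 := card_sdiff_add_card_inter g e
  rw [inter_comm] at h5
  have hsub : (f ∩ g) \ e ⊆ g \ e := sdiff_subset_sdiff inter_subset_right le_rfl
  have heq : (f ∩ g) \ e = g \ e := eq_of_subset_of_card_le hsub (by omega)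
  rw [← heq]
  exact sdiff_subset_sdiff inter_subset_left le_rfl

/-- A hypergraph living on `k + 2` vertices: split them into blocks of size at most two. -/
theorem exists_cover_of_subset {k : ℕ} (hk : 3 ≤ k) {H : Finset (Finset V)}
    (hH : ∀ e ∈ H, e.card = k) {S : Finset V} (hS : S.card = k + 2) (hHS : ∀ f ∈ H, f ⊆ S) :
    ∃ C, IsCover (k - 2) H C ∧ C.card ≤ ((k + 3) / 2).choose 2 := by
  let φ : S ≃ Fin (k + 2) := S.equivFinOfCardEq hS
  let g : V → ℕ := fun x => if h : x ∈ S then (φ ⟨x, h⟩ : ℕ) / 2 else 0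
  have hg : ∀ x (h : x ∈ S), g x = (φ ⟨x, h⟩ : ℕ) / 2 := fun x h => dif_pos h
  have hlt : ∀ x ∈ S, g x < (k + 3) / 2 := by
    intro x hx
    have := (φ ⟨x, hx⟩).2
    rw [hg x hx]
    omega
  have hfib : ∀ i, (S.filter (fun x => g x = i)).card ≤ 2 := by
    intro i
    let r : V → ℕ := fun x => if h : x ∈ S then (φ ⟨x, h⟩ : ℕ) else 0
    have hr : ∀ x (h : x ∈ S), r x = (φ ⟨x, h⟩ : ℕ) := fun x h => dif_pos h
    have : (S.filter (fun x => g x = i)).card ≤ ({2 * i, 2 * i + 1} : Finset ℕ).card := by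
      refine card_le_card_of_injOn r ?_ ?_
      · intro x hx
        simp only [coe_filter, Set.mem_ofPred_eq] at hx
        have h1 := hx.2
        rw [hg x hx.1] at h1
        simp only [coe_insert, coe_singleton, Set.mem_insert_iff, Set.mem_singleton_iff,
          hr x hx.1]
        omega
      · intro x hx y hy hxy
        simp only [coe_filter, Set.mem_ofPred_eq] at hx hy
        rw [hr x hx.1, hr y hy.1] at hxy
        simpa using φ.injective (Fin.ext hxy)
    exact this.trans card_le_two
  have hex : ∀ q ∈ powersetCard 2 (range ((k + 3) / 2)),
      ∃ c ⊆ S.filter (fun x => g x ∉ q), c.card = k - 2 := by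
    intro q hq
    apply exists_subset_card_eq
    have h1 : (S.filter (fun x => g x ∈ q)).card ≤ q.card * 2 := by
      have : S.filter (fun x => g x ∈ q) = q.biUnion fun i => S.filter (fun x => g x = i) := by
        ext x
        simp [and_comm]
      rw [this]
      exact card_biUnion_le_card_mul _ _ _ fun i _ => hfib i
    have h2 := card_filter_add_card_filter_not (s := S) (fun x => g x ∈ q)
    rw [(mem_powersetCard.1 hq).2] at h1
    omega
  choose! c hc hcard using hex
  refine ⟨(powersetCard 2 (range ((k + 3) / 2))).image c, ⟨?_, ?_⟩, ?_⟩
  · intro d hd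
    obtain ⟨q, hq, rfl⟩ := mem_image.1 hd
    exact hcard q hq
  · intro f hf
    have h1 : ((S \ f).image g).card ≤ 2 := by
      refine card_image_le.trans ?_
      rw [card_sdiff_of_subset (hHS f hf), hS, hH f hf]
      omega
    have h2 : (S \ f).image g ⊆ range ((k + 3) / 2) := by
      intro i hi
      obtain ⟨x, hx, rfl⟩ := mem_image.1 hi
      exact mem_range.2 (hlt x (mem_sdiff.1 hx).1)
    obtain ⟨q, hq1, hq2, hq3⟩ := exists_subsuperset_card_eq h2 h1 (by rw [card_range]; omega)
    have hq : q ∈ powersetCard 2 (range ((k + 3) / 2)) := mem_powersetCard.2 ⟨hq2, hq3⟩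
    refine ⟨c q, mem_image_of_mem _ hq, fun x hx => ?_⟩
    have hx' := mem_filter.1 (hc q hq hx)
    by_contra hxf
    exact hx'.2 (hq1 (mem_image_of_mem g (mem_sdiff.2 ⟨hx'.1, hxf⟩)))
  · exact card_image_le.trans (by rw [card_powersetCard, card_range])

/-- The sets `e \ f` of size two all meet `{a, c}`. -/
theorem exists_cover_of_meets_pair {k : ℕ} {H : Finset (Finset V)} {e : Finset V}
    (he : e.card = k) (h2 : ∀ f ∈ H, (e \ f).card ≤ 2) {a c : V} (ha : a ∈ e) (hc : c ∈ e)
    (hac : a ≠ c) (h : ∀ f ∈ H, (e \ f).card = 2 → ¬ Disjoint {a, c} (e \ f)) :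
    ∃ C, IsCover (k - 2) H C ∧ C.card ≤ 2 * k - 3 := by
  let T : Finset (Finset V) :=
    (e.erase a).image (fun v => {a, v}) ∪ ((e.erase a).erase c).image (fun v => {c, v})
  have hc' : c ∈ e.erase a := mem_erase.2 ⟨hac.symm, hc⟩
  have hTcard : T.card ≤ 2 * k - 3 := by
    refine (card_union_le _ _).trans ?_
    have h1 := card_image_le (s := e.erase a) (f := fun v => ({a, v} : Finset V))
    have h3 := card_image_le (s := (e.erase a).erase c) (f := fun v => ({c, v} : Finset V))
    rw [card_erase_of_mem hc'] at h3
    rw [card_erase_of_mem ha] at h1 h3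
    omega
  have haT : ∀ v ∈ e, v ≠ a → ({a, v} : Finset V) ∈ T := fun v hv hva =>
    mem_union_left _ (mem_image_of_mem (fun v => ({a, v} : Finset V)) (mem_erase.2 ⟨hva, hv⟩))
  have hcT : ∀ v ∈ e, v ≠ c → ({c, v} : Finset V) ∈ T := by
    intro v hv hvc
    by_cases hva : v = a
    · rw [hva, pair_comm]
      exact haT c hc hac.symm
    · exact mem_union_right _ (mem_image_of_mem (fun v => ({c, v} : Finset V))
        (mem_erase.2 ⟨hvc, mem_erase.2 ⟨hva, hv⟩⟩))
  obtain ⟨C, hC, hCT⟩ := exists_cover_of_pairs (H := H) he T (by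
    intro p hp
    simp only [T, mem_union, mem_image, mem_erase] at hp
    rcases hp with ⟨v, hv, rfl⟩ | ⟨v, hv, rfl⟩
    · exact ⟨by simp [insert_subset_iff, ha, hv.2], card_pair hv.1.symm⟩
    · exact ⟨by simp [insert_subset_iff, hc, hv.2.2], card_pair hv.1.symm⟩) (by
    intro f hf
    rcases (h2 f hf).lt_or_eq with hlt | heq
    · rcases (e \ f).eq_empty_or_nonempty with h0 | ⟨v, hv⟩
      · exact ⟨{a, c}, haT c hc hac.symm, by simp [h0]⟩
      · have h1 : e \ f ⊆ {v} := fun x hx => by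
          rw [mem_singleton]
          exact card_le_one.1 (by omega) x hx v hv
        have hve := (mem_sdiff.1 hv).1
        by_cases hva : v = a
        · subst hva
          exact ⟨{v, c}, haT c hc hac.symm, h1.trans (by simp)⟩
        · exact ⟨{a, v}, haT v hve hva, h1.trans (by simp)⟩
    · obtain ⟨x, y, hxy, hef⟩ := card_eq_two.1 heq
      have hx : x ∈ e := (mem_sdiff.1 (hef ▸ mem_insert_self x {y})).1
      have hy : y ∈ e := (mem_sdiff.1 (hef ▸ mem_insert_of_mem (mem_singleton_self y))).1
      refine ⟨e \ f, ?_, le_rfl⟩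
      have := h f hf heq
      rw [hef] at this ⊢
      obtain ⟨z, hz, hz'⟩ := not_disjoint_iff.1 this
      simp only [mem_insert, mem_singleton] at hz hz'
      rcases hz' with rfl | rfl <;> rcases hz with rfl | rfl
      · exact haT y hy hxy.symm
      · exact hcT y hy hxy.symm
      · rw [pair_comm]
        exact haT x hx hxy
      · rw [pair_comm]
        exact hcT x hx hxy)
  exact ⟨C, hC, hCT.trans hTcard⟩

/-- The sets `e \ f` of size two all lie in a set of four vertices. -/
theorem exists_cover_of_subset_four {k : ℕ} {H : Finset (Finset V)} {e F : Finset V}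
    (he : e.card = k) (h2 : ∀ f ∈ H, (e \ f).card ≤ 2) (hFe : F ⊆ e) (hF : F.card = 4)
    (h : ∀ f ∈ H, (e \ f).card = 2 → e \ f ⊆ F) :
    ∃ C, IsCover (k - 2) H C ∧ C.card ≤ k + 2 := by
  obtain ⟨a, ha⟩ : F.Nonempty := card_pos.1 (by omega)
  let T : Finset (Finset V) := powersetCard 2 F ∪ (e \ F).image (fun v => {a, v})
  have hTcard : T.card ≤ k + 2 := by
    refine (card_union_le _ _).trans ?_
    have h1 := card_image_le (s := e \ F) (f := fun v => ({a, v} : Finset V))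
    have h3 := card_le_card hFe
    rw [card_sdiff_of_subset hFe] at h1
    have h4 : Nat.choose 4 2 = 6 := rfl
    rw [card_powersetCard, hF, h4]
    omega
  have hFT : ∀ s ⊆ F, s.card ≤ 2 → ∃ p ∈ T, s ⊆ p := by
    intro s hs hs2
    obtain ⟨p, hp1, hp2, hp3⟩ := exists_subsuperset_card_eq hs hs2 (by omega)
    exact ⟨p, mem_union_left _ (mem_powersetCard.2 ⟨hp2, hp3⟩), hp1⟩
  obtain ⟨C, hC, hCT⟩ := exists_cover_of_pairs (H := H) he T (by
    intro p hp
    simp only [T, mem_union, mem_image, mem_sdiff, mem_powersetCard] at hp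
    rcases hp with hp | ⟨v, hv, rfl⟩
    · exact ⟨hp.1.trans hFe, hp.2⟩
    · refine ⟨by simp [insert_subset_iff, hFe ha, hv.1], card_pair ?_⟩
      rintro rfl
      exact hv.2 ha) (by
    intro f hf
    by_cases hs : e \ f ⊆ F
    · exact hFT _ hs (h2 f hf)
    · obtain ⟨v, hv, hvF⟩ := not_subset.1 hs
      have hlt : (e \ f).card ≤ 1 := by
        have h3 := h2 f hf
        have h4 : (e \ f).card ≠ 2 := fun h5 => hs (h f hf h5)
        omega
      refine ⟨{a, v}, mem_union_right _ (mem_image_of_mem (fun v => ({a, v} : Finset V))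
        (mem_sdiff.2 ⟨(mem_sdiff.1 hv).1, hvF⟩)), fun x hx => ?_⟩
      rw [card_le_one.1 hlt x hx v hv]
      simp)
  exact ⟨C, hC, hCT.trans hTcard⟩

theorem exists_cover_of_five_le {k : ℕ} (hk : 5 ≤ k) {H : Finset (Finset V)}
    (hH : ∀ e ∈ H, e.card = k) (hint : ∀ e ∈ H, ∀ f ∈ H, k - 2 ≤ (e ∩ f).card)
    {e : Finset V} (heH : e ∈ H) :
    ∃ C, IsCover (k - 2) H C ∧ C.card ≤ (k ^ 2 + 3) / 4 := by
  have he := hH e heH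
  have h2 : ∀ f ∈ H, (e \ f).card ≤ 2 := fun f hf => card_sdiff_le_two he (hint e heH f hf)
  have hB : ∀ f ∈ H, ∀ g ∈ H, (e \ f).card = 2 → Disjoint (e \ f) (e \ g) → g \ e ⊆ f \ e :=
    fun f hf g hg => sdiff_subset_sdiff_of_disjoint he (hH g hg) (hint f hf g hg)
  have hcard : ∀ f ∈ H, (f \ e).card = (e \ f).card := fun f hf =>
    card_sdiff_comm ((hH f hf).trans he.symm)
  have hBeq : ∀ f ∈ H, ∀ g ∈ H, (e \ f).card = 2 → (e \ g).card = 2 →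
      Disjoint (e \ f) (e \ g) → g \ e = f \ e := fun f hf g hg hf2 hg2 hd =>
    (hB f hf g hg hf2 hd).antisymm (hB g hg f hf hg2 hd.symm)
  by_cases hcase : ∃ p ⊆ e, p.card = 2 ∧ ∀ f ∈ H, (e \ f).card = 2 → ¬ Disjoint p (e \ f)
  · obtain ⟨p, hpe, hp, hmeet⟩ := hcase
    obtain ⟨a, c, hac, rfl⟩ := card_eq_two.1 hp
    obtain ⟨C, hC, hCc⟩ := exists_cover_of_meets_pair he h2 (hpe (mem_insert_self a {c}))
      (hpe (mem_insert_of_mem (mem_singleton_self c))) hac hmeet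
    refine ⟨C, hC, hCc.trans ?_⟩
    rw [Nat.le_div_iff_mul_le (by norm_num)]
    obtain ⟨n, rfl⟩ := Nat.exists_eq_add_of_le hk
    have : 2 * (5 + n) - 3 = 2 * n + 7 := by omega
    rw [this]
    nlinarith [Nat.le_mul_self n]
  push Not at hcase
  obtain ⟨p₀, hp₀e, hp₀⟩ := exists_subset_card_eq (s := e) (n := 2) (by omega)
  obtain ⟨f₁, hf₁, hf₁c, -⟩ := hcase p₀ hp₀e hp₀
  obtain ⟨f₂, hf₂, hf₂c, hd⟩ := hcase (e \ f₁) sdiff_subset hf₁c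
  have hP : f₂ \ e = f₁ \ e := hBeq f₁ hf₁ f₂ hf₂ hf₁c hf₂c hd
  by_cases hall : ∀ f ∈ H, f ⊆ e ∪ f₁
  · have hS : (e ∪ f₁).card = k + 2 := by
      rw [← union_sdiff_self_eq_union, card_union_of_disjoint disjoint_sdiff, he,
        hcard f₁ hf₁, hf₁c]
    obtain ⟨C, hC, hCc⟩ := exists_cover_of_subset (by omega) hH hS hall
    refine ⟨C, hC, hCc.trans ?_⟩
    rw [Nat.le_div_iff_mul_le (by norm_num), Nat.choose_two_right]
    obtain ⟨n, hn | hn⟩ : ∃ n, k = 2 * n ∨ k = 2 * n + 1 := ⟨k / 2, by omega⟩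
    · have h1 : (k + 3) / 2 = n + 1 := by omega
      have h3 := Nat.div_mul_le_self ((n + 1) * (n + 1 - 1)) 2
      rw [h1, hn]
      simp only [Nat.add_sub_cancel] at h3 ⊢
      nlinarith
    · have h1 : (k + 3) / 2 = n + 2 := by omega
      have h3 := Nat.div_mul_le_self ((n + 2) * (n + 2 - 1)) 2
      have h4 : n + 2 - 1 = n + 1 := rfl
      rw [h1, hn]
      rw [h4] at h3 ⊢
      nlinarith
  push Not at hall
  obtain ⟨f, hf, hfs⟩ := hall
  have hfP : ¬ f \ e ⊆ f₁ \ e := by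
    intro h
    refine hfs fun x hx => ?_
    by_cases hxe : x ∈ e
    · exact mem_union_left _ hxe
    · exact mem_union_right _ (mem_sdiff.1 (h (mem_sdiff.2 ⟨hx, hxe⟩))).1
  have key : ∀ g ∈ H, ¬ g \ e ⊆ f₁ \ e → (e \ g).card = 2 ∧ e \ g ⊆ (e \ f₁) ∪ (e \ f₂) := by
    intro g hg hgP
    have h3 : ¬ Disjoint (e \ f₁) (e \ g) := fun h => hgP (hB f₁ hf₁ g hg hf₁c h)
    have h4 : ¬ Disjoint (e \ f₂) (e \ g) := fun h => hgP (hP ▸ hB f₂ hf₂ g hg hf₂c h)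
    obtain ⟨x, hx, hxg⟩ := not_disjoint_iff.1 h3
    obtain ⟨y, hy, hyg⟩ := not_disjoint_iff.1 h4
    have hxy : x ≠ y := by
      rintro rfl
      exact disjoint_left.1 hd hx hy
    have hsub : {x, y} ⊆ e \ g := by simp only [insert_subset_iff, singleton_subset_iff, hxg, hyg,
      and_self]
    have heq : {x, y} = e \ g := eq_of_subset_of_card_le hsub (by
      rw [card_pair hxy]
      exact h2 g hg)
    rw [← heq]
    refine ⟨card_pair hxy, ?_⟩
    rw [insert_subset_iff, singleton_subset_iff]
    exact ⟨mem_union_left _ hx, mem_union_right _ hy⟩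
  obtain ⟨hfc, hfF⟩ := key f hf hfP
  obtain ⟨f₃, hf₃, hf₃c, hd₃⟩ := hcase (e \ f) sdiff_subset hfc
  have hQ : f₃ \ e = f \ e := hBeq f hf f₃ hf₃ hfc hf₃c hd₃
  have hsep : ∀ g, (e \ g).card = 2 → ∀ w ∈ e \ g, ∀ A B : Finset V, w ∉ A → w ∉ B →
      Disjoint A B → Disjoint A (e \ g) ∨ Disjoint B (e \ g) := by
    intro g hgc w hw A B hA hB hAB
    by_contra! hcon
    obtain ⟨x, hxA, hxg⟩ := not_disjoint_iff.1 hcon.1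
    obtain ⟨y, hyB, hyg⟩ := not_disjoint_iff.1 hcon.2
    have hxy : x ≠ y := by
      rintro rfl
      exact disjoint_left.1 hAB hxA hyB
    have hwx : w ≠ x := by
      rintro rfl
      exact hA hxA
    have hwy : w ≠ y := by
      rintro rfl
      exact hB hyB
    have : 2 < (e \ g).card := two_lt_card.2 ⟨w, hw, x, hxg, y, hyg, hwx, hwy, hxy⟩
    omega
  obtain ⟨C, hC, hCc⟩ := exists_cover_of_subset_four (F := (e \ f₁) ∪ (e \ f₂)) he h2
    (union_subset sdiff_subset sdiff_subset) (by rw [card_union_of_disjoint hd, hf₁c, hf₂c]) (by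
      intro g hg hgc
      by_contra hsub
      obtain ⟨w, hw, hwF⟩ := not_subset.1 hsub
      have hw1 : w ∉ e \ f₁ := fun h => hwF (mem_union_left _ h)
      have hw2 : w ∉ e \ f₂ := fun h => hwF (mem_union_right _ h)
      have hwf : w ∉ e \ f := fun h => hwF (hfF h)
      have hwf₃ : w ∉ e \ f₃ := fun h =>
        hwF ((key f₃ hf₃ (by rwa [hQ])).2 h)
      have hg1 : g \ e = f₁ \ e := by
        rcases hsep g hgc w hw _ _ hw1 hw2 hd with h | h
        · exact hBeq f₁ hf₁ g hg hf₁c hgc h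
        · exact (hBeq f₂ hf₂ g hg hf₂c hgc h).trans hP
      have hg2 : g \ e = f \ e := by
        rcases hsep g hgc w hw _ _ hwf hwf₃ hd₃ with h | h
        · exact hBeq f hf g hg hfc hgc h
        · exact (hBeq f₃ hf₃ g hg hf₃c hgc h).trans hQ
      exact hfP (by rw [← hg2, hg1]))
  refine ⟨C, hC, hCc.trans ?_⟩
  rw [Nat.le_div_iff_mul_le (by norm_num)]
  nlinarith

/-- Two complementary pairs in an edge of size four are served by a single pair. -/
theorem exists_pair_subset {H : Finset (Finset V)} (hH : ∀ e ∈ H, e.card = 4)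
    (hint : ∀ e ∈ H, ∀ f ∈ H, 2 ≤ (e ∩ f).card) {e p q : Finset V} (he : e ∈ H)
    (hp : p.card = 2) (hq : q.card = 2) (hpq : Disjoint p q) (hpe : e = p ∪ q) :
    ∃ c : Finset V, c.card = 2 ∧ ∀ f ∈ H, e \ f = p ∨ e \ f = q → c ⊆ f := by
  have hsub : ∀ f, e \ f = p → q ⊆ f := fun f hf x hx => by
    by_contra hxf
    exact disjoint_left.1 hpq (hf ▸ mem_sdiff.2 ⟨hpe ▸ mem_union_right _ hx, hxf⟩) hx
  have hsub' : ∀ f, e \ f = q → p ⊆ f := fun f hf x hx => by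
    by_contra hxf
    exact disjoint_left.1 hpq hx (hf ▸ mem_sdiff.2 ⟨hpe ▸ mem_union_left _ hx, hxf⟩)
  by_cases h1 : ∃ f ∈ H, e \ f = p
  · by_cases h2 : ∃ g ∈ H, e \ g = q
    · obtain ⟨f, hf, hfp⟩ := h1
      obtain ⟨g, hg, hgq⟩ := h2
      have hB : ∀ f ∈ H, ∀ g ∈ H, e \ f = p → e \ g = q → g \ e = f \ e := by
        intro f hf g hg hfp hgq
        have hd : Disjoint (e \ f) (e \ g) := by rwa [hfp, hgq]
        exact (sdiff_subset_sdiff_of_disjoint (hH e he) (hH g hg) (hint f hf g hg)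
          (by rw [hfp, hp]) hd).antisymm
          (sdiff_subset_sdiff_of_disjoint (hH e he) (hH f hf) (hint g hg f hf)
          (by rw [hgq, hq]) hd.symm)
      refine ⟨f \ e, ?_, ?_⟩
      · rw [card_sdiff_comm ((hH f hf).trans (hH e he).symm), hfp, hp]
      · rintro x hx (hxp | hxq)
        · rw [← hB f hf g hg hfp hgq, hB x hx g hg hxp hgq]
          exact sdiff_subset
        · rw [← hB f hf x hx hfp hxq]
          exact sdiff_subset
    · push Not at h2
      refine ⟨q, hq, ?_⟩
      rintro f hf (h | h)
      · exact hsub f h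
      · exact absurd h (h2 f hf)
  · push Not at h1
    refine ⟨p, hp, ?_⟩
    rintro f hf (h | h)
    · exact absurd h (h1 f hf)
    · exact hsub' f h

theorem exists_cover_of_eq_four {H : Finset (Finset V)} (hH : ∀ e ∈ H, e.card = 4)
    (hint : ∀ e ∈ H, ∀ f ∈ H, 2 ≤ (e ∩ f).card) {e : Finset V} (heH : e ∈ H) :
    ∃ C, IsCover 2 H C ∧ C.card ≤ 4 := by
  have he := hH e heH
  obtain ⟨a, b, c, d, hab, hac, had, hbc, hbd, hcd, hed⟩ := card_eq_four.1 he
  obtain ⟨s, hs, hsf⟩ := exists_pair_subset hH hint heH (card_pair hac) (card_pair hbd)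
    (by simp [hbc, hab.symm, hcd.symm, had.symm])
    (by rw [hed]; ext x; simp; tauto)
  obtain ⟨t, ht, htf⟩ := exists_pair_subset hH hint heH (card_pair had) (card_pair hbc)
    (by simp [hcd, hbd, hab.symm, hac.symm])
    (by rw [hed]; ext x; simp; tauto)
  refine ⟨{{a, b}, {c, d}, s, t}, ⟨?_, ?_⟩, card_le_four⟩
  · intro x hx
    simp only [mem_insert, mem_singleton] at hx
    rcases hx with rfl | rfl | rfl | rfl
    · exact card_pair hab
    · exact card_pair hcd
    · exact hs
    · exact ht
  · intro f hf
    have h2 : (e \ f).card ≤ 2 := card_sdiff_le_two he (hint e heH f hf)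
    have hmem : ∀ x ∈ e, x ∉ f → x ∈ e \ f := fun x hx hxf => mem_sdiff.2 ⟨hx, hxf⟩
    have heq : ∀ x ∈ e, ∀ y ∈ e, x ≠ y → x ∉ f → y ∉ f → e \ f = {x, y} := by
      intro x hx y hy hxy hxf hyf
      refine (eq_of_subset_of_card_le ?_ (by rwa [card_pair hxy])).symm
      rw [insert_subset_iff, singleton_subset_iff]
      exact ⟨hmem x hx hxf, hmem y hy hyf⟩
    have hae : a ∈ e := by simp [hed]
    have hbe : b ∈ e := by simp [hed]
    have hce : c ∈ e := by simp [hed]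
    have hde : d ∈ e := by simp [hed]
    by_cases h3 : {a, b} ⊆ f
    · exact ⟨{a, b}, by simp, h3⟩
    by_cases h4 : {c, d} ⊆ f
    · exact ⟨{c, d}, by simp, h4⟩
    rw [insert_subset_iff, singleton_subset_iff, not_and_or] at h3 h4
    rcases h3 with h3 | h3 <;> rcases h4 with h4 | h4
    · exact ⟨s, by simp, hsf f hf (Or.inl (heq a hae c hce hac h3 h4))⟩
    · exact ⟨t, by simp, htf f hf (Or.inl (heq a hae d hde had h3 h4))⟩
    · exact ⟨t, by simp, htf f hf (Or.inr (heq b hbe c hce hbc h3 h4))⟩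
    · exact ⟨s, by simp, hsf f hf (Or.inr (heq b hbe d hde hbd h3 h4))⟩

end

/-- If `H` is a `k`-uniform hypergraph (`k ≥ 3`) with `ν^(k-2)(H) = 1`, then
`τ^(k-2)(H) ≤ ⌈k²/4⌉`; note `⌈k²/4⌉ = (k² + 3)/4` (in natural division) for every `k`. -/
theorem stmt5 {V : Type*} [DecidableEq V] (k : ℕ) (hk : 3 ≤ k)
    (H : Finset (Finset V)) (hH : ∀ e ∈ H, e.card = k)
    (hex : ∃ M, IsMatching (k - 2) H M ∧ M.card = 1)
    (hmax : ∀ M, IsMatching (k - 2) H M → M.card ≤ 1) :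
    ∃ C, IsCover (k - 2) H C ∧ C.card ≤ (k ^ 2 + 3) / 4 := by
  obtain ⟨M, hM, hM1⟩ := hex
  obtain ⟨e, rfl⟩ := card_eq_one.1 hM1
  have heH : e ∈ H := hM.1 (mem_singleton_self e)
  have hint : ∀ e ∈ H, ∀ f ∈ H, k - 2 ≤ (e ∩ f).card := fun e he f hf =>
    le_card_inter_of_matching_le_one hH hmax he hf
  have he := hH e heH
  obtain rfl | rfl | h5 : k = 3 ∨ k = 4 ∨ 5 ≤ k := by omega
  · obtain ⟨C, hC, hCc⟩ := exists_cover_of_pairs (H := H) he (powersetCard 2 e)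
      (fun p hp => mem_powersetCard.1 hp) (fun f hf => by
        obtain ⟨p, hp1, hp2, hp3⟩ := exists_subsuperset_card_eq (sdiff_subset (s := e) (t := f))
          (card_sdiff_le_two he (hint e heH f hf)) (by omega)
        exact ⟨p, mem_powersetCard.2 ⟨hp2, hp3⟩, hp1⟩)
    rw [card_powersetCard, he] at hCc
    exact ⟨C, hC, hCc⟩
  · exact exists_cover_of_eq_four hH hint heH
  · exact exists_cover_of_five_le h5 hH hint heH
end

section
/- Let H be a 5-uniform hypergraph with ν^(2)(H) = 1. Then τ^(2)(H) ≤ 7. -/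
open Finset

/-- A list of at most seven genuine pairs, one of which lies in each edge, gives a `2`-cover. -/
lemma exists_cover_of_pairs_s6 {V : Type*} [DecidableEq V] {H : Finset (Finset V)}
    (L : List (V × V)) (hlen : L.length ≤ 7) (hne : ∀ p ∈ L, p.1 ≠ p.2)
    (hcov : ∀ h ∈ H, ∃ p ∈ L, p.1 ∈ h ∧ p.2 ∈ h) :
    ∃ C, IsCover 2 H C ∧ C.card ≤ 7 := by
  refine ⟨(L.map fun p => ({p.1, p.2} : Finset V)).toFinset, ⟨?_, ?_⟩, ?_⟩
  · intro c hc
    obtain ⟨p, hp, rfl⟩ := List.mem_map.1 (List.mem_toFinset.1 hc)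
    exact card_pair (hne p hp)
  · intro h hh
    obtain ⟨p, hp, h1, h2⟩ := hcov h hh
    refine ⟨{p.1, p.2}, List.mem_toFinset.2 (List.mem_map.2 ⟨p, hp, rfl⟩), ?_⟩
    simp [insert_subset_iff, h1, h2]
  · exact (List.toFinset_card_le _).trans (by simpa using hlen)

lemma card_inter_toFinset {V : Type*} [DecidableEq V] (h : Finset V) {l : List V}
    (hl : l.Nodup) :
    (h ∩ l.toFinset).card = (l.map fun x => (decide (x ∈ h)).toNat).sum := by
  induction l with
  | nil => simp
  | cons a l ih =>
    rw [List.nodup_cons] at hl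
    by_cases ha : a ∈ h
    · rw [List.toFinset_cons, inter_insert_of_mem ha, card_insert_of_notMem (by simp [hl.1]),
        ih hl.2]
      simp [ha, add_comm]
    · rw [List.toFinset_cons, inter_insert_of_notMem ha, ih hl.2]
      simp [ha]

lemma sum_mem_le_card {V : Type*} [DecidableEq V] (h : Finset V) {l : List V} (hl : l.Nodup) :
    (l.map fun x => (decide (x ∈ h)).toNat).sum ≤ h.card :=
  card_inter_toFinset h hl ▸ card_le_card inter_subset_left

lemma nodup_of_perm_cons {α : Type*} {l l' : List α} {s : α} (hl : l.Nodup) (hs : s ∉ l)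
    (hp : l'.Perm (s :: l)) : l'.Nodup :=
  hp.nodup_iff.2 (List.nodup_cons.2 ⟨hs, hl⟩)

/-- A set `g` containing at least two points of a three-element set `X`. -/
lemma exists_eq_triple {V : Type*} [DecidableEq V] {X g : Finset V} (hX : X.card = 3)
    (hg : 2 ≤ (g ∩ X).card) :
    ∃ x y z, [x, y, z].Nodup ∧ X = {x, y, z} ∧ x ∈ g ∧ y ∈ g := by
  obtain ⟨x, hx, y, hy, hxy⟩ := one_lt_card.1 hg
  rw [mem_inter] at hx hy
  have hc : (X \ {x, y}).card = 1 := by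
    rw [card_sdiff_of_subset (by simp [insert_subset_iff, hx.2, hy.2]), hX, card_pair hxy]
  obtain ⟨z, hz⟩ := card_eq_one.1 hc
  have hzn : z ∉ ({x, y} : Finset V) := (mem_sdiff.1 (hz ▸ mem_singleton_self z)).2
  refine ⟨x, y, z, by simp at hzn ⊢; and_intros <;> grind, ?_, hx.1, hy.1⟩
  rw [← union_sdiff_of_subset (show {x, y} ⊆ X by simp [insert_subset_iff, hx.2, hy.2]), hz]
  ext; simp

/-- A five-element set with four known members. -/
lemma exists_eq_of_four_mem {V : Type*} [DecidableEq V] {h : Finset V} (hc : h.card = 5)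
    {a b c d : V} (hn : [a, b, c, d].Nodup) (hm : ∀ x ∈ [a, b, c, d], x ∈ h) :
    ∃ s ∈ h, s ∉ [a, b, c, d] ∧ h = [a, b, c, d, s].toFinset := by
  have hs : [a, b, c, d].toFinset ⊆ h := fun x hx => hm x (List.mem_toFinset.1 hx)
  have h1 : (h \ [a, b, c, d].toFinset).card = 1 := by
    rw [card_sdiff_of_subset hs, hc, List.toFinset_card_of_nodup hn]
    rfl
  obtain ⟨s, hs'⟩ := card_eq_one.1 h1
  have hsn := mem_sdiff.1 (hs' ▸ mem_singleton_self s)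
  refine ⟨s, hsn.1, fun hsm => hsn.2 (List.mem_toFinset.2 hsm), ?_⟩
  rw [← union_sdiff_of_subset hs, hs']
  ext; simp

lemma bool_three_of_five : ∀ x₀ x₁ x₂ x₃ x₄ : Bool,
    3 ≤ x₀.toNat + (x₁.toNat + (x₂.toNat + (x₃.toNat + x₄.toNat))) →
    x₀ ∧ x₁ ∨ x₀ ∧ x₂ ∨ x₁ ∧ x₂ ∨ x₃ ∧ x₄ := by
  decide

lemma bool_degenerate : ∀ x₀ x₁ x₂ x₃ x₄ x₅ x₆ x₇ : Bool,
    2 ≤ x₀.toNat + (x₁.toNat + (x₂.toNat + (x₃.toNat + x₆.toNat))) →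
    2 ≤ x₀.toNat + (x₁.toNat + (x₄.toNat + (x₅.toNat + x₇.toNat))) →
    2 ≤ x₂.toNat + (x₃.toNat + (x₄.toNat + (x₅.toNat + x₆.toNat))) →
    x₀ ∧ x₄ ∨ x₁ ∧ x₅ ∨ x₂ ∧ x₃ ∨ x₃ ∧ x₆ ∨ x₀ ∧ x₅ ∨ x₁ ∧ x₄ ∨ x₂ ∧ x₆ := by
  decide +kernel

set_option synthInstance.maxHeartbeats 400000 in
set_option synthInstance.maxSize 4000 in
lemma bool_triangle : ∀ x₀ x₁ x₂ x₃ x₄ x₅ x₆ x₇ x₈ : Bool,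
    2 ≤ x₀.toNat + (x₁.toNat + (x₂.toNat + (x₃.toNat + x₆.toNat))) →
    2 ≤ x₀.toNat + (x₁.toNat + (x₄.toNat + (x₅.toNat + x₇.toNat))) →
    2 ≤ x₂.toNat + (x₃.toNat + (x₄.toNat + (x₅.toNat + x₈.toNat))) →
    x₀.toNat + (x₁.toNat + (x₂.toNat + (x₃.toNat + (x₄.toNat + (x₅.toNat + (x₆.toNat +
      (x₇.toNat + x₈.toNat))))))) ≤ 5 →
    (x₀ ∧ x₅ ∨ x₂ ∧ x₃ ∨ x₃ ∧ x₄ ∨ x₆ ∧ x₇ ∨ x₀ ∧ x₈ ∨ x₁ ∧ x₅ ∨ x₂ ∧ x₄) ∨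
    ((x₁ ∧ x₂ ∧ x₇ ∧ x₈) ∧ !x₀ ∧ !x₃ ∧ !x₄ ∧ !x₅ ∧ !x₆) ∨
    ((x₁ ∧ x₃ ∧ x₇ ∧ x₈) ∧ !x₀ ∧ !x₂ ∧ !x₄ ∧ !x₅ ∧ !x₆) ∨
    ((x₁ ∧ x₄ ∧ x₆ ∧ x₈) ∧ !x₀ ∧ !x₂ ∧ !x₃ ∧ !x₅ ∧ !x₇) := by
  decide +kernel

set_option synthInstance.maxHeartbeats 400000 in
set_option synthInstance.maxSize 4000 in
lemma bool_quadruple : ∀ x₀ x₁ x₂ x₃ x₄ x₅ x₆ x₇ x₈ x₉ : Bool,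
    2 ≤ x₀.toNat + (x₁.toNat + (x₂.toNat + (x₃.toNat + x₆.toNat))) →
    2 ≤ x₀.toNat + (x₁.toNat + (x₄.toNat + (x₅.toNat + x₇.toNat))) →
    2 ≤ x₂.toNat + (x₃.toNat + (x₄.toNat + (x₅.toNat + x₈.toNat))) →
    2 ≤ x₁.toNat + (x₂.toNat + (x₇.toNat + (x₈.toNat + x₉.toNat))) →
    x₀.toNat + (x₁.toNat + (x₂.toNat + (x₃.toNat + (x₄.toNat + (x₅.toNat + (x₆.toNat +
      (x₇.toNat + (x₈.toNat + x₉.toNat)))))))) ≤ 5 →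
    x₁ ∧ x₅ ∨ x₀ ∧ x₈ ∨ x₃ ∧ x₇ ∨ x₂ ∧ x₄ ∨ x₁ ∧ x₄ ∨ x₀ ∧ x₂ ∨ x₂ ∧ x₇ := by
  decide +kernel

section

variable {V : Type*} [DecidableEq V] {H : Finset (Finset V)}

lemma exists_cover_of_three_intersecting (hH : ∀ e ∈ H, e.card = 5)
    (h3 : ∀ e ∈ H, ∀ f ∈ H, 3 ≤ (e ∩ f).card) :
    ∃ C, IsCover 2 H C ∧ C.card ≤ 7 := by
  obtain rfl | ⟨e, he⟩ := H.eq_empty_or_nonempty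
  · exact ⟨∅, by simp [IsCover], by simp⟩
  obtain ⟨l, hl, rfl⟩ : ∃ l : List V, l.Nodup ∧ l.toFinset = e :=
    ⟨e.toList, e.nodup_toList, e.toList_toFinset⟩
  have hlen : l.length = 5 := by rw [← List.toFinset_card_of_nodup hl, hH _ he]
  obtain ⟨v₀, v₁, v₂, v₃, v₄, rfl⟩ : ∃ a b c d e, l = [a, b, c, d, e] := by
    match l, hlen with
    | [a, b, c, d, e], _ => exact ⟨a, b, c, d, e, rfl⟩
  refine exists_cover_of_pairs_s6 [(v₀, v₁), (v₀, v₂), (v₁, v₂), (v₃, v₄)] (by simp)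
    (by simp at hl ⊢; tauto) fun h hh => ?_
  have key := h3 h hh _ he
  rw [card_inter_toFinset h hl] at key
  replace key := bool_three_of_five _ _ _ _ _ (by simpa using key)
  simpa using key

lemma exists_cover_of_degenerate {v₀ v₁ v₂ v₃ v₄ v₅ v₆ v₇ : V}
    (h2 : ∀ e ∈ H, ∀ f ∈ H, 2 ≤ (e ∩ f).card)
    (hn : [v₀, v₁, v₂, v₃, v₄, v₅, v₆, v₇].Nodup)
    (h₁ : [v₀, v₁, v₂, v₃, v₆].toFinset ∈ H) (h₂ : [v₀, v₁, v₄, v₅, v₇].toFinset ∈ H)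
    (h₃ : [v₂, v₃, v₄, v₅, v₆].toFinset ∈ H) :
    ∃ C, IsCover 2 H C ∧ C.card ≤ 7 := by
  refine exists_cover_of_pairs_s6
    [(v₀, v₄), (v₁, v₅), (v₂, v₃), (v₃, v₆), (v₀, v₅), (v₁, v₄), (v₂, v₆)] (by simp)
    (by simp at hn; simp [hn]) fun h hh => ?_
  have k₁ := h2 h hh _ h₁
  have k₂ := h2 h hh _ h₂
  have k₃ := h2 h hh _ h₃
  rw [card_inter_toFinset h (by simp at hn; simp [hn])] at k₁ k₂ k₃
  have key := bool_degenerate _ _ _ _ _ _ _ _ (by simpa using k₁) (by simpa using k₂)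
    (by simpa using k₃)
  simpa using key

lemma exists_cover_of_quadruple {v₀ v₁ v₂ v₃ v₄ v₅ v₆ v₇ v₈ v₉ : V}
    (hH : ∀ e ∈ H, e.card = 5) (h2 : ∀ e ∈ H, ∀ f ∈ H, 2 ≤ (e ∩ f).card)
    (hn : [v₀, v₁, v₂, v₃, v₄, v₅, v₆, v₇, v₈, v₉].Nodup)
    (h₁ : [v₀, v₁, v₂, v₃, v₆].toFinset ∈ H) (h₂ : [v₀, v₁, v₄, v₅, v₇].toFinset ∈ H)
    (h₃ : [v₂, v₃, v₄, v₅, v₈].toFinset ∈ H) (h₄ : [v₁, v₂, v₇, v₈, v₉].toFinset ∈ H) :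
    ∃ C, IsCover 2 H C ∧ C.card ≤ 7 := by
  refine exists_cover_of_pairs_s6
    [(v₁, v₅), (v₀, v₈), (v₃, v₇), (v₂, v₄), (v₁, v₄), (v₀, v₂), (v₂, v₇)] (by simp)
    (by simp at hn; simp [hn]) fun h hh => ?_
  have k₁ := h2 h hh _ h₁
  have k₂ := h2 h hh _ h₂
  have k₃ := h2 h hh _ h₃
  have k₄ := h2 h hh _ h₄
  have k₅ := (sum_mem_le_card h hn).trans (hH h hh).le
  rw [card_inter_toFinset h (by simp at hn; simp [hn])] at k₁ k₂ k₃ k₄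
  have key := bool_quadruple _ _ _ _ _ _ _ _ _ _ (by simpa using k₁) (by simpa using k₂)
    (by simpa using k₃) (by simpa using k₄) (by simpa using k₅)
  simpa using key

lemma exists_cover_of_triangle {v₀ v₁ v₂ v₃ v₄ v₅ v₆ v₇ v₈ : V}
    (hH : ∀ e ∈ H, e.card = 5) (h2 : ∀ e ∈ H, ∀ f ∈ H, 2 ≤ (e ∩ f).card)
    (hn : [v₀, v₁, v₂, v₃, v₄, v₅, v₆, v₇, v₈].Nodup)
    (h₁ : [v₀, v₁, v₂, v₃, v₆].toFinset ∈ H) (h₂ : [v₀, v₁, v₄, v₅, v₇].toFinset ∈ H)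
    (h₃ : [v₂, v₃, v₄, v₅, v₈].toFinset ∈ H) :
    ∃ C, IsCover 2 H C ∧ C.card ≤ 7 := by
  by_cases hc : ∀ h ∈ H, ∃ p ∈
      [(v₀, v₅), (v₂, v₃), (v₃, v₄), (v₆, v₇), (v₀, v₈), (v₁, v₅), (v₂, v₄)],
      p.1 ∈ h ∧ p.2 ∈ h
  · exact exists_cover_of_pairs_s6 _ (by simp) (by simp at hn; simp [hn]) hc
  push Not at hc
  obtain ⟨h, hh, hc⟩ := hc
  have k₁ := h2 h hh _ h₁
  have k₂ := h2 h hh _ h₂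
  have k₃ := h2 h hh _ h₃
  have k₄ := (sum_mem_le_card h hn).trans (hH h hh).le
  rw [card_inter_toFinset h (by simp at hn; simp [hn])] at k₁ k₂ k₃
  have key := bool_triangle _ _ _ _ _ _ _ _ _ (by simpa using k₁) (by simpa using k₂)
    (by simpa using k₃) (by simpa using k₄)
  simp only [decide_eq_true_eq, Bool.not_eq_true', decide_eq_false_iff_not] at key
  obtain key | key | key | key := key
  · simp at hc; clear * - hc key; grind
  · obtain ⟨s, hsh, hs, hs'⟩ := exists_eq_of_four_mem (hH h hh) (a := v₁) (b := v₂)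
      (c := v₇) (d := v₈) (by simp at hn; simp [hn]) (by simpa using key.1)
    have hsn : s ∉ [v₀, v₁, v₂, v₃, v₄, v₅, v₆, v₇, v₈] := by
      have key := key.2
      clear * - key hsh hs
      simp at hs key ⊢; and_intros <;> grind
    rw [hs'] at hh
    refine exists_cover_of_quadruple (v₀ := v₀) (v₁ := v₁) (v₂ := v₂) (v₃ := v₃) (v₄ := v₄)
      (v₅ := v₅) (v₆ := v₆) (v₇ := v₇) (v₈ := v₈) (v₉ := s) hH h2
      (nodup_of_perm_cons hn hsn ?_) h₁ h₂ h₃ hh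
    · simp [List.perm_iff_count, List.count_cons]; intros; ring
  · obtain ⟨s, hsh, hs, hs'⟩ := exists_eq_of_four_mem (hH h hh) (a := v₁) (b := v₃)
      (c := v₇) (d := v₈) (by simp at hn; simp [hn]) (by simpa using key.1)
    have hsn : s ∉ [v₀, v₁, v₂, v₃, v₄, v₅, v₆, v₇, v₈] := by
      have key := key.2
      clear * - key hsh hs
      simp at hs key ⊢; and_intros <;> grind
    rw [hs'] at hh
    refine exists_cover_of_quadruple (v₀ := v₀) (v₁ := v₁) (v₂ := v₃) (v₃ := v₂) (v₄ := v₄)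
      (v₅ := v₅) (v₆ := v₆) (v₇ := v₇) (v₈ := v₈) (v₉ := s) hH h2
      (nodup_of_perm_cons hn hsn ?_) ?_ h₂ ?_ hh
    · simp [List.perm_iff_count, List.count_cons]; intros; ring
    · convert h₁ using 1; ext; clear * -; simp; tauto
    · convert h₃ using 1; ext; clear * -; simp; tauto
  · obtain ⟨s, hsh, hs, hs'⟩ := exists_eq_of_four_mem (hH h hh) (a := v₁) (b := v₄)
      (c := v₆) (d := v₈) (by simp at hn; simp [hn]) (by simpa using key.1)
    have hsn : s ∉ [v₀, v₁, v₂, v₃, v₄, v₅, v₆, v₇, v₈] := by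
      have key := key.2
      clear * - key hsh hs
      simp at hs key ⊢; and_intros <;> grind
    rw [hs'] at hh
    refine exists_cover_of_quadruple (v₀ := v₀) (v₁ := v₁) (v₂ := v₄) (v₃ := v₅) (v₄ := v₂)
      (v₅ := v₃) (v₆ := v₇) (v₇ := v₆) (v₈ := v₈) (v₉ := s) hH h2
      (nodup_of_perm_cons hn hsn ?_) h₂ h₁ ?_ hh
    · simp [List.perm_iff_count, List.count_cons]; intros; ring
    · convert h₃ using 1; ext; clear * -; simp; tauto

lemma exists_cover_of_card_inter_eq_two (hH : ∀ e ∈ H, e.card = 5)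
    (h2 : ∀ e ∈ H, ∀ f ∈ H, 2 ≤ (e ∩ f).card) {e f : Finset V} (he : e ∈ H) (hf : f ∈ H)
    (hef : (e ∩ f).card = 2) :
    ∃ C, IsCover 2 H C ∧ C.card ≤ 7 := by
  obtain ⟨a, b, hab, hI⟩ := card_eq_two.1 hef
  have hX : (e \ f).card = 3 := by have := card_sdiff_add_card_inter e f; grind
  have hY : (f \ e).card = 3 := by
    have := card_sdiff_add_card_inter f e; rw [inter_comm] at this; grind
  have hmem : ∀ x, x ∈ e ∧ x ∈ f ↔ x = a ∨ x = b := fun x => by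
    rw [← mem_inter, hI]; simp
  by_cases hc : ∀ g ∈ H, ¬ (a ∉ g ∧ b ∉ g)
  · obtain ⟨x, y, z, hxy, hxz, hyz, hX'⟩ := card_eq_three.1 hX
    have hmX : ∀ w, w ∈ e ∧ w ∉ f ↔ w = x ∨ w = y ∨ w = z := fun w => by
      rw [← mem_sdiff, hX']; simp
    have hn : [a, b, x, y, z].Nodup := by simp; grind
    have he' : e = [a, b, x, y, z].toFinset := by ext w; simp; grind
    refine exists_cover_of_pairs_s6
      [(a, b), (a, x), (a, y), (a, z), (b, x), (b, y), (b, z)] (by simp)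
      (by simp at hn; simp [hn]) fun h hh => ?_
    obtain ⟨u, hu, w, hw, huw⟩ := one_lt_card.1 (h2 h hh e he)
    have := hc h hh
    simp [he'] at hu hw ⊢
    grind
  push Not at hc
  obtain ⟨g, hg, hag, hbg⟩ := hc
  have hgX : g ∩ (e \ f) = g ∩ e := by ext w; have := hmem w; simp; grind
  have hgY : g ∩ (f \ e) = g ∩ f := by ext w; have := hmem w; simp; grind
  obtain ⟨x, y, z, nX, hX', hx, hy⟩ := exists_eq_triple hX (hgX ▸ h2 g hg e he)
  obtain ⟨u, v, w, nY, hY', hu, hv⟩ := exists_eq_triple hY (hgY ▸ h2 g hg f hf)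
  have hmX : ∀ t, t ∈ e ∧ t ∉ f ↔ t = x ∨ t = y ∨ t = z := fun t => by
    rw [← mem_sdiff, hX']; simp
  have hmY : ∀ t, t ∈ f ∧ t ∉ e ↔ t = u ∨ t = v ∨ t = w := fun t => by
    rw [← mem_sdiff, hY']; simp
  have he' : e = [a, b, x, y, z].toFinset := by ext t; simp; grind
  have hf' : f = [a, b, u, v, w].toFinset := by ext t; simp; grind
  have hn : [a, b, x, y, u, v, z, w].Nodup := by
    have ha := (hmem a).2 (by simp)
    have hb := (hmem b).2 (by simp)
    have hx := (hmX x).2 (by simp)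
    have hy := (hmX y).2 (by simp)
    have hz := (hmX z).2 (by simp)
    have hu := (hmY u).2 (by simp)
    have hv := (hmY v).2 (by simp)
    have hw := (hmY w).2 (by simp)
    clear hmem hmX hmY hI hX hY hX' hY' hgX hgY he' hf' hH h2 hef
    simp at nX nY ⊢; and_intros <;> grind
  obtain ⟨s, hsg, hs, hg'⟩ := exists_eq_of_four_mem (hH g hg) (a := x) (b := y) (c := u) (d := v)
    (by simp at hn; simp [hn]) (by simp [*])
  have hsa : s ≠ a := by rintro rfl; exact hag hsg
  have hsb : s ≠ b := by rintro rfl; exact hbg hsg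
  rw [hg'] at hg
  rw [he'] at he
  rw [hf'] at hf
  by_cases hsz : s = z
  · subst hsz
    exact exists_cover_of_degenerate h2 hn he hf hg
  by_cases hsw : s = w
  · subst hsw
    refine exists_cover_of_degenerate (v₀ := a) (v₁ := b) (v₂ := u) (v₃ := v) (v₄ := x)
      (v₅ := y) (v₆ := s) (v₇ := z) h2 (by simp at hn ⊢; and_intros <;> grind) hf he ?_
    convert hg using 1; ext; clear * -; simp; tauto
  refine exists_cover_of_triangle (v₈ := s) hH h2 (nodup_of_perm_cons hn (s := s) ?_ ?_) he hf hg
  · clear * - hs hsa hsb hsz hsw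
    simp at hs ⊢; and_intros <;> grind
  · simp [List.perm_iff_count, List.count_cons]; intros; ring

end

/-- If `H` is a `5`-uniform hypergraph with `ν^(2)(H) = 1`, then `τ^(2)(H) ≤ 7`. -/
theorem stmt6 {V : Type*} [DecidableEq V]
    (H : Finset (Finset V)) (hH : ∀ e ∈ H, e.card = 5)
    (hex : ∃ M, IsMatching 2 H M ∧ M.card = 1)
    (hmax : ∀ M, IsMatching 2 H M → M.card ≤ 1) :
    ∃ C, IsCover 2 H C ∧ C.card ≤ 7 := by
  have h2 : ∀ e ∈ H, ∀ f ∈ H, 2 ≤ (e ∩ f).card := by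
    intro e he f hf
    by_contra! hlt
    obtain rfl | hne := eq_or_ne e f
    · rw [inter_self, hH e he] at hlt
      omega
    · have := hmax {e, f} ⟨by simp [insert_subset_iff, he, hf], by
        intro x hx y hy hxy
        simp only [mem_insert, mem_singleton] at hx hy
        obtain rfl | rfl := hx <;> obtain rfl | rfl := hy
        · exact absurd rfl hxy
        · exact hlt
        · rwa [inter_comm]
        · exact absurd rfl hxy⟩
      rw [card_pair hne] at this
      omega
  by_cases h : ∃ e ∈ H, ∃ f ∈ H, (e ∩ f).card = 2
  · obtain ⟨e, he, f, hf, hef⟩ := h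
    exact exists_cover_of_card_inter_eq_two hH h2 he hf hef
  · push Not at h
    exact exists_cover_of_three_intersecting hH fun e he f hf =>
      lt_of_le_of_ne (h2 e he f hf) (h e he f hf).symm
end

section
/- There exists a 5-uniform hypergraph H with ν^(2)(H) = 1 and τ^(2)(H) ≥ 6. (Such a hypergraph is given by the block set of the symmetric 2-(11,5,2) design.) -/
open Finset

/-- The translates of the set of quadratic residues modulo `11`, i.e. the blocks of the symmetric
`2-(11,5,2)` design. -/
def paleyBlock (i : Fin 11) : Finset (Fin 11) := {1 + i, 3 + i, 4 + i, 5 + i, 9 + i}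

theorem card_paleyBlock (i : Fin 11) : (paleyBlock i).card = 5 := by
  revert i; decide

theorem two_le_card_paleyBlock_inter (i j : Fin 11) :
    2 ≤ (paleyBlock i ∩ paleyBlock j).card := by
  revert i j; decide +kernel

theorem card_filter_mem_paleyBlock_le (a b : Fin 11) (hab : a ≠ b) :
    (univ.filter fun i => a ∈ paleyBlock i ∧ b ∈ paleyBlock i).card ≤ 2 := by
  revert a b; decide +kernel

/-- A family of pairs such that every block contains one of them has at least six members. -/
theorem six_le_card_of_forall_exists_subset_paleyBlock (C : Finset (Finset (Fin 11)))
    (hC : ∀ c ∈ C, c.card = 2) (hcov : ∀ i, ∃ c ∈ C, c ⊆ paleyBlock i) : 6 ≤ C.card := by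
  have h : (univ : Finset (Fin 11)).card ≤ C.card * 2 := by
    refine (card_le_card (t := C.biUnion fun c => univ.filter fun i => c ⊆ paleyBlock i) ?_).trans
      (card_biUnion_le_card_mul _ _ _ ?_)
    · intro i _
      simpa using hcov i
    · intro c hc
      obtain ⟨a, b, hab, rfl⟩ := card_eq_two.mp (hC c hc)
      simpa [insert_subset_iff] using card_filter_mem_paleyBlock_le a b hab
  rw [card_univ, Fintype.card_fin] at h
  omega

/-- There exists a `5`-uniform hypergraph `H` (e.g. the block set of the symmetric
`2-(11,5,2)` design, on 11 vertices) with `ν^(2)(H) = 1` and `τ^(2)(H) ≥ 6`. -/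
theorem stmt7 : ∃ H : Finset (Finset (Fin 11)),
    (∀ e ∈ H, e.card = 5) ∧
    (∃ M, IsMatching 2 H M ∧ M.card = 1) ∧
    (∀ M, IsMatching 2 H M → M.card ≤ 1) ∧
    (∀ C, IsCover 2 H C → 6 ≤ C.card) := by
  refine ⟨univ.image paleyBlock, ?_, ⟨{paleyBlock 0}, ⟨?_, ?_⟩, card_singleton _⟩, ?_, ?_⟩
  · simp [card_paleyBlock]
  · simp
  · simp
  · rintro M ⟨hMH, hM⟩
    refine card_le_one.mpr fun e he f hf => ?_
    by_contra hef
    obtain ⟨i, -, rfl⟩ := mem_image.mp (hMH he)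
    obtain ⟨j, -, rfl⟩ := mem_image.mp (hMH hf)
    exact (hM _ he _ hf hef).not_ge (two_le_card_paleyBlock_inter i j)
  · rintro C ⟨hC, hcov⟩
    exact six_le_card_of_forall_exists_subset_paleyBlock C hC fun i =>
      hcov _ (mem_image_of_mem _ (mem_univ i))
end

section
/- Let k ≥ 2 and let H be a 2k-uniform hypergraph with ν^(k)(H) = 1. Then τ*^(k)(H) ≤ (1/2 + 1/(2(k+1)))·C(2k,k), where C(2k,k) denotes the binomial coefficient 2k choose k. -/
open Finset

/-- `w` is a fractional `m`-cover of the hypergraph `H`: a nonnegative weighting of the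
`m`-sets such that every edge of `H` receives total weight at least 1 from its `m`-subsets. -/
def IsFracCover {V : Type*} (m : ℕ) (H : Finset (Finset V)) (w : Finset V → ℝ) : Prop :=
  (∀ S, 0 ≤ w S) ∧ ∀ e ∈ H, 1 ≤ ∑ S ∈ e.powersetCard m, w S

/-- The size of a fractional `m`-cover: the total weight over all `m`-subsets of `V`. -/
def fracSize {V : Type*} [Fintype V] (m : ℕ) (w : Finset V → ℝ) : ℝ :=
  ∑ S ∈ (Finset.univ : Finset V).powersetCard m, w S

/-- Linear programming duality for covering problems with unit costs and unit demands. -/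
lemma exists_weight_of_dual_bound {ι κ : Type*} [Fintype ι] [Fintype κ] [Nonempty κ]
    (A : ι → κ → ℝ) (hA : ∀ i s, 0 ≤ A i s) (b : ℝ) (hb : 0 < b)
    (h : ∀ y : ι → ℝ, (∀ i, 0 ≤ y i) → (∀ s, ∑ i, y i * A i s ≤ 1) → ∑ i, y i ≤ b) :
    ∃ w : κ → ℝ, (∀ s, 0 ≤ w s) ∧ ∑ s, w s ≤ b ∧ ∀ i, 1 ≤ ∑ s, A i s * w s := by
  classical
  let L : (κ → ℝ) →ₗ[ℝ] (ι → ℝ) := Matrix.mulVecLin (Matrix.of A)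
  have hL : ∀ w i, L w i = ∑ s, A i s * w s := fun w i => rfl
  let K : Set (ι → ℝ) := L '' stdSimplex ℝ κ
  let T : Set (ι → ℝ) := Set.Ici fun _ => 1 / b
  by_cases hd : Disjoint K T
  · exfalso
    obtain ⟨f, u, v, hfu, huv, hvf⟩ := geometric_hahn_banach_compact_closed
      ((convex_stdSimplex ℝ κ).linear_image L)
      ((isCompact_stdSimplex ℝ κ).image L.continuous_of_finiteDimensional)
      (convex_Ici _) isClosed_Ici hd
    let y : ι → ℝ := fun i => f (Pi.single i 1)
    have hf : ∀ z, f z = ∑ i, z i * y i := by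
      intro z
      conv_lhs => rw [← Finset.univ_sum_single z]
      rw [map_sum]
      refine sum_congr rfl fun i _ => ?_
      rw [← smul_eq_mul, ← map_smul, ← Pi.single_smul, smul_eq_mul, mul_one]
    have hy : ∀ i, 0 ≤ y i := by
      intro i
      by_contra! hneg
      obtain ⟨t, ht⟩ := exists_nat_gt ((f (fun _ => 1 / b) - v) / (-(y i)))
      have h1 := hvf ((fun _ => 1 / b) + (t : ℝ) • Pi.single i (1 : ℝ)) (by
        refine Set.mem_Ici.2 (le_add_of_nonneg_right (smul_nonneg (Nat.cast_nonneg t) ?_))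
        exact Pi.single_nonneg.2 zero_le_one)
      rw [map_add, map_smul, smul_eq_mul] at h1
      rw [div_lt_iff₀ (by linarith)] at ht
      change _ < _ + (t : ℝ) * y i at h1
      linarith
    have hdeg : ∀ s, ∑ i, y i * A i s < u := by
      intro s
      have h1 := hfu (L (Pi.single s 1)) ⟨_, single_mem_stdSimplex ℝ s, rfl⟩
      rw [hf] at h1
      simpa [hL, Pi.single_apply, mul_comm] using h1
    have hu : 0 < u :=
      lt_of_le_of_lt (sum_nonneg fun i _ => mul_nonneg (hy i) (hA i _))
        (hdeg (Classical.arbitrary κ))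
    have hv := hvf (fun _ => 1 / b) Set.self_mem_Ici
    rw [hf, ← mul_sum] at hv
    have hub := h (fun i => y i / u) (fun i => div_nonneg (hy i) hu.le) (fun s => by
      simp_rw [div_mul_eq_mul_div, ← sum_div]
      exact (div_le_one hu).2 (hdeg s).le)
    rw [← sum_div, div_le_iff₀ hu] at hub
    have : u < (∑ i, y i) / b := by rw [div_eq_inv_mul, ← one_div]; linarith
    rw [lt_div_iff₀ hb] at this
    linarith
  · obtain ⟨_, ⟨w, hw, rfl⟩, hT⟩ := Set.not_disjoint_iff.1 hd
    refine ⟨fun s => b * w s, fun s => mul_nonneg hb.le (hw.1 s), ?_, fun i => ?_⟩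
    · rw [← mul_sum, hw.2, mul_one]
    · have h1 : 1 / b ≤ L w i := hT i
      rw [div_le_iff₀ hb, hL, sum_mul] at h1
      exact h1.trans_eq (sum_congr rfl fun s _ => by ring)

section Intersecting

variable {V : Type*} [DecidableEq V] {k : ℕ} {H : Finset (Finset V)}

/-- If edges `f` and `g` of a `k`-intersecting `2k`-uniform family cut out complementary
`k`-subsets of an edge `e`, then `f` and `g` agree outside `e`. -/
lemma sdiff_eq_sdiff_of_inter_eq_compl (hH : ∀ e ∈ H, e.card = 2 * k)
    (hint : ∀ e ∈ H, ∀ f ∈ H, k ≤ (e ∩ f).card) {e f g S : Finset V}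
    (hf : f ∈ H) (hg : g ∈ H) (hS : S.card = k) (hS' : (e \ S).card = k)
    (hfe : f ∩ e = S) (hge : g ∩ e = e \ S) : f \ e = g \ e := by
  have hfc : (f \ e).card = k := by
    have := card_sdiff_add_card_inter f e
    rw [hfe, hS, hH f hf] at this
    omega
  have hgc : (g \ e).card = k := by
    have := card_sdiff_add_card_inter g e
    rw [hge, hS', hH g hg] at this
    omega
  have hdis : ∀ x ∈ f ∩ g, x ∉ e := by
    intro x hx hxe
    rw [mem_inter] at hx
    have h1 : x ∈ S := hfe ▸ mem_inter.2 ⟨hx.1, hxe⟩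
    have h2 : x ∈ e \ S := hge ▸ mem_inter.2 ⟨hx.2, hxe⟩
    exact (mem_sdiff.1 h2).2 h1
  have h1 : f ∩ g = f \ e := eq_of_subset_of_card_le
    (fun x hx => mem_sdiff.2 ⟨(mem_inter.1 hx).1, hdis x hx⟩) (hfc ▸ hint f hf g hg)
  have h2 : f ∩ g = g \ e := eq_of_subset_of_card_le
    (fun x hx => mem_sdiff.2 ⟨(mem_inter.1 hx).2, hdis x hx⟩) (hgc ▸ hint f hf g hg)
  exact h1.symm.trans h2

variable {y : Finset V → ℝ}

lemma sum_trace_le_one (hy : ∀ h ∈ H, 0 ≤ y h)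
    (hdeg : ∀ S, S.card = k → ∑ h ∈ H with S ⊆ h, y h ≤ 1) {e S : Finset V}
    (hS : S.card = k) : ∑ h ∈ H with h ∩ e = S, y h ≤ 1 := by
  refine (sum_le_sum_of_subset_of_nonneg ?_ ?_).trans (hdeg S hS)
  · intro h hh
    rw [mem_filter] at hh ⊢
    exact ⟨hh.1, hh.2 ▸ inter_subset_left⟩
  · exact fun h hh _ => hy h (mem_filter.1 hh).1

/-- If some edge meets the heaviest edge `e` in `e \ S`, then the edges meeting `e` in `S`
have total weight at most `1 / 2`. -/
lemma sum_trace_le_half (hk : 0 < k) (hH : ∀ e ∈ H, e.card = 2 * k)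
    (hint : ∀ e ∈ H, ∀ f ∈ H, k ≤ (e ∩ f).card) (hy : ∀ h ∈ H, 0 ≤ y h)
    (hdeg : ∀ S, S.card = k → ∑ h ∈ H with S ⊆ h, y h ≤ 1) {e g S : Finset V}
    (he : e ∈ H) (hmax : ∀ h ∈ H, y h ≤ y e) (hSe : S ⊆ e) (hS : S.card = k)
    (hg : g ∈ H) (hge : g ∩ e = e \ S) : ∑ h ∈ H with h ∩ e = S, y h ≤ 1 / 2 := by
  have hS' : (e \ S).card = k := by
    rw [card_sdiff_of_subset hSe, hS, hH e he]; omega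
  rcases (H.filter fun h => h ∩ e = S).eq_empty_or_nonempty with h0 | ⟨f, hf⟩
  · rw [h0, sum_empty]; norm_num
  obtain ⟨hfH, hfe⟩ := mem_filter.1 hf
  have huniq : (H.filter fun h => h ∩ e = S) = {f} := by
    refine eq_singleton_iff_unique_mem.2 ⟨hf, fun h hh => ?_⟩
    obtain ⟨hhH, hhe⟩ := mem_filter.1 hh
    rw [← sdiff_union_inter h e, ← sdiff_union_inter f e, hhe, hfe,
      sdiff_eq_sdiff_of_inter_eq_compl hH hint hhH hg hS hS' hhe hge,
      sdiff_eq_sdiff_of_inter_eq_compl hH hint hfH hg hS hS' hfe hge]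
  have hne : f ≠ e := by
    rintro rfl
    rw [inter_self] at hfe
    have := hH f hfH
    rw [hfe] at this
    omega
  have hpair : y f + y e ≤ 1 := by
    rw [← sum_pair hne]
    refine (sum_le_sum_of_subset_of_nonneg ?_ ?_).trans (hdeg S hS)
    · intro h hh
      rw [mem_insert, mem_singleton] at hh
      rcases hh with rfl | rfl
      · exact mem_filter.2 ⟨hfH, hfe ▸ inter_subset_left⟩
      · exact mem_filter.2 ⟨he, hSe⟩
    · exact fun h hh _ => hy h (mem_filter.1 hh).1
  rw [huniq, sum_singleton]
  linarith [hmax f hfH]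

lemma sum_trace_add_sum_trace_compl_le_one (hk : 0 < k) (hH : ∀ e ∈ H, e.card = 2 * k)
    (hint : ∀ e ∈ H, ∀ f ∈ H, k ≤ (e ∩ f).card) (hy : ∀ h ∈ H, 0 ≤ y h)
    (hdeg : ∀ S, S.card = k → ∑ h ∈ H with S ⊆ h, y h ≤ 1) {e S : Finset V}
    (he : e ∈ H) (hmax : ∀ h ∈ H, y h ≤ y e) (hSe : S ⊆ e) (hS : S.card = k) :
    (∑ h ∈ H with h ∩ e = S, y h) + ∑ h ∈ H with h ∩ e = e \ S, y h ≤ 1 := by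
  have hS' : (e \ S).card = k := by
    rw [card_sdiff_of_subset hSe, hS, hH e he]; omega
  rcases (H.filter fun h => h ∩ e = e \ S).eq_empty_or_nonempty with h0 | ⟨g, hg⟩
  · rw [h0, sum_empty, add_zero]
    exact sum_trace_le_one hy hdeg hS
  rcases (H.filter fun h => h ∩ e = S).eq_empty_or_nonempty with h0 | ⟨f, hf⟩
  · rw [h0, sum_empty, zero_add]
    exact sum_trace_le_one hy hdeg hS'
  obtain ⟨hgH, hge⟩ := mem_filter.1 hg
  obtain ⟨hfH, hfe⟩ := mem_filter.1 hf
  have h1 := sum_trace_le_half hk hH hint hy hdeg he hmax hSe hS hgH hge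
  have h2 := sum_trace_le_half hk hH hint hy hdeg he hmax sdiff_subset hS' hfH
    (by rw [hfe, Finset.sdiff_sdiff_eq_self hSe])
  linarith

/-- The edges meeting the heaviest edge in exactly `k` vertices have total weight at most
half of `C(2k, k)`. -/
lemma two_mul_sum_card_inter_eq_le (hk : 0 < k) (hH : ∀ e ∈ H, e.card = 2 * k)
    (hint : ∀ e ∈ H, ∀ f ∈ H, k ≤ (e ∩ f).card) (hy : ∀ h ∈ H, 0 ≤ y h)
    (hdeg : ∀ S, S.card = k → ∑ h ∈ H with S ⊆ h, y h ≤ 1) {e : Finset V}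
    (he : e ∈ H) (hmax : ∀ h ∈ H, y h ≤ y e) :
    2 * ∑ h ∈ H with (h ∩ e).card = k, y h ≤ ((2 * k).choose k : ℝ) := by
  let r : Finset V → ℝ := fun S => ∑ h ∈ H with h ∩ e = S, y h
  have hcompl : ∀ S ∈ e.powersetCard k, e \ S ∈ e.powersetCard k := by
    intro S hS
    rw [mem_powersetCard] at hS ⊢
    refine ⟨sdiff_subset, ?_⟩
    rw [card_sdiff_of_subset hS.1, hS.2, hH e he]; omega
  have hinv : ∀ S ∈ e.powersetCard k, e \ (e \ S) = S := fun S hS =>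
    Finset.sdiff_sdiff_eq_self (mem_powersetCard.1 hS).1
  have hsum : ∑ h ∈ H with (h ∩ e).card = k, y h = ∑ S ∈ e.powersetCard k, r S := by
    rw [← sum_fiberwise_of_maps_to (t := e.powersetCard k) (g := fun h => h ∩ e)
      (fun h hh => mem_powersetCard.2 ⟨inter_subset_right, (mem_filter.1 hh).2⟩)]
    refine sum_congr rfl fun S hS => ?_
    rw [filter_filter]
    refine sum_congr (filter_congr fun h _ => ?_) fun _ _ => rfl
    exact ⟨fun hh => hh.2, fun hh => ⟨hh ▸ (mem_powersetCard.1 hS).2, hh⟩⟩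
  have hswap : ∑ S ∈ e.powersetCard k, r (e \ S) = ∑ S ∈ e.powersetCard k, r S :=
    sum_nbij' (fun S => e \ S) (fun S => e \ S) hcompl hcompl hinv hinv fun _ _ => rfl
  calc 2 * ∑ h ∈ H with (h ∩ e).card = k, y h
      = ∑ S ∈ e.powersetCard k, (r S + r (e \ S)) := by
        rw [sum_add_distrib, hswap, hsum, two_mul]
    _ ≤ ∑ S ∈ e.powersetCard k, (1 : ℝ) := sum_le_sum fun S hS =>
        sum_trace_add_sum_trace_compl_le_one hk hH hint hy hdeg he hmax
          (mem_powersetCard.1 hS).1 (mem_powersetCard.1 hS).2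
    _ = ((2 * k).choose k : ℝ) := by
        rw [sum_const, card_powersetCard, hH e he, nsmul_eq_mul, mul_one]

/-- The bound on the size of a fractional `k`-matching of a `k`-intersecting `2k`-uniform
family. -/
lemma sum_le_of_fractional_matching (hk : 0 < k) (hH : ∀ e ∈ H, e.card = 2 * k)
    (hint : ∀ e ∈ H, ∀ f ∈ H, k ≤ (e ∩ f).card) (hy : ∀ h ∈ H, 0 ≤ y h)
    (hdeg : ∀ S, S.card = k → ∑ h ∈ H with S ⊆ h, y h ≤ 1) :
    ∑ h ∈ H, y h ≤ (1 / 2 + 1 / (2 * ((k : ℝ) + 1))) * ((2 * k).choose k : ℝ) := by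
  rcases H.eq_empty_or_nonempty with rfl | hne
  · rw [sum_empty]; positivity
  obtain ⟨e, he, hmax⟩ := exists_max_image H y hne
  have hq := two_mul_sum_card_inter_eq_le hk hH hint hy hdeg he hmax
  set C : ℝ := ((2 * k).choose k : ℝ) with hC
  have hcount : ∑ h ∈ H, y h * ((h ∩ e).card.choose k : ℝ) ≤ C := by
    calc ∑ h ∈ H, y h * ((h ∩ e).card.choose k : ℝ)
        = ∑ h ∈ H, ∑ S ∈ e.powersetCard k with S ⊆ h, y h := by
          refine sum_congr rfl fun h _ => ?_
          have : (e.powersetCard k).filter (· ⊆ h) = (h ∩ e).powersetCard k := by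
            ext S
            simp only [mem_filter, mem_powersetCard, subset_inter_iff]
            tauto
          rw [this, sum_const, card_powersetCard, nsmul_eq_mul, mul_comm]
      _ = ∑ S ∈ e.powersetCard k, ∑ h ∈ H with S ⊆ h, y h := by
          simp_rw [sum_filter]
          exact sum_comm
      _ ≤ ∑ S ∈ e.powersetCard k, (1 : ℝ) :=
          sum_le_sum fun S hS => hdeg S (mem_powersetCard.1 hS).2
      _ = C := by rw [sum_const, card_powersetCard, hH e he, nsmul_eq_mul, mul_one]
  have hlow : ((k : ℝ) + 1) * ∑ h ∈ H, y h - k * ∑ h ∈ H with (h ∩ e).card = k, y h ≤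
      ∑ h ∈ H, y h * ((h ∩ e).card.choose k : ℝ) := by
    rw [sum_filter, mul_sum, mul_sum, ← sum_sub_distrib]
    refine sum_le_sum fun h hh => ?_
    split_ifs with hcard
    · rw [hcard, Nat.choose_self]
      push_cast
      linarith
    · have h1 : k + 1 ≤ (h ∩ e).card := lt_of_le_of_ne (hint h hh e he) (Ne.symm hcard)
      have h2 : k + 1 ≤ (h ∩ e).card.choose k := by
        simpa using Nat.choose_le_choose k h1
      have h3 : (k : ℝ) + 1 ≤ ((h ∩ e).card.choose k : ℝ) := by exact_mod_cast h2
      nlinarith [mul_le_mul_of_nonneg_left h3 (hy h hh)]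
  have hk1 : (0 : ℝ) < k + 1 := by positivity
  have hbound : (1 / 2 + 1 / (2 * ((k : ℝ) + 1))) * C = (C + k * (C / 2)) / (k + 1) := by
    field_simp
    ring
  rw [hbound, le_div_iff₀ hk1]
  have := mul_le_mul_of_nonneg_left hq (Nat.cast_nonneg (α := ℝ) k)
  linarith

end Intersecting

/-- If `H` is a `2k`-uniform hypergraph (`k ≥ 2`) with `ν^(k)(H) = 1`, then
`τ*^(k)(H) ≤ (1/2 + 1/(2(k+1))) · C(2k, k)`. -/
theorem stmt8 {V : Type*} [Fintype V] [DecidableEq V] (k : ℕ) (hk : 2 ≤ k)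
    (H : Finset (Finset V)) (hH : ∀ e ∈ H, e.card = 2 * k)
    (hex : ∃ M, IsMatching k H M ∧ M.card = 1)
    (hmax : ∀ M, IsMatching k H M → M.card ≤ 1) :
    ∃ w, IsFracCover k H w ∧
      fracSize k w ≤ (1 / 2 + 1 / (2 * ((k : ℝ) + 1))) * ((2 * k).choose k : ℝ) := by
  have hint : ∀ e ∈ H, ∀ f ∈ H, k ≤ (e ∩ f).card := by
    intro e he f hf
    by_contra! hlt
    have hne : e ≠ f := by
      rintro rfl
      rw [inter_self, hH e he] at hlt
      omega
    have := hmax {e, f} ⟨by simp [insert_subset_iff, he, hf], by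
      simp only [mem_insert, mem_singleton]
      rintro a (rfl | rfl) b (rfl | rfl) hab
      · exact absurd rfl hab
      · exact hlt
      · rwa [inter_comm]
      · exact absurd rfl hab⟩
    rw [card_pair hne] at this
    omega
  have hb : 0 < (1 / 2 + 1 / (2 * ((k : ℝ) + 1))) * ((2 * k).choose k : ℝ) := by
    have : 0 < (2 * k).choose k := Nat.choose_pos (by omega)
    positivity
  obtain ⟨w, hw0, hwb, hw1⟩ := exists_weight_of_dual_bound
    (fun (e : H) (S : Finset V) => if S ∈ e.1.powersetCard k then (1 : ℝ) else 0)
    (fun e S => by split_ifs <;> norm_num) _ hb (fun y hy hdeg => by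
      let z : Finset V → ℝ := fun e => if he : e ∈ H then y ⟨e, he⟩ else 0
      have hz : ∀ e : H, z e = y e := fun e => by simp [z]
      have := sum_le_of_fractional_matching (y := z) (by omega) hH hint
        (fun e he => hz ⟨e, he⟩ ▸ hy _) (fun S hS => by
          refine le_trans (le_of_eq ?_) (hdeg S)
          rw [sum_filter, ← sum_coe_sort H]
          refine sum_congr rfl fun e _ => ?_
          simp [mem_powersetCard, hS, hz])
      rw [← sum_coe_sort H] at this
      simpa only [hz] using this)
  refine ⟨w, ⟨hw0, fun e he => (hw1 ⟨e, he⟩).trans_eq ?_⟩, le_trans ?_ hwb⟩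
  · simp only [ite_mul, one_mul, zero_mul]
    rw [sum_ite_mem, univ_inter]
  · exact sum_le_sum_of_subset_of_nonneg (subset_univ _) fun S _ _ => hw0 S
end

section
/- Let k ≥ 2 and let H be any 2k-uniform hypergraph. Then τ*^(k)(H) ≤ (1 − k/(4(k+2)))·C(2k,k)·ν^(k)(H), where C(2k,k) denotes the binomial coefficient 2k choose k. -/
open Finset

/-- The edge `f` meets no member of `M` other than `e` in `m` or more vertices. -/
def IsPrivate {V : Type*} [DecidableEq V] (m : ℕ) (M : Finset (Finset V)) (e f : Finset V) :
    Prop :=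
  ∀ e' ∈ M, e' ≠ e → (f ∩ e').card < m

/-- In a maximum matching, no edge can be exchanged for two private edges of small intersection. -/
lemma le_card_inter_of_isPrivate {V : Type*} [DecidableEq V] {m : ℕ}
    {H M : Finset (Finset V)} (hM : IsMatching m H M)
    (hmax : ∀ M', IsMatching m H M' → M'.card ≤ M.card) {e f g : Finset V} (he : e ∈ M)
    (hf : f ∈ H) (hg : g ∈ H) (hfm : m ≤ f.card) (hgm : m ≤ g.card) (hfg : f ≠ g)
    (pf : IsPrivate m M e f) (pg : IsPrivate m M e g) : m ≤ (f ∩ g).card := by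
  by_contra! hlt
  have hg' : g ∉ M.erase e := fun h => by
    have := pg g (mem_of_mem_erase h) (ne_of_mem_erase h)
    rw [inter_self] at this
    omega
  have hf' : f ∉ insert g (M.erase e) := fun h => by
    rcases mem_insert.1 h with h | h
    · exact hfg h
    · have := pf f (mem_of_mem_erase h) (ne_of_mem_erase h)
      rw [inter_self] at this
      omega
  have hmat : IsMatching m H (insert f (insert g (M.erase e))) := by
    refine ⟨?_, ?_⟩
    · intro x hx
      simp only [mem_insert, mem_erase] at hx
      rcases hx with rfl | rfl | hx
      · exact hf
      · exact hg
      · exact hM.1 hx.2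
    · intro x hx y hy hxy
      simp only [mem_insert, mem_erase] at hx hy
      rcases hx with rfl | rfl | hx <;> rcases hy with rfl | rfl | hy
      · exact absurd rfl hxy
      · exact hlt
      · exact pf y hy.2 hy.1
      · rwa [inter_comm]
      · exact absurd rfl hxy
      · exact pg y hy.2 hy.1
      · rw [inter_comm]; exact pf x hx.2 hx.1
      · rw [inter_comm]; exact pg x hx.2 hx.1
      · exact hM.2 x hx.2 y hy.2 hxy
  have h1 := hmax _ hmat
  rw [card_insert_of_notMem hf', card_insert_of_notMem hg', card_erase_of_mem he] at h1
  have := card_pos.2 ⟨e, he⟩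
  omega

/-- Two private edges cutting `e` into complementary halves agree outside `e`. -/
lemma sdiff_eq_sdiff_of_isPrivate {V : Type*} [DecidableEq V] {k : ℕ} (hk : 0 < k)
    {H M : Finset (Finset V)} (hH : ∀ e ∈ H, e.card = 2 * k) (hM : IsMatching k H M)
    (hmax : ∀ M', IsMatching k H M' → M'.card ≤ M.card) {e f g : Finset V} (he : e ∈ M)
    (hf : f ∈ H) (hg : g ∈ H) (pf : IsPrivate k M e f) (pg : IsPrivate k M e g)
    (hfe : (f ∩ e).card = k) (hge : g ∩ e = e \ (f ∩ e)) : f \ e = g \ e := by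
  have hfc := hH f hf
  have hgc := hH g hg
  have hec := hH e (hM.1 he)
  have hge' : (g ∩ e).card = k := by
    rw [hge, card_sdiff_of_subset inter_subset_right]; omega
  have hdisj : Disjoint (f ∩ e) (g ∩ e) := hge ▸ disjoint_sdiff
  have hfg : f ≠ g := by
    rintro rfl
    rw [disjoint_self_iff_empty] at hdisj
    rw [hdisj, card_empty] at hfe
    omega
  have hle := le_card_inter_of_isPrivate hM hmax he hf hg (by omega) (by omega) hfg pf pg
  have hsub : f ∩ g ⊆ (f \ e) ∩ (g \ e) := by
    intro x hx
    rw [mem_inter] at hx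
    have hxe : x ∉ e := fun h =>
      disjoint_left.1 hdisj (mem_inter.2 ⟨hx.1, h⟩) (mem_inter.2 ⟨hx.2, h⟩)
    simp [hx, hxe]
  have h1 := card_sdiff_add_card_inter f e
  have h2 := card_sdiff_add_card_inter g e
  have h3 := hle.trans (card_le_card hsub)
  rw [← eq_of_subset_of_card_le (inter_subset_left : (f \ e) ∩ (g \ e) ⊆ f \ e) (by omega)]
  exact eq_of_subset_of_card_le inter_subset_right (by omega)

/-- The weight charged to one edge `e` of a maximum matching. -/
lemma exists_local_weight {V : Type*} [Fintype V] [DecidableEq V] {k : ℕ} (hk : 0 < k)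
    {H M : Finset (Finset V)} (hH : ∀ e ∈ H, e.card = 2 * k) (hM : IsMatching k H M)
    (hmax : ∀ M', IsMatching k H M' → M'.card ≤ M.card) {e : Finset V} (he : e ∈ M) :
    ∃ w : Finset V → ℝ, (∀ S, 0 ≤ w S) ∧ (∀ S ∈ e.powersetCard k, 1 / 2 ≤ w S) ∧
      (∀ f ∈ H, IsPrivate k M e f → (f ∩ e).card = k → 1 ≤ ∑ S ∈ f.powersetCard k, w S) ∧
      fracSize k w ≤ 3 / 4 * ((2 * k).choose k : ℝ) := by
  classical
  have hec := hH e (hM.1 he)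
  let bad : Finset V → Prop := fun S => ∃ f ∈ H, IsPrivate k M e f ∧ f ∩ e = S
  let A : Finset V → Finset V := fun S => if h : bad S then h.choose \ e else ∅
  let c : Finset V → ℝ := fun S => 1 / 2 + if bad S ∧ ¬ bad (e \ S) then 1 / 2 else 0
  let d : Finset V → ℝ := fun S => if bad S ∧ bad (e \ S) then 1 / 4 else 0
  let P := e.powersetCard k
  let w : Finset V → ℝ := fun T =>
    (if T ∈ P then c T else 0) + ∑ S ∈ P, if T = A S then d S else 0
  have hc : ∀ S, 1 / 2 ≤ c S := fun S => by
    simp only [c]; split_ifs <;> norm_num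
  have hd : ∀ S, 0 ≤ d S := fun S => by
    simp only [d]; split_ifs <;> norm_num
  have hd' : ∀ T, ∀ S ∈ P, 0 ≤ if T = A S then d S else 0 := fun T S _ => by
    split_ifs
    · exact hd S
    · exact le_rfl
  have hcw : ∀ S ∈ P, c S ≤ w S := fun S hS => by
    simp only [w, if_pos hS]
    linarith [sum_nonneg (hd' S)]
  have hw0 : ∀ S, 0 ≤ w S := fun S => by
    refine add_nonneg ?_ (sum_nonneg (hd' S))
    split_ifs
    · linarith [hc S]
    · exact le_rfl
  have hcompl : ∀ S ∈ P, e \ S ∈ P := fun S hS => by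
    obtain ⟨h1, h2⟩ := mem_powersetCard.1 hS
    refine mem_powersetCard.2 ⟨sdiff_subset, ?_⟩
    rw [card_sdiff_of_subset h1]; omega
  have hinv : ∀ S ∈ P, e \ (e \ S) = S := fun S hS =>
    Finset.sdiff_sdiff_eq_self (mem_powersetCard.1 hS).1
  refine ⟨w, hw0, fun S hS => (hc S).trans (hcw S hS), ?_, ?_⟩
  · intro f hf pf hfe
    set S := f ∩ e with hS
    have hSP : S ∈ P := mem_powersetCard.2 ⟨inter_subset_right, hfe⟩
    have hSf : S ∈ f.powersetCard k := mem_powersetCard.2 ⟨inter_subset_left, hfe⟩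
    have hbad : bad S := ⟨f, hf, pf, rfl⟩
    by_cases hb : bad (e \ S)
    · have hA' : A (e \ S) = f \ e := by
        simp only [A, dif_pos hb]
        obtain ⟨h1, h2, h3⟩ := hb.choose_spec
        exact (sdiff_eq_sdiff_of_isPrivate hk hH hM hmax he hf h1 pf h2 hfe h3).symm
      have hA : A S = f \ e := by
        simp only [A, dif_pos hbad]
        obtain ⟨h1, h2, h3⟩ := hbad.choose_spec
        obtain ⟨g, hg1, hg2, hg3⟩ := hb
        rw [sdiff_eq_sdiff_of_isPrivate hk hH hM hmax he hf hg1 pf hg2 hfe hg3]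
        exact sdiff_eq_sdiff_of_isPrivate hk hH hM hmax he h1 hg1 h2 hg2
          (by rw [h3]; exact hfe) (by rw [h3]; exact hg3)
      have hne : S ≠ e \ S := fun h => by
        have h1 : Disjoint S (e \ S) := disjoint_sdiff
        rw [← h, disjoint_self_iff_empty] at h1
        rw [h1, card_empty] at hfe
        omega
      have hAf : f \ e ∈ f.powersetCard k := by
        refine mem_powersetCard.2 ⟨sdiff_subset, ?_⟩
        have h1 := card_sdiff_add_card_inter f e
        have h2 := hH f hf
        rw [← hS] at h1
        omega
      have hSA : S ≠ f \ e := fun h => by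
        have h1 : Disjoint (f \ e) (f ∩ e) := disjoint_sdiff_inter f e
        rw [← h, ← hS, disjoint_self_iff_empty] at h1
        rw [h1, card_empty] at hfe
        omega
      have hwA : 1 / 2 ≤ w (f \ e) := by
        have h1 : ∑ T ∈ {S, e \ S}, (if f \ e = A T then d T else 0) ≤
            ∑ T ∈ P, if f \ e = A T then d T else 0 := by
          refine sum_le_sum_of_subset_of_nonneg ?_ fun T hT _ => hd' _ T hT
          intro T hT
          rcases mem_insert.1 hT with rfl | hT
          · exact hSP
          · rw [mem_singleton.1 hT]; exact hcompl S hSP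
        rw [sum_pair hne, if_pos hA.symm, if_pos hA'.symm] at h1
        have h2 : d S = 1 / 4 := if_pos ⟨hbad, hb⟩
        have h3 : d (e \ S) = 1 / 4 := if_pos ⟨hb, (hinv S hSP).symm ▸ hbad⟩
        have h4 : (0 : ℝ) ≤ if f \ e ∈ P then c (f \ e) else 0 := by
          split_ifs
          · linarith [hc (f \ e)]
          · exact le_rfl
        simp only [w]
        linarith
      have h1 : ∑ T ∈ {S, f \ e}, w T ≤ ∑ T ∈ f.powersetCard k, w T := by
        refine sum_le_sum_of_subset_of_nonneg ?_ fun T _ _ => hw0 T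
        intro T hT
        rcases mem_insert.1 hT with rfl | hT
        · exact hSf
        · rw [mem_singleton.1 hT]; exact hAf
      rw [sum_pair hSA] at h1
      linarith [hc S, hcw S hSP]
    · have h1 : c S = 1 := by
        simp only [c, if_pos (And.intro hbad hb)]; norm_num
      have h2 := single_le_sum (f := w) (fun T _ => hw0 T) hSf
      linarith [hcw S hSP]
  · have hsize : fracSize k w ≤ ∑ S ∈ P, (c S + d S) := by
      simp only [fracSize, w]
      rw [sum_add_distrib, sum_add_distrib, sum_comm]
      refine add_le_add (le_of_eq ?_) (sum_le_sum fun S _ => ?_)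
      · rw [← sum_filter]
        refine sum_congr ?_ fun _ _ => rfl
        ext T
        simp only [P, mem_filter, mem_powersetCard, subset_univ, true_and]
        tauto
      · rw [sum_ite_eq']
        split_ifs
        · exact le_rfl
        · exact hd S
    have hswap : ∑ S ∈ P, (c (e \ S) + d (e \ S)) = ∑ S ∈ P, (c S + d S) :=
      sum_nbij' (fun S => e \ S) (fun S => e \ S) hcompl hcompl hinv hinv fun _ _ => rfl
    have hpair : ∑ S ∈ P, ((c S + d S) + (c (e \ S) + d (e \ S))) ≤ ∑ S ∈ P, (3 / 2 : ℝ) := by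
      refine sum_le_sum fun S hS => ?_
      simp only [c, d, hinv S hS]
      by_cases h1 : bad S <;> by_cases h2 : bad (e \ S) <;> simp [h1, h2] <;> norm_num
    rw [sum_add_distrib, hswap, sum_const, card_powersetCard, hec, nsmul_eq_mul] at hpair
    linarith

/-- The bound `3/4 · C(2k, k)` on the ratio of fractional covers to matchings. -/
lemma exists_isFracCover_le_three_quarters {V : Type*} [Fintype V] [DecidableEq V] {k : ℕ}
    (hk : 0 < k) {H M : Finset (Finset V)} (hH : ∀ e ∈ H, e.card = 2 * k)
    (hM : IsMatching k H M) (hmax : ∀ M', IsMatching k H M' → M'.card ≤ M.card) :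
    ∃ w, IsFracCover k H w ∧ fracSize k w ≤ 3 / 4 * ((2 * k).choose k : ℝ) * M.card := by
  choose! u hu0 huhalf hupriv husize using
    fun e (he : e ∈ M) => exists_local_weight hk hH hM hmax he
  let w : Finset V → ℝ := fun S => ∑ e ∈ M, u e S
  have hle : ∀ e ∈ M, ∀ S, u e S ≤ w S := fun e he S =>
    single_le_sum (f := fun e => u e S) (fun e' he' => hu0 e' he' S) he
  have hw0 : ∀ S, 0 ≤ w S := fun S => sum_nonneg fun e he => hu0 e he S
  refine ⟨w, ⟨hw0, fun f hf => ?_⟩, ?_⟩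
  · by_cases htwo : ∃ S ∈ f.powersetCard k, ∃ T ∈ f.powersetCard k, S ≠ T ∧
        (∃ e ∈ M, S ⊆ e) ∧ ∃ e ∈ M, T ⊆ e
    · obtain ⟨S, hS, T, hT, hST, ⟨e, he, hSe⟩, e', he', hTe'⟩ := htwo
      have h1 := huhalf e he S (mem_powersetCard.2 ⟨hSe, (mem_powersetCard.1 hS).2⟩)
      have h2 := huhalf e' he' T (mem_powersetCard.2 ⟨hTe', (mem_powersetCard.1 hT).2⟩)
      have h3 : ∑ X ∈ {S, T}, w X ≤ ∑ X ∈ f.powersetCard k, w X := by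
        refine sum_le_sum_of_subset_of_nonneg ?_ fun X _ _ => hw0 X
        intro X hX
        rcases mem_insert.1 hX with rfl | hX
        · exact hS
        · rw [mem_singleton.1 hX]; exact hT
      rw [sum_pair hST] at h3
      linarith [hle e he S, hle e' he' T]
    · push Not at htwo
      have hfc := hH f hf
      have hmeet : ∃ e ∈ M, k ≤ (f ∩ e).card := by
        by_contra! hno
        have hfM : f ∉ M := fun h => by
          have := hno f h
          rw [inter_self] at this
          omega
        have hmat : IsMatching k H (insert f M) := by
          refine ⟨insert_subset hf hM.1, fun x hx y hy hxy => ?_⟩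
          rcases mem_insert.1 hx with rfl | hxM <;> rcases mem_insert.1 hy with rfl | hyM
          · exact absurd rfl hxy
          · exact hno y hyM
          · rw [inter_comm]; exact hno x hxM
          · exact hM.2 x hxM y hyM hxy
        have := hmax _ hmat
        rw [card_insert_of_notMem hfM] at this
        omega
      obtain ⟨e, he, hfe⟩ := hmeet
      obtain ⟨S, hSsub, hSc⟩ := exists_subset_card_eq hfe
      have hSf : S ∈ f.powersetCard k :=
        mem_powersetCard.2 ⟨hSsub.trans inter_subset_left, hSc⟩
      have hSe : S ⊆ e := hSsub.trans inter_subset_right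
      have huniq : ∀ e' ∈ M, ∀ T ⊆ f ∩ e', T.card = k → T = S := by
        intro e' he' T hT hTc
        by_contra hne
        exact htwo S hSf T (mem_powersetCard.2 ⟨hT.trans inter_subset_left, hTc⟩)
          (Ne.symm hne) ⟨e, he, hSe⟩ e' he' (hT.trans inter_subset_right)
      have hcard : (f ∩ e).card = k := by
        refine le_antisymm ?_ hfe
        suffices f ∩ e ⊆ S from hSc ▸ card_le_card this
        intro x hx
        obtain ⟨T, hxT, hTsub, hTc⟩ := exists_subsuperset_card_eq
          (singleton_subset_iff.2 hx) (by rw [card_singleton]; omega) hfe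
        exact huniq e he T hTsub hTc ▸ singleton_subset_iff.1 hxT
      have hpriv : IsPrivate k M e f := by
        intro e' he' hne
        by_contra! hlarge
        obtain ⟨T, hTsub, hTc⟩ := exists_subset_card_eq hlarge
        have hTS := huniq e' he' T hTsub hTc
        subst hTS
        have := card_le_card (subset_inter (hTsub.trans inter_subset_right) hSe)
        have := hM.2 e' he' e he hne
        omega
      exact (hupriv e he f hf hpriv hcard).trans (sum_le_sum fun S _ => hle e he S)
  · have : fracSize k w = ∑ e ∈ M, fracSize k (u e) := sum_comm
    rw [this]
    refine (sum_le_sum fun e he => husize e he).trans (le_of_eq ?_)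
    rw [sum_const, nsmul_eq_mul, mul_comm]

/-- For `k ≥ 2`, every `2k`-uniform hypergraph `H` satisfies
`τ*^(k)(H) ≤ (1 - k/(4(k+2))) · C(2k, k) · ν^(k)(H)`,
where `n = ν^(k)(H)` is the maximum size of a `k`-matching of `H`. -/
theorem stmt9 {V : Type*} [Fintype V] [DecidableEq V] (k : ℕ) (hk : 2 ≤ k)
    (H : Finset (Finset V)) (hH : ∀ e ∈ H, e.card = 2 * k)
    (n : ℕ) (hex : ∃ M, IsMatching k H M ∧ M.card = n)
    (hmax : ∀ M, IsMatching k H M → M.card ≤ n) :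
    ∃ w, IsFracCover k H w ∧
      fracSize k w ≤ (1 - (k : ℝ) / (4 * ((k : ℝ) + 2))) * ((2 * k).choose k : ℝ) * (n : ℝ) := by
  obtain ⟨M, hM, rfl⟩ := hex
  obtain ⟨w, hw, hsize⟩ := exists_isFracCover_le_three_quarters (by omega) hH hM hmax
  refine ⟨w, hw, hsize.trans ?_⟩
  gcongr
  have h : (k : ℝ) / (4 * ((k : ℝ) + 2)) ≤ 1 / 4 := by
    rw [div_le_div_iff₀ (by positivity) (by norm_num)]
    linarith
  linarith
end

section
/- Let k ≥ 3 and let H be a k-uniform hypergraph with ν^(k−2)(H) = 1. Then τ*^(k−2)(H) ≤ (1/6)·C(k−2,2) + 2k − 3, where C(k−2,2) denotes the binomial coefficient (k−2) choose 2. -/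
open Finset

/-- `H` has a fractional `m`-cover of size at most `t`. -/
def HasFracCover {V : Type*} [Fintype V] (m : ℕ) (H : Finset (Finset V)) (t : ℝ) : Prop :=
  ∃ w, IsFracCover m H w ∧ fracSize m w ≤ t

theorem HasFracCover.mono {V : Type*} [Fintype V] {m : ℕ} {H : Finset (Finset V)} {s t : ℝ}
    (h : HasFracCover m H s) (hst : s ≤ t) : HasFracCover m H t := by
  obtain ⟨w, hw, hs⟩ := h
  exact ⟨w, hw, hs.trans hst⟩

theorem HasFracCover.union {V : Type*} [Fintype V] [DecidableEq V] {m : ℕ}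
    {H₁ H₂ : Finset (Finset V)} {s t : ℝ}
    (h₁ : HasFracCover m H₁ s) (h₂ : HasFracCover m H₂ t) :
    HasFracCover m (H₁ ∪ H₂) (s + t) := by
  obtain ⟨w₁, ⟨hp₁, hc₁⟩, hs₁⟩ := h₁
  obtain ⟨w₂, ⟨hp₂, hc₂⟩, hs₂⟩ := h₂
  refine ⟨fun S => w₁ S + w₂ S, ⟨fun S => add_nonneg (hp₁ S) (hp₂ S), fun e he => ?_⟩, ?_⟩
  · rw [sum_add_distrib]
    have h₁ : 0 ≤ ∑ S ∈ e.powersetCard m, w₁ S := sum_nonneg fun S _ => hp₁ S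
    have h₂ : 0 ≤ ∑ S ∈ e.powersetCard m, w₂ S := sum_nonneg fun S _ => hp₂ S
    rcases mem_union.1 he with he | he
    · linarith [hc₁ e he]
    · linarith [hc₂ e he]
  · unfold fracSize at *
    rw [sum_add_distrib]
    exact add_le_add hs₁ hs₂

/-- If every edge contains at least `r` of the `m`-sets in `F`, then giving each member of `F`
the weight `1 / r` yields a fractional cover. -/
theorem hasFracCover_of_le_card {V : Type*} [Fintype V] [DecidableEq V] {m r : ℕ}
    {H : Finset (Finset V)} (F : Finset (Finset V)) (hr : 0 < r)
    (h : ∀ e ∈ H, r ≤ #(e.powersetCard m ∩ F)) :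
    HasFracCover m H ((#F : ℝ) / r) := by
  have hr' : (0 : ℝ) < r := by exact_mod_cast hr
  refine ⟨fun S => if S ∈ F then 1 / (r : ℝ) else 0, ⟨fun S => ?_, fun e he => ?_⟩, ?_⟩
  · dsimp only
    split_ifs <;> positivity
  · rw [sum_ite_mem, sum_const, nsmul_eq_mul, mul_one_div, le_div_iff₀ hr', one_mul]
    exact_mod_cast h e he
  · unfold fracSize
    rw [sum_ite_mem, sum_const, nsmul_eq_mul, mul_one_div]
    gcongr
    exact inter_subset_right

/-- The uniform cover by the sets `R ∪ Y`, with `R` a `p`-subset of `U` and `Y` in `Q`. -/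
theorem hasFracCover_of_le_choose_mul {V : Type*} [Fintype V] [DecidableEq V] {m r : ℕ}
    {H : Finset (Finset V)} (U : Finset V) (p : ℕ) (Q : Finset (Finset V)) (hr : 0 < r)
    (hQ : ∀ Y ∈ Q, Disjoint U Y ∧ p + #Y = m)
    (h : ∀ e ∈ H, r ≤ (#(e ∩ U)).choose p * #{Y ∈ Q | Y ⊆ e}) :
    HasFracCover m H (((#U).choose p * #Q : ℝ) / r) := by
  set F := (U.powersetCard p ×ˢ Q).image fun x => x.1 ∪ x.2 with hF
  refine (hasFracCover_of_le_card F hr fun e he => (h e he).trans ?_).mono ?_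
  · rw [← card_powersetCard, ← card_product]
    refine card_le_card_of_injOn (fun x => x.1 ∪ x.2) ?_ ?_
    · rintro ⟨R, Y⟩ hx
      simp only [coe_product, Set.mem_prod, mem_coe, mem_powersetCard, mem_filter,
        subset_inter_iff] at hx
      obtain ⟨⟨⟨hRe, hRU⟩, hR⟩, hY, hYe⟩ := hx
      obtain ⟨hd, hc⟩ := hQ Y hY
      simp only [mem_coe, mem_inter, mem_powersetCard, hF, mem_image, mem_product, Prod.exists]
      refine ⟨⟨union_subset hRe hYe, ?_⟩, R, Y, ⟨⟨hRU, hR⟩, hY⟩, rfl⟩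
      rw [card_union_of_disjoint (hd.mono_left hRU), hR, hc]
    · rintro ⟨R, Y⟩ hx ⟨R', Y'⟩ hx' heq
      simp only [coe_product, Set.mem_prod, mem_coe, mem_powersetCard, mem_filter,
        subset_inter_iff] at hx hx' heq
      have hd := (hQ Y hx.2.1).1
      have hd' := (hQ Y' hx'.2.1).1
      have hR := hx.1.1.2
      have hR' := hx'.1.1.2
      rw [disjoint_left] at hd hd'
      simp only [Prod.mk.injEq]
      constructor <;> ext v <;> have := Finset.ext_iff.1 heq v <;>
        simp only [mem_union] at this <;> have := @hR v <;> have := @hR' v <;>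
        have := @hd v <;> have := @hd' v <;> tauto
  · gcongr
    have : #F ≤ _ := card_image_le
    rw [card_product, card_powersetCard] at this
    exact_mod_cast this

theorem card_inter_union_of_disjoint {V : Type*} [DecidableEq V] (h : Finset V) {X Y : Finset V}
    (hXY : Disjoint X Y) : #(h ∩ (X ∪ Y)) = #(h ∩ X) + #(h ∩ Y) := by
  rw [inter_union_distrib_left, card_union_of_disjoint]
  exact hXY.mono inter_subset_right inter_subset_right

/-- The cover by all `(k - 2)`-subsets of a set that meets every edge in at least `k - 1` points. -/
theorem hasFracCover_of_card_inter_ge {V : Type*} [Fintype V] [DecidableEq V] {k : ℕ} (hk : 3 ≤ k)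
    {H : Finset (Finset V)} {e : Finset V} (he : #e = k) (h : ∀ g ∈ H, k - 1 ≤ #(g ∩ e)) :
    HasFracCover (k - 2) H ((k : ℝ) / 2) := by
  obtain ⟨n, rfl⟩ : ∃ n, k = n + 2 := ⟨k - 2, by omega⟩
  refine (hasFracCover_of_le_choose_mul (r := n + 1) e n {∅} (by omega) (by simp)
    fun g hg => ?_).mono ?_
  · have h₁ := Nat.choose_le_choose n (h g hg)
    have h₂ : (n + 2 - 1).choose n = n + 1 := by simp
    have h₃ : #{Y ∈ ({∅} : Finset (Finset V)) | Y ⊆ g} = 1 := by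
      rw [filter_true_of_mem (by simp), card_singleton]
    rw [h₃]
    omega
  · have h₁ : (n + 2).choose n = (n + 2).choose 2 := Nat.choose_symm_add
    rw [he, h₁, Nat.cast_choose_two, card_singleton]
    push_cast
    apply le_of_eq
    have : (n : ℝ) + 1 ≠ 0 := by positivity
    field_simp
    ring

/-- The cover of the edges that contain `T` and meet the pairs `P`, `A`, `B` suitably, by the sets
`T ∪ Y` with `Y` a pair in `P ∪ A ∪ B` other than `P`, `A` and `B`. -/
theorem hasFracCover_of_three_pairs {V : Type*} [Fintype V] [DecidableEq V] {k : ℕ}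
    {H : Finset (Finset V)} {T P A B : Finset V} (hT : #T + 4 = k)
    (hP : #P = 2) (hA : #A = 2) (hB : #B = 2) (hPA : Disjoint P A) (hPB : Disjoint P B)
    (hAB : Disjoint A B) (hTW : Disjoint T (P ∪ A ∪ B)) (hTH : ∀ h ∈ H, T ⊆ h)
    (h₁ : ∀ h ∈ H, 2 ≤ #(h ∩ P) + #(h ∩ A)) (h₂ : ∀ h ∈ H, 2 ≤ #(h ∩ P) + #(h ∩ B))
    (h₃ : ∀ h ∈ H, 2 ≤ #(h ∩ A) + #(h ∩ B)) :
    HasFracCover (k - 2) H 4 := by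
  have hPAB : Disjoint (P ∪ A) B := disjoint_union_left.2 ⟨hPB, hAB⟩
  have hW : #(P ∪ A ∪ B) = 6 := by
    rw [card_union_of_disjoint hPAB, card_union_of_disjoint hPA, hP, hA, hB]
  have hne : ∀ {X Y : Finset V}, #X = 2 → Disjoint X Y → X ≠ Y := by
    rintro X Y hX hXY rfl
    rw [disjoint_self, bot_eq_empty] at hXY
    simp [hXY] at hX
  have hcard : #({P, A, B} : Finset (Finset V)) = 3 :=
    card_eq_three.2 ⟨P, A, B, hne hP hPA, hne hP hPB, hne hA hAB, rfl⟩
  set Q := (P ∪ A ∪ B).powersetCard 2 \ {P, A, B} with hQ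
  have hQcard : #Q = 12 := by
    rw [hQ, card_sdiff_of_subset, card_powersetCard, hW, hcard]
    · rfl
    · intro X hX
      simp only [mem_insert, mem_singleton] at hX
      rw [mem_powersetCard]
      rcases hX with rfl | rfl | rfl
      · exact ⟨subset_union_left.trans subset_union_left, hP⟩
      · exact ⟨subset_union_right.trans subset_union_left, hA⟩
      · exact ⟨subset_union_right, hB⟩
  refine (hasFracCover_of_le_choose_mul (r := 3) T #T Q (by omega) ?_ fun h hh => ?_).mono ?_
  · intro Y hY
    simp only [hQ, mem_sdiff, mem_powersetCard] at hY
    exact ⟨hTW.mono_right hY.1.1, by omega⟩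
  · rw [inter_eq_right.2 (hTH h hh), Nat.choose_self, one_mul]
    have hsub : (h ∩ (P ∪ A ∪ B)).powersetCard 2 \ {X ∈ ({P, A, B} : Finset (Finset V)) | X ⊆ h} ⊆
        {Y ∈ Q | Y ⊆ h} := by
      intro Y hY
      simp only [hQ, mem_sdiff, mem_powersetCard, mem_filter, subset_inter_iff] at hY ⊢
      tauto
    have hle := (le_card_sdiff _ _).trans (card_le_card hsub)
    rw [card_powersetCard] at hle
    have hsum := card_inter_union_of_disjoint h hPAB
    rw [card_inter_union_of_disjoint h hPA] at hsum
    have := h₁ h hh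
    have := h₂ h hh
    have := h₃ h hh
    by_cases h4 : 4 ≤ #(h ∩ (P ∪ A ∪ B))
    · have hc : 6 ≤ (#(h ∩ (P ∪ A ∪ B))).choose 2 := Nat.choose_le_choose 2 h4
      have hf : #{X ∈ ({P, A, B} : Finset (Finset V)) | X ⊆ h} ≤ 3 :=
        (card_filter_le _ _).trans hcard.le
      omega
    · have hc : (#(h ∩ (P ∪ A ∪ B))).choose 2 = 3 := by
        rw [show #(h ∩ (P ∪ A ∪ B)) = 3 by omega]
        rfl
      have hf : #{X ∈ ({P, A, B} : Finset (Finset V)) | X ⊆ h} = 0 := by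
        rw [card_eq_zero, filter_eq_empty_iff]
        intro X hX hXh
        simp only [mem_insert, mem_singleton] at hX
        have hXc : #(h ∩ X) = #X := by rw [inter_eq_right.2 hXh]
        rcases hX with rfl | rfl | rfl <;> omega
      omega
  · rw [hQcard, Nat.choose_self]
    norm_num

/-- The cover of the edges that contain `S` or all of `S` but one point. -/
theorem hasFracCover_of_card_inter_ge_sub_three {V : Type*} [Fintype V] [DecidableEq V] {k : ℕ}
    (hk : 3 ≤ k) {H : Finset (Finset V)} {S A B : Finset V} (hS : #S + 2 = k) (hA : #A = 2)
    (hB : #B = 2) (hSA : Disjoint S A) (hSB : Disjoint S B) (hAB : Disjoint A B)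
    (h₁ : ∀ h ∈ H, k ≤ #(h ∩ S) + #(h ∩ A) + 2) (h₂ : ∀ h ∈ H, k ≤ #(h ∩ S) + #(h ∩ B) + 2)
    (h₃ : ∀ h ∈ H, k ≤ #(h ∩ S) + 3) :
    HasFracCover (k - 2) H (2 * (k : ℝ) - 3) := by
  obtain ⟨n, rfl⟩ : ∃ n, k = n + 3 := ⟨k - 3, by omega⟩
  have hfull : HasFracCover (n + 3 - 2) {h ∈ H | S ⊆ h} 1 := by
    refine (hasFracCover_of_le_choose_mul (r := 1) S #S {∅} one_pos (by simp; omega)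
      fun h hh => ?_).mono (by simp)
    rw [mem_filter] at hh
    rw [inter_eq_right.2 hh.2, Nat.choose_self, filter_true_of_mem (by simp), card_singleton]
  have hone : HasFracCover (n + 3 - 2) {h ∈ H | ¬ S ⊆ h} (2 * (n : ℝ) + 2) := by
    refine (hasFracCover_of_le_choose_mul (r := 2) S n ((A ∪ B).powersetCard 1) two_pos ?_
      fun h hh => ?_).mono ?_
    · intro Y hY
      rw [mem_powersetCard] at hY
      exact ⟨(disjoint_union_right.2 ⟨hSA, hSB⟩).mono_right hY.1, by omega⟩
    · rw [mem_filter] at hh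
      have hlt : #(h ∩ S) < #S :=
        card_lt_card ⟨inter_subset_right, fun hs => hh.2 (hs.trans inter_subset_left)⟩
      have := h₁ h hh.1
      have := h₂ h hh.1
      have := h₃ h hh.1
      rw [show #(h ∩ S) = n by omega, Nat.choose_self, one_mul]
      have hsub : (h ∩ (A ∪ B)).powersetCard 1 ⊆ {Y ∈ (A ∪ B).powersetCard 1 | Y ⊆ h} := by
        intro Y hY
        simp only [mem_powersetCard, mem_filter, subset_inter_iff] at hY ⊢
        tauto
      have hle := card_le_card hsub
      rw [card_powersetCard, Nat.choose_one_right, card_inter_union_of_disjoint h hAB] at hle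
      omega
    · rw [show #S = n + 1 by omega, card_powersetCard, card_union_of_disjoint hAB, hA, hB,
        Nat.choose_succ_self_right]
      push_cast
      norm_num
      linarith
  have := hfull.union hone
  rw [filter_union_filter_not_eq] at this
  refine this.mono ?_
  push_cast
  linarith

/-- The cover of the edges that contain `W` and all of `S` but two points. -/
theorem hasFracCover_of_subset {V : Type*} [Fintype V] [DecidableEq V] {n : ℕ}
    {H : Finset (Finset V)} {S W : Finset V} (hS : #S = n + 4) (hW : #W = 4) (hSW : Disjoint S W)
    (h₁ : ∀ h ∈ H, #(h ∩ S) = n + 2) (h₂ : ∀ h ∈ H, W ⊆ h) :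
    HasFracCover (n + 4) H (((n + 4).choose 2 : ℝ) / 6) := by
  refine (hasFracCover_of_le_choose_mul (r := (n + 2).choose n) S n {W}
    (Nat.choose_pos (by omega)) (by simpa [hW] using hSW) fun h hh => ?_).mono ?_
  · rw [h₁ h hh, filter_true_of_mem (by simpa using h₂ h hh), card_singleton, mul_one]
  · have hmul : (n + 4).choose 4 * 6 = (n + 4).choose 2 * (n + 2).choose 2 :=
      Nat.choose_mul (n := n + 4) (k := 4) (s := 2) (by omega)
    have h₁ : (n + 4).choose n = (n + 4).choose 4 := Nat.choose_symm_add
    have h₂ : (n + 2).choose n = (n + 2).choose 2 := Nat.choose_symm_add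
    have hpos : (0 : ℝ) < (n + 2).choose 2 := by
      exact_mod_cast Nat.choose_pos (by omega)
    rw [hS, h₁, h₂, card_singleton, div_le_div_iff₀ hpos (by norm_num)]
    exact_mod_cast (by omega)

/-- If `H` is a `k`-uniform hypergraph (`k ≥ 3`) with `ν^(k-2)(H) = 1`, then
`τ*^(k-2)(H) ≤ (1/6) · C(k-2, 2) + 2k - 3`. -/
theorem stmt10 {V : Type*} [Fintype V] [DecidableEq V] (k : ℕ) (hk : 3 ≤ k)
    (H : Finset (Finset V)) (hH : ∀ e ∈ H, e.card = k)
    (hex : ∃ M, IsMatching (k - 2) H M ∧ M.card = 1)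
    (hmax : ∀ M, IsMatching (k - 2) H M → M.card ≤ 1) :
    ∃ w, IsFracCover (k - 2) H w ∧
      fracSize (k - 2) w ≤ ((k - 2).choose 2 : ℝ) / 6 + 2 * (k : ℝ) - 3 := by
  have hmeet : ∀ e ∈ H, ∀ f ∈ H, k ≤ #(e ∩ f) + 2 := by
    intro e he f hf
    by_contra hlt
    have hne : e ≠ f := by
      rintro rfl
      rw [inter_self, hH e he] at hlt
      omega
    have hM : IsMatching (k - 2) H {e, f} := by
      refine ⟨by simp [insert_subset_iff, he, hf], fun x hx y hy hxy => ?_⟩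
      simp only [mem_insert, mem_singleton] at hx hy
      rcases hx with rfl | rfl <;> rcases hy with rfl | rfl
      · exact absurd rfl hxy
      · omega
      · rw [inter_comm]
        omega
      · exact absurd rfl hxy
    have := hmax _ hM
    rw [card_pair hne] at this
    omega
  have hk' : (3 : ℝ) ≤ k := by exact_mod_cast hk
  have hC : (0 : ℝ) ≤ ((k - 2).choose 2 : ℝ) / 6 := by positivity
  change HasFracCover (k - 2) H _
  by_cases hclose : ∀ e ∈ H, ∀ f ∈ H, k - 1 ≤ #(e ∩ f)
  · obtain ⟨M, hM, hMc⟩ := hex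
    obtain ⟨e, rfl⟩ := card_eq_one.1 hMc
    have he : e ∈ H := hM.1 (mem_singleton_self e)
    exact (hasFracCover_of_card_inter_ge hk (hH e he) fun g hg => hclose g hg e he).mono
      (by linarith)
  push Not at hclose
  obtain ⟨e, he, f, hf, hef⟩ := hclose
  have hSk : #(e ∩ f) + 2 = k := by
    have := hmeet e he f hf
    omega
  obtain ⟨S, A, B, hS, hA, hB, hSA, hSB, hAB, he', hf'⟩ : ∃ S A B : Finset V, #S + 2 = k ∧
      #A = 2 ∧ #B = 2 ∧ Disjoint S A ∧ Disjoint S B ∧ Disjoint A B ∧ S ∪ A ∈ H ∧ S ∪ B ∈ H := by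
    refine ⟨e ∩ f, e \ f, f \ e, hSk, ?_, ?_, ?_, ?_, ?_, ?_, ?_⟩
    · have := card_inter_add_card_sdiff e f
      have := hH e he
      omega
    · have := card_inter_add_card_sdiff f e
      rw [inter_comm] at this
      have := hH f hf
      omega
    · exact (disjoint_sdiff_inter e f).symm
    · rw [inter_comm]
      exact (disjoint_sdiff_inter f e).symm
    · exact disjoint_sdiff_sdiff
    · rwa [union_comm, sdiff_union_inter]
    · rwa [union_comm, inter_comm, sdiff_union_inter]
  have hSAH : ∀ h ∈ H, k ≤ #(h ∩ S) + #(h ∩ A) + 2 := fun h hh => by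
    rw [← card_inter_union_of_disjoint h hSA]
    exact hmeet h hh _ he'
  have hSBH : ∀ h ∈ H, k ≤ #(h ∩ S) + #(h ∩ B) + 2 := fun h hh => by
    rw [← card_inter_union_of_disjoint h hSB]
    exact hmeet h hh _ hf'
  have hSABH : ∀ h ∈ H, #(h ∩ S) + #(h ∩ A) + #(h ∩ B) ≤ k := fun h hh => by
    rw [← card_inter_union_of_disjoint h hSA,
      ← card_inter_union_of_disjoint h (disjoint_union_left.2 ⟨hSB, hAB⟩), ← hH h hh]
    exact card_le_card inter_subset_left
  have hle2 : ∀ h X : Finset V, #X = 2 → #(h ∩ X) ≤ 2 := fun h X hX =>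
    hX ▸ card_le_card inter_subset_right
  by_cases hfar : ∀ h ∈ H, k ≤ #(h ∩ S) + 3
  · exact (hasFracCover_of_card_inter_ge_sub_three hk hS hA hB hSA hSB hAB hSAH hSBH hfar).mono
      (by linarith)
  have hfull : ∀ h ∈ H, ¬ k ≤ #(h ∩ S) + 3 →
      #(h ∩ S) + 4 = k ∧ #(h ∩ A) = 2 ∧ #(h ∩ B) = 2 := by
    intro h hh hlt
    have := hSAH h hh
    have := hSBH h hh
    have := hSABH h hh
    have := hle2 h A hA
    have := hle2 h B hB
    omega
  have hsub : ∀ h X : Finset V, #X = 2 → #(h ∩ X) = 2 → X ⊆ h := fun h X hX hhX =>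
    inter_eq_right.1 (eq_of_subset_of_card_le inter_subset_right (by omega))
  by_cases hk6 : 6 ≤ k
  · obtain ⟨n, rfl⟩ : ∃ n, k = n + 6 := ⟨k - 6, by omega⟩
    have h₁ := hasFracCover_of_card_inter_ge_sub_three hk (H := {h ∈ H | n + 6 ≤ #(h ∩ S) + 3})
      hS hA hB hSA hSB hAB (fun h hh => hSAH h (mem_filter.1 hh).1)
      (fun h hh => hSBH h (mem_filter.1 hh).1) (fun h hh => (mem_filter.1 hh).2)
    have h₂ : HasFracCover (n + 4) {h ∈ H | ¬ n + 6 ≤ #(h ∩ S) + 3}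
        (((n + 4).choose 2 : ℝ) / 6) := by
      refine hasFracCover_of_subset (S := S) (W := A ∪ B) (by omega)
        (by rw [card_union_of_disjoint hAB, hA, hB]) (disjoint_union_right.2 ⟨hSA, hSB⟩) ?_ ?_
      · intro h hh
        rw [mem_filter] at hh
        have := hfull h hh.1 hh.2
        omega
      · intro h hh
        rw [mem_filter] at hh
        have := hfull h hh.1 hh.2
        exact union_subset (hsub h A hA this.2.1) (hsub h B hB this.2.2)
    have := h₁.union h₂
    rw [filter_union_filter_not_eq] at this
    refine this.mono (le_of_eq ?_)
    rw [show n + 6 - 2 = n + 4 by omega]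
    ring
  push Not at hfar
  obtain ⟨g, hg, hgS⟩ := hfar
  obtain ⟨hgS, hgA, hgB⟩ := hfull g hg (by omega)
  obtain ⟨T, P, rfl, hTP, hT, hgT⟩ : ∃ T P : Finset V, S = T ∪ P ∧ Disjoint T P ∧
      #T + 4 = k ∧ g = T ∪ (A ∪ B) := by
    refine ⟨g ∩ S, S \ g, ?_, ?_, hgS, ?_⟩
    · rw [union_comm, inter_comm, sdiff_union_inter]
    · rw [inter_comm]
      exact (disjoint_sdiff_inter S g).symm
    · symm
      apply eq_of_subset_of_card_le
      · exact union_subset inter_subset_left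
          (union_subset (hsub g A hA hgA) (hsub g B hB hgB))
      · rw [card_union_of_disjoint, card_union_of_disjoint hAB, hH g hg]
        · omega
        · exact (disjoint_union_right.2 ⟨hSA, hSB⟩).mono_left inter_subset_right
  rw [disjoint_union_left] at hSA hSB
  have hP : #P = 2 := by
    rw [card_union_of_disjoint hTP] at hS
    omega
  have hTPAH : ∀ h ∈ H, k ≤ #(h ∩ T) + #(h ∩ P) + #(h ∩ A) + 2 := fun h hh => by
    rw [← card_inter_union_of_disjoint h hTP]
    exact hSAH h hh
  have hTPBH : ∀ h ∈ H, k ≤ #(h ∩ T) + #(h ∩ P) + #(h ∩ B) + 2 := fun h hh => by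
    rw [← card_inter_union_of_disjoint h hTP]
    exact hSBH h hh
  have hTABH : ∀ h ∈ H, k ≤ #(h ∩ T) + (#(h ∩ A) + #(h ∩ B)) + 2 := fun h hh => by
    rw [← card_inter_union_of_disjoint h hAB,
      ← card_inter_union_of_disjoint h (disjoint_union_right.2 ⟨hSA.1, hSB.1⟩), ← hgT]
    exact hmeet h hh g hg
  have h₁ : HasFracCover (k - 2) {h ∈ H | T ⊆ h} 4 := by
    refine hasFracCover_of_three_pairs hT hP hA hB hSA.2 hSB.2 hAB
      (disjoint_union_right.2 ⟨disjoint_union_right.2 ⟨hTP, hSA.1⟩, hSB.1⟩)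
      (fun h hh => (mem_filter.1 hh).2) ?_ ?_ ?_ <;>
    · intro h hh
      rw [mem_filter] at hh
      have hhT : #(h ∩ T) = #T := by rw [inter_eq_right.2 hh.2]
      have := hTPAH h hh.1
      have := hTPBH h hh.1
      have := hTABH h hh.1
      omega
  obtain rfl | rfl : k = 4 ∨ k = 5 := by omega
  · obtain rfl : T = ∅ := card_eq_zero.1 (by omega)
    rw [filter_true_of_mem fun h _ => empty_subset h] at h₁
    exact h₁.mono (by norm_num)
  · have hPAB : Disjoint (P ∪ A) B := disjoint_union_left.2 ⟨hSB.2, hAB⟩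
    have hW : #(P ∪ A ∪ B) = 6 := by
      rw [card_union_of_disjoint hPAB, card_union_of_disjoint hSA.2, hP, hA, hB]
    have h₂ : HasFracCover 3 {h ∈ H | ¬ T ⊆ h} 2 := by
      refine (hasFracCover_of_le_choose_mul (r := 10) (P ∪ A ∪ B) 3 {∅} (by norm_num) (by simp)
        fun h hh => ?_).mono ?_
      · rw [mem_filter] at hh
        have hlt : #(h ∩ T) < #T :=
          card_lt_card ⟨inter_subset_right, fun hs => hh.2 (hs.trans inter_subset_left)⟩
        have hsum := card_inter_union_of_disjoint h hPAB
        rw [card_inter_union_of_disjoint h hSA.2] at hsum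
        have := hTPAH h hh.1
        have := hTPBH h hh.1
        have := hTABH h hh.1
        rw [filter_true_of_mem (by simp), card_singleton, mul_one]
        exact Nat.choose_le_choose 3 (show 5 ≤ #(h ∩ (P ∪ A ∪ B)) by omega)
      · rw [hW, card_singleton, show Nat.choose 6 3 = 20 from rfl]
        norm_num
    have := h₁.union h₂
    rw [filter_union_filter_not_eq] at this
    refine this.mono ?_
    norm_num [Nat.choose]
end

section
/- Let k ≥ 3 and let H be a k-uniform hypergraph with ν^(k−1)(H) = 1 and with edge set of size e(H). Then either τ^(k−1)(H) = 1 or τ^(k−1)(H) ≤ ⌈e(H)/2⌉. -/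
open Finset

/-- If every edge has at least `m` vertices and any two edges share at least `m` vertices, then
pairing up the edges yields an `m`-cover of size at most `⌈e(H)/2⌉`. -/
theorem exists_isCover_card_le_half {V : Type*} [DecidableEq V] (m : ℕ)
    (H : Finset (Finset V)) (hinter : ∀ e ∈ H, ∀ f ∈ H, m ≤ (e ∩ f).card) :
    ∃ C, IsCover m H C ∧ C.card ≤ (H.card + 1) / 2 := by
  induction H using Finset.strongInduction with
  | H H ih =>
    obtain rfl | ⟨e, he⟩ := H.eq_empty_or_nonempty
    · exact ⟨∅, ⟨by simp, by simp⟩, by simp⟩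
    obtain ⟨f, hf, hcard⟩ : ∃ f ∈ H, ((H.erase e).erase f).card + 2 ≤ H.card ∨
        H.card = 1 ∧ ((H.erase e).erase f).card = 0 := by
      have h₁ := card_erase_add_one he
      obtain h | ⟨f, hf⟩ := (H.erase e).eq_empty_or_nonempty
      · exact ⟨e, he, .inr (by simp_all)⟩
      · have h₂ := card_erase_add_one hf
        exact ⟨f, mem_of_mem_erase hf, .inl (by omega)⟩
    have hsub : (H.erase e).erase f ⊂ H :=
      (erase_subset _ _).trans_ssubset (erase_ssubset he)
    obtain ⟨C, ⟨hC, hcov⟩, hCcard⟩ := ih _ hsub fun a ha b hb =>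
      hinter a (hsub.subset ha) b (hsub.subset hb)
    obtain ⟨c, hc, hcm⟩ := exists_subset_card_eq (hinter e he f hf)
    refine ⟨insert c C, ⟨?_, fun g hg => ?_⟩, ?_⟩
    · simpa [hcm] using hC
    · by_cases hge : g = e
      · exact ⟨c, mem_insert_self _ _, hge ▸ hc.trans inter_subset_left⟩
      by_cases hgf : g = f
      · exact ⟨c, mem_insert_self _ _, hgf ▸ hc.trans inter_subset_right⟩
      obtain ⟨d, hd, hdg⟩ := hcov g (by simp [hge, hgf, hg])
      exact ⟨d, mem_insert_of_mem hd, hdg⟩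
    · have := card_insert_le c C
      omega

/-- If `H` is a `k`-uniform hypergraph (`k ≥ 3`) with `ν^(k-1)(H) = 1`, then either
`τ^(k-1)(H) = 1` or `τ^(k-1)(H) ≤ ⌈e(H)/2⌉` (here `⌈n/2⌉ = (n+1)/2` in natural division). -/
theorem stmt11 {V : Type*} [DecidableEq V] (k : ℕ) (hk : 3 ≤ k)
    (H : Finset (Finset V)) (hH : ∀ e ∈ H, e.card = k)
    (hex : ∃ M, IsMatching (k - 1) H M ∧ M.card = 1)
    (hmax : ∀ M, IsMatching (k - 1) H M → M.card ≤ 1) :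
    (∃ C, IsCover (k - 1) H C ∧ C.card = 1) ∨
      (∃ C, IsCover (k - 1) H C ∧ C.card ≤ (H.card + 1) / 2) := by
  refine .inr (exists_isCover_card_le_half _ H fun e he f hf => ?_)
  obtain rfl | hne := eq_or_ne e f
  · simp [hH e he]
  by_contra! hlt
  have h := hmax {e, f} ⟨by simp [insert_subset_iff, he, hf], ?_⟩
  · rw [card_pair hne] at h
    omega
  · have hlt' : (f ∩ e).card < k - 1 := inter_comm e f ▸ hlt
    simp [hlt, hlt']
end

section
/- Let k ≥ 3 and let H be a k-uniform hypergraph with ν^(k−1)(H) = 1 and τ^(k−1)(H) ≠ 1. Then for any edge e of H, there exists a unique vertex v of H with v ∉ e such that every edge e' of H with e' ≠ e satisfies e' \ e = {v}. -/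
open Finset

/-- If three finite sets pairwise intersect in the same number of elements, and `x`, `y` each
leave `e` in a single vertex, these vertices being distinct, then `x` and `y` have the same
trace on `e`. -/
lemma inter_eq_inter_of_sdiff_eq_singleton {V : Type*} [DecidableEq V] {m : ℕ}
    {e x y : Finset V} {u v : V} (hx : (x ∩ e).card = m) (hy : (y ∩ e).card = m)
    (hxy : (x ∩ y).card = m) (hu : x \ e = {u}) (hv : y \ e = {v}) (huv : u ≠ v) :
    x ∩ e = y ∩ e := by
  have hsub : ∀ z ∈ x ∩ y, z ∈ e := by
    intro z hz
    by_contra hze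
    rw [mem_inter] at hz
    have h₁ : z ∈ x \ e := mem_sdiff.2 ⟨hz.1, hze⟩
    have h₂ : z ∈ y \ e := mem_sdiff.2 ⟨hz.2, hze⟩
    rw [hu, mem_singleton] at h₁
    rw [hv, mem_singleton] at h₂
    exact huv (h₁.symm.trans h₂)
  have h₁ : x ∩ y = x ∩ e := eq_of_subset_of_card_le
    (fun z hz => mem_inter.2 ⟨(mem_inter.1 hz).1, hsub z hz⟩) (by omega)
  have h₂ : x ∩ y = y ∩ e := eq_of_subset_of_card_le
    (fun z hz => mem_inter.2 ⟨(mem_inter.1 hz).2, hsub z hz⟩) (by omega)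
  exact h₁.symm.trans h₂

/-- If a `k`-uniform hypergraph has no `(k-1)`-matching of size two, then any two distinct edges
share exactly `k - 1` vertices. -/
lemma card_inter_eq_of_matching_card_le_one {V : Type*} [DecidableEq V] {k : ℕ}
    {H : Finset (Finset V)} (hH : ∀ e ∈ H, e.card = k)
    (hmax : ∀ M, IsMatching (k - 1) H M → M.card ≤ 1) {e f : Finset V}
    (he : e ∈ H) (hf : f ∈ H) (hef : e ≠ f) : (e ∩ f).card = k - 1 := by
  have hlt : (e ∩ f).card < k := by
    by_contra! h
    have h₁ : e ∩ f = e := eq_of_subset_of_card_le inter_subset_left (by rw [hH e he]; exact h)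
    have h₂ : e ∩ f = f := eq_of_subset_of_card_le inter_subset_right (by rw [hH f hf]; exact h)
    exact hef (h₁.symm.trans h₂)
  have hge : k - 1 ≤ (e ∩ f).card := by
    by_contra! h
    have hM : IsMatching (k - 1) H {e, f} := by
      refine ⟨by simp [insert_subset_iff, he, hf], ?_⟩
      intro a ha b hb hab
      simp only [mem_insert, mem_singleton] at ha hb
      rcases ha with rfl | rfl <;> rcases hb with rfl | rfl
      · exact absurd rfl hab
      · exact h
      · rwa [inter_comm]
      · exact absurd rfl hab
    have := hmax _ hM
    rw [card_pair hef] at this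
    omega
  omega

/-- If `H` is a `k`-uniform hypergraph (`k ≥ 3`) with `ν^(k-1)(H) = 1` and
`τ^(k-1)(H) ≠ 1` (i.e. no single `(k-1)`-set covers `H`), then for every edge `e` of `H`
there is a unique vertex `v ∉ e` such that every other edge `e'` satisfies `e' \ e = {v}`. -/
theorem stmt12 {V : Type*} [DecidableEq V] (k : ℕ) (hk : 3 ≤ k)
    (H : Finset (Finset V)) (hH : ∀ e ∈ H, e.card = k)
    (hex : ∃ M, IsMatching (k - 1) H M ∧ M.card = 1)
    (hmax : ∀ M, IsMatching (k - 1) H M → M.card ≤ 1)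
    (htau : ∀ C, IsCover (k - 1) H C → C.card ≠ 1) :
    ∀ e ∈ H, ∃! v : V, v ∉ e ∧ ∀ e' ∈ H, e' ≠ e → e' \ e = {v} := by
  intro e he
  have key : ∀ f ∈ H, ∀ g ∈ H, f ≠ g → (f ∩ g).card = k - 1 := fun f hf g hg =>
    card_inter_eq_of_matching_card_le_one hH hmax hf hg
  have hsingle : ∀ f ∈ H, f ≠ e → ∃ v, f \ e = {v} := by
    intro f hf hfe
    rw [← card_eq_one]
    have h₁ := card_sdiff_add_card_inter f e
    have h₂ := key f hf e he hfe
    have h₃ := hH f hf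
    omega
  have huncovered : ∀ c : Finset V, c.card = k - 1 → ∃ h ∈ H, ¬ c ⊆ h := by
    intro c hc
    by_contra! h
    exact htau {c} ⟨by simpa using hc, fun f hf => ⟨c, mem_singleton_self c, h f hf⟩⟩
      (card_singleton c)
  obtain ⟨f, hf, hfe⟩ : ∃ f ∈ H, f ≠ e := by
    obtain ⟨c, hce, hc⟩ := exists_subset_card_eq (s := e) (n := k - 1) (by rw [hH e he]; omega)
    obtain ⟨h, hh, hch⟩ := huncovered c hc
    exact ⟨h, hh, fun h' => hch (h' ▸ hce)⟩
  obtain ⟨v, hv⟩ := hsingle f hf hfe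
  refine ⟨v, ⟨?_, ?_⟩, ?_⟩
  · have hmem : v ∈ f \ e := by rw [hv]; exact mem_singleton_self v
    exact (mem_sdiff.1 hmem).2
  · intro g hg hge
    obtain ⟨w, hw⟩ := hsingle g hg hge
    by_contra hne
    have hwv : w ≠ v := fun h => hne (h ▸ hw)
    have htrace : ∀ x ∈ H, x ≠ e → ∀ y ∈ H, y ≠ e → ∀ a b, x \ e = {a} → y \ e = {b} →
        a ≠ b → x ∩ e = y ∩ e := by
      intro x hx hxe y hy hye a b ha hb hab
      have hxy : x ≠ y := by
        rintro rfl
        exact hab (singleton_injective (ha.symm.trans hb))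
      exact inter_eq_inter_of_sdiff_eq_singleton (key x hx e he hxe) (key y hy e he hye)
        (key x hx y hy hxy) ha hb hab
    have hgf := htrace g hg hge f hf hfe w v hw hv hwv
    obtain ⟨h, hh, hch⟩ := huncovered (f ∩ e) (key f hf e he hfe)
    have hhe : h ≠ e := fun h' => hch (h' ▸ inter_subset_right)
    obtain ⟨u, hu⟩ := hsingle h hh hhe
    by_cases huv : u = v
    · have hhg := htrace h hh hhe g hg hge u w hu hw (huv ▸ hwv.symm)
      exact hch ((hhg.trans hgf) ▸ inter_subset_left)
    · have hhf := htrace h hh hhe f hf hfe u v hu hv huv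
      exact hch (hhf ▸ inter_subset_left)
  · rintro w ⟨-, hw⟩
    exact singleton_injective ((hw f hf hfe).symm.trans hv)
end

section
/- Let k ≥ 3, let H be a k-uniform hypergraph, let M be a maximum (k−1)-matching of H, and suppose M is partitioned into nonempty sets P₁ and P₂ such that |e ∩ e'| < k−2 for all e ∈ P₁ and e' ∈ P₂. For each matching edge f let T_f = {h ∈ H : |f ∩ h| ≥ k−1}, and set H₁ = ⋃_{e ∈ P₁} T_e and H₂ = ⋃_{e' ∈ P₂} T_{e'}. Then: (i) T_e ∩ T_{e'} = ∅ for all e ∈ P₁ and e' ∈ P₂; (ii) every edge of H lies in H₁ or H₂; (iii) ν^(k−1)(H₁) = |P₁| and ν^(k−1)(H₂) = |P₂|; and (iv) τ^(k−1)(H) ≤ τ^(k−1)(H₁) + τ^(k−1)(H₂). -/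
open Finset

/-- `Te k H e` is the set of edges of `H` meeting `e` in at least `k - 1` vertices. -/
def Te {V : Type*} [DecidableEq V] (k : ℕ) (H : Finset (Finset V)) (e : Finset V) :
    Finset (Finset V) :=
  H.filter (fun h => k - 1 ≤ (e ∩ h).card)

theorem IsMatching.mono {V : Type*} [DecidableEq V] {m : ℕ} {H M N : Finset (Finset V)}
    (hM : IsMatching m H M) (hN : N ⊆ M) : IsMatching m H N :=
  ⟨hN.trans hM.1, fun e he f hf => hM.2 e (hN he) f (hN hf)⟩

theorem IsMatching.union {V : Type*} [DecidableEq V] {m : ℕ} {H M N : Finset (Finset V)}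
    (hM : IsMatching m H M) (hN : IsMatching m H N)
    (hMN : ∀ e ∈ M, ∀ f ∈ N, (e ∩ f).card < m) : IsMatching m H (M ∪ N) := by
  refine ⟨union_subset hM.1 hN.1, fun e he f hf hne => ?_⟩
  rcases mem_union.1 he with he | he <;> rcases mem_union.1 hf with hf | hf
  · exact hM.2 e he f hf hne
  · exact hMN e he f hf
  · rw [inter_comm]
    exact hMN f hf e he
  · exact hN.2 e he f hf hne

theorem mem_Te {V : Type*} [DecidableEq V] {k : ℕ} {H : Finset (Finset V)} {e h : Finset V} :
    h ∈ Te k H e ↔ h ∈ H ∧ k - 1 ≤ (e ∩ h).card :=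
  mem_filter

theorem mem_Te_self {V : Type*} [DecidableEq V] {k : ℕ} {H : Finset (Finset V)}
    (hH : ∀ e ∈ H, e.card = k) {e : Finset V} (he : e ∈ H) : e ∈ Te k H e := by
  rw [mem_Te, inter_self, hH e he]
  exact ⟨he, Nat.sub_le k 1⟩

theorem biUnion_Te_subset {V : Type*} [DecidableEq V] (k : ℕ) (H P : Finset (Finset V)) :
    P.biUnion (Te k H) ⊆ H :=
  biUnion_subset.2 fun _ _ => filter_subset _ _

/-- If two edges meet in fewer than `k - 2` vertices, no edge meets both in `k - 1` vertices. -/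
theorem disjoint_Te {V : Type*} [DecidableEq V] {k : ℕ} {H : Finset (Finset V)}
    (hH : ∀ e ∈ H, e.card = k) {e f : Finset V} (hef : (e ∩ f).card < k - 2) :
    Disjoint (Te k H e) (Te k H f) := by
  rw [disjoint_left]
  intro h he hf
  rw [mem_Te] at he hf
  have hunion : ((e ∩ h) ∪ (f ∩ h)).card ≤ h.card :=
    card_le_card (union_subset inter_subset_right inter_subset_right)
  have hinter : ((e ∩ h) ∩ (f ∩ h)).card ≤ (e ∩ f).card :=
    card_le_card (inter_subset_inter inter_subset_left inter_subset_left)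
  have hsum := card_union_add_card_inter (e ∩ h) (f ∩ h)
  have hcard := hH h he.1
  omega

/-- Every edge lies in `T_e` for some edge `e` of a maximum `(k - 1)`-matching. -/
theorem exists_mem_Te {V : Type*} [DecidableEq V] {k : ℕ} {H M : Finset (Finset V)}
    (hH : ∀ e ∈ H, e.card = k) (hM : IsMatching (k - 1) H M)
    (hmax : ∀ M', IsMatching (k - 1) H M' → M'.card ≤ M.card) {h : Finset V} (hh : h ∈ H) :
    ∃ e ∈ M, h ∈ Te k H e := by
  by_contra! hcon
  have hnot : h ∉ M := fun hhM => hcon h hhM (mem_Te_self hH hh)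
  have hsingle : IsMatching (k - 1) H {h} := by
    refine ⟨singleton_subset_iff.2 hh, fun e he f hf hne => ?_⟩
    exact absurd ((mem_singleton.1 he).trans (mem_singleton.1 hf).symm) hne
  have hle := hmax _ (hM.union hsingle fun e he f hf => by
    rw [mem_singleton.1 hf]
    by_contra! hlt
    exact hcon e he (mem_Te.2 ⟨hh, hlt⟩))
  rw [card_union_of_disjoint (disjoint_singleton_right.2 hnot), card_singleton] at hle
  omega

theorem isMatching_biUnion_Te {V : Type*} [DecidableEq V] {k : ℕ} {H P : Finset (Finset V)}
    (hH : ∀ e ∈ H, e.card = k) (hP : IsMatching (k - 1) H P) :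
    IsMatching (k - 1) (P.biUnion (Te k H)) P :=
  ⟨fun e he => mem_biUnion.2 ⟨e, he, mem_Te_self hH (hP.1 he)⟩, hP.2⟩

/-- A matching in `⋃_{e ∈ P} T_e` can replace `P` in the maximum matching `P ∪ Q`. -/
theorem card_le_of_isMatching_biUnion_Te {V : Type*} [DecidableEq V] {k : ℕ}
    {H P Q N : Finset (Finset V)} (hH : ∀ e ∈ H, e.card = k) (hQ : IsMatching (k - 1) H Q)
    (hmax : ∀ M', IsMatching (k - 1) H M' → M'.card ≤ (P ∪ Q).card)
    (hcross : ∀ e ∈ P, ∀ f ∈ Q, (e ∩ f).card < k - 2)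
    (hN : IsMatching (k - 1) (P.biUnion (Te k H)) N) : N.card ≤ P.card := by
  have hNH : IsMatching (k - 1) H N := ⟨hN.1.trans (biUnion_Te_subset k H P), hN.2⟩
  have hnot : ∀ g ∈ N, ∀ f ∈ Q, g ∉ Te k H f := fun g hg f hf => by
    obtain ⟨e, he, hge⟩ := mem_biUnion.1 (hN.1 hg)
    exact disjoint_left.1 (disjoint_Te hH (hcross e he f hf)) hge
  have hdisj : Disjoint N Q :=
    disjoint_left.2 fun g hg hgQ => hnot g hg g hgQ (mem_Te_self hH (hQ.1 hgQ))
  have hle := hmax _ (hNH.union hQ fun g hg f hf => by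
    by_contra! hlt
    rw [inter_comm] at hlt
    exact hnot g hg f hf (mem_Te.2 ⟨hNH.1 hg, hlt⟩))
  rw [card_union_of_disjoint hdisj] at hle
  have := card_union_le P Q
  omega

/-- If a maximum `(k-1)`-matching `M` of a `k`-uniform hypergraph `H` is partitioned into
nonempty parts `P₁, P₂` with all cross intersections of size `< k - 2`, then (i) `T_e` and
`T_{e'}` are disjoint for `e ∈ P₁`, `e' ∈ P₂`; (ii) every edge of `H` lies in
`H₁ = ⋃_{e ∈ P₁} T_e` or `H₂ = ⋃_{e' ∈ P₂} T_{e'}`; (iii) `ν^(k-1)(H₁) = |P₁|` and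
`ν^(k-1)(H₂) = |P₂|`; and (iv) `τ^(k-1)(H) ≤ τ^(k-1)(H₁) + τ^(k-1)(H₂)`. -/
theorem stmt14 {V : Type*} [DecidableEq V] (k : ℕ) (hk : 3 ≤ k)
    (H : Finset (Finset V)) (hH : ∀ e ∈ H, e.card = k)
    (M : Finset (Finset V)) (hM : IsMatching (k - 1) H M)
    (hmax : ∀ M', IsMatching (k - 1) H M' → M'.card ≤ M.card)
    (P1 P2 : Finset (Finset V)) (hP : P1 ∪ P2 = M) (hdisj : Disjoint P1 P2)
    (hP1 : P1.Nonempty) (hP2 : P2.Nonempty)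
    (hcross : ∀ e ∈ P1, ∀ e' ∈ P2, (e ∩ e').card < k - 2) :
    (∀ e ∈ P1, ∀ e' ∈ P2, Disjoint (Te k H e) (Te k H e')) ∧
    (∀ h ∈ H, h ∈ P1.biUnion (Te k H) ∨ h ∈ P2.biUnion (Te k H)) ∧
    ((∃ M1, IsMatching (k - 1) (P1.biUnion (Te k H)) M1 ∧ M1.card = P1.card) ∧
      (∀ M1, IsMatching (k - 1) (P1.biUnion (Te k H)) M1 → M1.card ≤ P1.card)) ∧
    ((∃ M2, IsMatching (k - 1) (P2.biUnion (Te k H)) M2 ∧ M2.card = P2.card) ∧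
      (∀ M2, IsMatching (k - 1) (P2.biUnion (Te k H)) M2 → M2.card ≤ P2.card)) ∧
    (∀ C1 C2, IsCover (k - 1) (P1.biUnion (Te k H)) C1 →
      IsCover (k - 1) (P2.biUnion (Te k H)) C2 →
      ∃ C, IsCover (k - 1) H C ∧ C.card ≤ C1.card + C2.card) := by
  subst hP
  have hM1 : IsMatching (k - 1) H P1 := hM.mono subset_union_left
  have hM2 : IsMatching (k - 1) H P2 := hM.mono subset_union_right
  have hcov : ∀ h ∈ H, h ∈ P1.biUnion (Te k H) ∨ h ∈ P2.biUnion (Te k H) := fun h hh => by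
    obtain ⟨e, he, hhe⟩ := exists_mem_Te hH hM hmax hh
    exact (mem_union.1 he).imp (fun he => mem_biUnion.2 ⟨e, he, hhe⟩)
      (fun he => mem_biUnion.2 ⟨e, he, hhe⟩)
  refine ⟨fun e he f hf => disjoint_Te hH (hcross e he f hf), hcov,
    ⟨⟨P1, isMatching_biUnion_Te hH hM1, rfl⟩, fun N hN => ?_⟩,
    ⟨⟨P2, isMatching_biUnion_Te hH hM2, rfl⟩, fun N hN => ?_⟩, fun C1 C2 hC1 hC2 => ?_⟩
  · exact card_le_of_isMatching_biUnion_Te hH hM2 hmax hcross hN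
  · refine card_le_of_isMatching_biUnion_Te hH hM1 (union_comm P1 P2 ▸ hmax)
      (fun e he f hf => ?_) hN
    rw [inter_comm]
    exact hcross f hf e he
  · refine ⟨C1 ∪ C2, ⟨fun c hc => (mem_union.1 hc).elim (hC1.1 c) (hC2.1 c), fun h hh => ?_⟩,
      card_union_le C1 C2⟩
    rcases hcov h hh with h1 | h2
    · obtain ⟨c, hc, hch⟩ := hC1.2 h h1
      exact ⟨c, mem_union_left _ hc, hch⟩
    · obtain ⟨c, hc, hch⟩ := hC2.2 h h2
      exact ⟨c, mem_union_right _ hc, hch⟩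
end

section
/- Let H be a 3-uniform hypergraph, let M be a maximum 2-matching of H with |M| ≥ 2, and suppose there exists e ∈ M such that Σ_{v ∈ e} d_M(v) ≤ 4 and τ^(2)(S_e) = 1. Then there exists f ∈ M with f ≠ e such that τ^(2)(T_e ∪ T_f) ≤ 4 and ν^(2)(H \ (T_e ∪ T_f)) ≤ ν^(2)(H) − 2. -/
open Finset

/-- For a 3-uniform hypergraph: `T3 H e` is the set of edges of `H` meeting `e`
in at least 2 vertices. -/
def T3 {V : Type*} [DecidableEq V] (H : Finset (Finset V)) (e : Finset V) :
    Finset (Finset V) :=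
  H.filter (fun h => 2 ≤ (e ∩ h).card)

/-- For a 3-uniform hypergraph with 2-matching `M` and `e ∈ M`: `S3 H M e` is the set of
edges of `H` meeting `e` in at least 2 vertices, and meeting every other matching edge
in fewer than 2 vertices. -/
def S3 {V : Type*} [DecidableEq V] (H M : Finset (Finset V)) (e : Finset V) :
    Finset (Finset V) :=
  H.filter (fun h => 2 ≤ (e ∩ h).card ∧ ∀ f ∈ M, f ≠ e → (h ∩ f).card < 2)

/-- `dM M v` is the number of edges of `M` containing the vertex `v`. -/
def dM {V : Type*} [DecidableEq V] (M : Finset (Finset V)) (v : V) : ℕ :=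
  (M.filter (fun f => v ∈ f)).card

/-- Double counting: the degrees in `M` of the vertices of `e` add up to `∑ f ∈ M, |e ∩ f|`. -/
theorem sum_dM_eq_sum_card_inter {V : Type*} [DecidableEq V] (M : Finset (Finset V))
    (e : Finset V) : ∑ v ∈ e, dM M v = ∑ f ∈ M, (e ∩ f).card := by
  simp only [dM, card_filter]
  rw [sum_comm]
  refine sum_congr rfl fun f _ => ?_
  rw [← card_filter, filter_mem_eq_inter]

/-- If `e` has three vertices of total degree at most 4, at most one other edge of `M` meets `e`. -/
theorem eq_of_inter_nonempty_of_sum_dM_le {V : Type*} [DecidableEq V] {M : Finset (Finset V)}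
    {e f g : Finset V} (he : e ∈ M) (hcard : e.card = 3) (hdeg : ∑ v ∈ e, dM M v ≤ 4)
    (hf : f ∈ M) (hfe : f ≠ e) (hef : (e ∩ f).Nonempty)
    (hg : g ∈ M) (hge : g ≠ e) (heg : (e ∩ g).Nonempty) : g = f := by
  by_contra hgf
  have hsub : ({e, f, g} : Finset (Finset V)) ⊆ M := by
    simp [insert_subset_iff, he, hf, hg]
  have hle := sum_le_sum_of_subset (f := fun x => (e ∩ x).card) hsub
  rw [← sum_dM_eq_sum_card_inter M, sum_insert (by simp [hfe.symm, hge.symm]),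
    sum_pair (Ne.symm hgf), inter_self] at hle
  have := hef.card_pos
  have := heg.card_pos
  omega

/-- Two sets that each share at least two elements with a 3-set intersect. -/
theorem inter_nonempty_of_two_le_card_inter {V : Type*} [DecidableEq V] {e g h : Finset V}
    (hh : h.card = 3) (heh : 2 ≤ (e ∩ h).card) (hhg : 2 ≤ (h ∩ g).card) :
    (e ∩ g).Nonempty := by
  have hlt : h.card < (e ∩ h).card + (h ∩ g).card := by omega
  obtain ⟨v, hv⟩ :=
    inter_nonempty_of_card_lt_card_add_card inter_subset_right inter_subset_left hlt
  simp only [mem_inter] at hv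
  exact ⟨v, mem_inter.2 ⟨hv.1.1, hv.2.2⟩⟩

/-- The pairs inside `f` cover `T3 H f`. -/
theorem isCover_T3_powersetCard {V : Type*} [DecidableEq V] (H : Finset (Finset V))
    (f : Finset V) : IsCover 2 (T3 H f) (f.powersetCard 2) := by
  refine ⟨fun c hc => (mem_powersetCard.1 hc).2, fun h hh => ?_⟩
  obtain ⟨c, hc, hc2⟩ := exists_subset_card_eq (mem_filter.1 hh).2
  exact ⟨c, mem_powersetCard.2 ⟨hc.trans inter_subset_left, hc2⟩, hc.trans inter_subset_right⟩

/-- Two edges of a 2-matching can be added to any 2-matching avoiding their neighbourhoods. -/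
theorem IsMatching.insert_insert_of_sdiff_T3 {V : Type*} [DecidableEq V]
    {H M M' : Finset (Finset V)} {e f : Finset V} (hM : IsMatching 2 H M) (he : e ∈ M)
    (hf : f ∈ M) (hfe : f ≠ e) (hM' : IsMatching 2 (H \ (T3 H e ∪ T3 H f)) M') :
    IsMatching 2 H (insert e (insert f M')) := by
  have hlt : ∀ x ∈ M', x ∈ H ∧ (e ∩ x).card < 2 ∧ (f ∩ x).card < 2 := by
    intro x hx
    have := hM'.1 hx
    simp only [T3, mem_sdiff, mem_union, mem_filter] at this
    grind
  have hef := hM.2 e he f hf hfe.symm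
  refine ⟨insert_subset (hM.1 he) (insert_subset (hM.1 hf) fun x hx => (hlt x hx).1), ?_⟩
  intro x hx y hy hxy
  have hM'2 := hM'.2
  rw [mem_insert, mem_insert] at hx hy
  rcases hx with rfl | rfl | hx <;> rcases hy with rfl | rfl | hy <;>
    grind [inter_comm]

/-- Let `M` be a maximum 2-matching of a 3-uniform hypergraph `H` with `|M| ≥ 2`, and let
`e ∈ M` satisfy `Σ_{v ∈ e} d_M(v) ≤ 4` and `τ^(2)(S_e) = 1`. Then there is `f ∈ M`, `f ≠ e`,
with `τ^(2)(T_e ∪ T_f) ≤ 4` and `ν^(2)(H \ (T_e ∪ T_f)) ≤ ν^(2)(H) - 2`. -/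
theorem stmt15 {V : Type*} [DecidableEq V]
    (H : Finset (Finset V)) (hH : ∀ e ∈ H, e.card = 3)
    (M : Finset (Finset V)) (hM : IsMatching 2 H M)
    (hmax : ∀ M', IsMatching 2 H M' → M'.card ≤ M.card)
    (hM2 : 2 ≤ M.card)
    (e : Finset V) (he : e ∈ M)
    (hdeg : ∑ v ∈ e, dM M v ≤ 4)
    (htauSe : (∃ C, IsCover 2 (S3 H M e) C ∧ C.card = 1) ∧
      (∀ C, IsCover 2 (S3 H M e) C → 1 ≤ C.card)) :
    ∃ f ∈ M, f ≠ e ∧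
      (∃ C, IsCover 2 (T3 H e ∪ T3 H f) C ∧ C.card ≤ 4) ∧
      (∀ M', IsMatching 2 (H \ (T3 H e ∪ T3 H f)) M' → M'.card ≤ M.card - 2) := by
  obtain ⟨⟨C, hC, hC1⟩, -⟩ := htauSe
  obtain ⟨f, hf, hfe, huniq⟩ : ∃ f ∈ M, f ≠ e ∧
      ∀ g ∈ M, g ≠ e → (e ∩ g).Nonempty → g = f := by
    by_cases hmeet : ∃ f ∈ M, f ≠ e ∧ (e ∩ f).Nonempty
    · obtain ⟨f, hf, hfe, hef⟩ := hmeet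
      exact ⟨f, hf, hfe, fun g hg hge heg =>
        eq_of_inter_nonempty_of_sum_dM_le he (hH e (hM.1 he)) hdeg hf hfe hef hg hge heg⟩
    · obtain ⟨f, hf, hfe⟩ := exists_mem_ne (s := M) (by omega) e
      exact ⟨f, hf, hfe, fun g hg hge heg => absurd ⟨g, hg, hge, heg⟩ hmeet⟩
  have hcov := isCover_T3_powersetCard H f
  refine ⟨f, hf, hfe, ⟨C ∪ f.powersetCard 2, ⟨?_, ?_⟩, ?_⟩, ?_⟩
  · intro c hc
    exact (mem_union.1 hc).elim (hC.1 c) (hcov.1 c)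
  · intro h hh
    have hST : h ∈ S3 H M e ∨ h ∈ T3 H f := by
      refine (mem_union.1 hh).elim (fun hhe => ?_) Or.inr
      obtain ⟨hhH, hh2⟩ := mem_filter.1 hhe
      by_cases hS : ∀ g ∈ M, g ≠ e → (h ∩ g).card < 2
      · exact Or.inl (mem_filter.2 ⟨hhH, hh2, hS⟩)
      · push Not at hS
        obtain ⟨g, hg, hge, hg2⟩ := hS
        obtain rfl := huniq g hg hge (inter_nonempty_of_two_le_card_inter (hH h hhH) hh2 hg2)
        exact Or.inr (mem_filter.2 ⟨hhH, by rwa [inter_comm]⟩)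
    rcases hST with hS | hT
    · obtain ⟨c, hc, hch⟩ := hC.2 h hS
      exact ⟨c, mem_union_left _ hc, hch⟩
    · obtain ⟨c, hc, hch⟩ := hcov.2 h hT
      exact ⟨c, mem_union_right _ hc, hch⟩
  · refine (card_union_le _ _).trans ?_
    rw [hC1, card_powersetCard, hH f (hM.1 hf)]
    decide
  · intro M' hM'
    have hle := hmax _ (hM.insert_insert_of_sdiff_T3 he hf hfe hM')
    have hself : ∀ x ∈ M, x ∈ T3 H x := fun x hx =>
      mem_filter.2 ⟨hM.1 hx, by rw [inter_self, hH x (hM.1 hx)]; decide⟩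
    have hf' : f ∉ M' := fun h =>
      (mem_sdiff.1 (hM'.1 h)).2 (mem_union_right _ (hself f hf))
    have he' : e ∉ insert f M' := fun h => (mem_insert.1 h).elim hfe.symm fun h =>
      (mem_sdiff.1 (hM'.1 h)).2 (mem_union_left _ (hself e he))
    rw [card_insert_of_notMem he', card_insert_of_notMem hf'] at hle
    omega
end

section
/- Let e be a k-element set and let m be an integer with 2 ≤ m ≤ k−1, and set m' = max{0, 2m−k}. Then for any family S of m-element subsets of e with |S| > (1/2)·C(k,m), there exist distinct a, b ∈ S such that |a ∩ b| = m'. Here C(k,m) denotes the binomial coefficient k choose m. -/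
open Finset

/-- A family of more than half of the `r`-subsets of a `k`-set, where `1 ≤ r` and `2 * r ≤ k`,
contains two disjoint members. -/
theorem exists_disjoint_of_choose_lt_two_mul_card {V : Type*} [DecidableEq V] {k r : ℕ}
    (hr : 1 ≤ r) (hrk : 2 * r ≤ k) {e : Finset V} (he : e.card = k)
    {T : Finset (Finset V)} (hT : ∀ a ∈ T, a ⊆ e ∧ a.card = r)
    (hcard : k.choose r < 2 * T.card) :
    ∃ a ∈ T, ∃ b ∈ T, Disjoint a b := by
  by_contra! hdisj
  let f : Fin k → V := fun i => (e.equivFinOfCardEq he).symm i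
  have hf : Function.Injective f :=
    Subtype.val_injective.comp (e.equivFinOfCardEq he).symm.injective
  have hfe : ∀ x ∈ e, ∃ i, f i = x := fun x hx =>
    ⟨e.equivFinOfCardEq he ⟨x, hx⟩, by simp [f]⟩
  let g : Finset V → Finset (Fin k) := fun a => univ.filter fun i => f i ∈ a
  have hg : ∀ a ⊆ e, (g a).image f = a := by
    intro a ha
    ext x
    simp only [g, mem_image, mem_filter, mem_univ, true_and]
    constructor
    · rintro ⟨i, hi, rfl⟩
      exact hi
    · intro hx
      obtain ⟨i, rfl⟩ := hfe x (ha hx)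
      exact ⟨i, hx, rfl⟩
  have hinj : Set.InjOn g T := by
    intro a ha b hb hab
    rw [← hg a (hT a ha).1, ← hg b (hT b hb).1, hab]
  have hinter : ((T.image g : Finset (Finset (Fin k))) : Set (Finset (Fin k))).Intersecting := by
    intro a ha b hb hab
    simp only [coe_image, Set.mem_image, mem_coe] at ha hb
    obtain ⟨a, ha, rfl⟩ := ha
    obtain ⟨b, hb, rfl⟩ := hb
    apply hdisj a ha b hb
    rw [← hg a (hT a ha).1, ← hg b (hT b hb).1]
    exact (disjoint_image hf).2 hab
  have hsized : ((T.image g : Finset (Finset (Fin k))) : Set (Finset (Fin k))).Sized r := by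
    intro a ha
    simp only [coe_image, Set.mem_image, mem_coe] at ha
    obtain ⟨a, ha, rfl⟩ := ha
    rw [← card_image_of_injective _ hf, hg a (hT a ha).1, (hT a ha).2]
  have hekr := erdos_ko_rado hinter hsized (by lia)
  rw [card_image_of_injOn hinj] at hekr
  obtain ⟨n, rfl⟩ : ∃ n, k = n + 1 := ⟨k - 1, by lia⟩
  obtain ⟨s, rfl⟩ : ∃ s, r = s + 1 := ⟨r - 1, by lia⟩
  have hchoose := Nat.add_one_mul_choose_eq n s
  simp only [Nat.add_sub_cancel] at hekr
  nlinarith [Nat.zero_le (n.choose s)]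

/-- Let `e` be a `k`-set, `2 ≤ m ≤ k - 1`, and `m' = max {0, 2m - k}` (which in
truncated natural subtraction is `2 * m - k`). Any family `S` of `m`-subsets of `e` with
`|S| > (1/2) C(k,m)` contains two distinct members `a, b` with `|a ∩ b| = m'`. -/
theorem stmt16 {V : Type*} [DecidableEq V] (k m : ℕ) (hm2 : 2 ≤ m) (hmk : m ≤ k - 1)
    (e : Finset V) (he : e.card = k)
    (S : Finset (Finset V)) (hS : ∀ a ∈ S, a ⊆ e ∧ a.card = m)
    (hcard : k.choose m < 2 * S.card) :
    ∃ a ∈ S, ∃ b ∈ S, a ≠ b ∧ (a ∩ b).card = 2 * m - k := by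
  suffices h : ∃ a ∈ S, ∃ b ∈ S, (a ∩ b).card = 2 * m - k by
    obtain ⟨a, ha, b, hb, hab⟩ := h
    refine ⟨a, ha, b, hb, ?_, hab⟩
    rintro rfl
    rw [inter_self, (hS a ha).2] at hab
    lia
  rcases le_total (2 * m) k with hk | hk
  · obtain ⟨a, ha, b, hb, hab⟩ :=
      exists_disjoint_of_choose_lt_two_mul_card (by lia) hk he hS hcard
    exact ⟨a, ha, b, hb, by rw [disjoint_iff_inter_eq_empty.1 hab, card_empty]; lia⟩
  · have hinj : Set.InjOn (fun a => e \ a) (S : Set (Finset V)) := by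
      intro a ha b hb hab
      rw [← Finset.sdiff_sdiff_eq_self (hS a ha).1, ← Finset.sdiff_sdiff_eq_self (hS b hb).1]
      exact congrArg (e \ ·) hab
    obtain ⟨a', ha', b', hb', hab⟩ :=
      exists_disjoint_of_choose_lt_two_mul_card (r := k - m) (T := S.image fun a => e \ a)
        (by lia) (by lia) he
        (by
          intro c hc
          obtain ⟨a, ha, rfl⟩ := mem_image.1 hc
          exact ⟨sdiff_subset, by rw [card_sdiff_of_subset (hS a ha).1, he, (hS a ha).2]⟩)
        (by rwa [card_image_of_injOn hinj, Nat.choose_symm (by lia)])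
    obtain ⟨a, ha, rfl⟩ := mem_image.1 ha'
    obtain ⟨b, hb, rfl⟩ := mem_image.1 hb'
    refine ⟨a, ha, b, hb, ?_⟩
    have hunion : a ∪ b = e := by
      refine (union_subset (hS a ha).1 (hS b hb).1).antisymm fun x hx => ?_
      have : x ∈ e \ a → x ∉ e \ b := fun hxa => Finset.disjoint_left.1 hab hxa
      simp only [mem_sdiff, mem_union] at this ⊢
      tauto
    have hcount := card_union_add_card_inter a b
    rw [hunion, he, (hS a ha).2, (hS b hb).2] at hcount
    lia
end

section
/- Let k ≥ 5 and let G be the simple graph whose vertices are the (k−2)-element subsets of {1, ..., k}, with A and B adjacent if and only if |A ∩ B| = k−4. Then G has a perfect matching if C(k,2) is even, and G has a matching leaving exactly one vertex unsaturated if C(k,2) is odd. Here C(k,2) denotes the binomial coefficient k choose 2. -/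
/-- The graph whose vertices are the `(k-2)`-element subsets of `{1, ..., k}`
(modelled as `Fin k`), with `A` and `B` adjacent iff `|A ∩ B| = k - 4`. -/
def kGraph (k : ℕ) : SimpleGraph {A : Finset (Fin k) // A.card = k - 2} :=
  SimpleGraph.fromRel (fun A B => (A.1 ∩ B.1).card = k - 4)

/-- An involution whose non-fixed points are adjacent to their images yields a matching. -/
theorem SimpleGraph.exists_isMatching_of_involutive {V : Type*} (G : SimpleGraph V) (f : V → V)
    (hf : Function.Involutive f) (hadj : ∀ v, f v ≠ v → G.Adj v (f v)) :
    ∃ M : G.Subgraph, M.IsMatching ∧ M.verts = {v | f v ≠ v} := by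
  refine ⟨{ verts := {v | f v ≠ v}
            Adj := fun v w => f v ≠ v ∧ w = f v
            adj_sub := ?_
            edge_vert := fun h => h.1
            symm := ?_ }, ?_, rfl⟩
  · rintro v w ⟨h, rfl⟩
    exact hadj v h
  · constructor
    rintro v w ⟨h, rfl⟩
    exact ⟨by rw [hf v]; exact h.symm, (hf v).symm⟩
  · exact fun v hv => ⟨f v, ⟨hv, rfl⟩, fun w hw => hw.2⟩

/-- A perfect matching of the Kneser graph on the pairs `a < b < 5`. -/
def petersenPartner : ℕ → ℕ → ℕ × ℕ
  | 0, 1 => (2, 4)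
  | 2, 4 => (0, 1)
  | 1, 2 => (0, 3)
  | 0, 3 => (1, 2)
  | 2, 3 => (1, 4)
  | 1, 4 => (2, 3)
  | 3, 4 => (0, 2)
  | 0, 2 => (3, 4)
  | 0, 4 => (1, 3)
  | 1, 3 => (0, 4)
  | a, b => (a, b)

/-- A pairing of the pairs `a < b < k` into disjoint ones. The points are grouped in consecutive
couples `{c, c + 1}` with `c ≡ k [MOD 2]` (above `{0, ..., 4}` if `k` is odd); the pair `{a, c}`
with `a < c` goes with `{a + 1 mod c, c + 1}`, and the couples themselves are paired up in order.
The last couple may be left over, and is then fixed. -/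
def pairPartner (k a b : ℕ) : ℕ × ℕ :=
  if k % 2 = 1 ∧ b < 5 then petersenPartner a b
  else if b % 2 = k % 2 then (if a + 1 = b then 0 else a + 1, b + 1)
  else if a + 1 = b then
    if b % 4 = 1 ∨ b % 4 = 2 then
      if b + 1 = k then (a, b) else (a + 2, b + 2)
    else (a - 2, b - 2)
  else (if a = 0 then b - 2 else a - 1, b - 1)

theorem petersenPartner_spec {a b : ℕ} (hab : a < b) (hb : b < 5) :
    (petersenPartner a b).1 < (petersenPartner a b).2 ∧ (petersenPartner a b).2 < 5 ∧
    petersenPartner (petersenPartner a b).1 (petersenPartner a b).2 = (a, b) ∧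
    (petersenPartner a b).1 ≠ a ∧ (petersenPartner a b).1 ≠ b ∧
    (petersenPartner a b).2 ≠ a ∧ (petersenPartner a b).2 ≠ b := by
  interval_cases b <;> interval_cases a <;> simp [petersenPartner]

theorem pairPartner_lt {k a b : ℕ} (hk : 5 ≤ k) (hab : a < b) (hb : b < k) :
    (pairPartner k a b).1 < (pairPartner k a b).2 ∧ (pairPartner k a b).2 < k := by
  by_cases h : k % 2 = 1 ∧ b < 5
  · have := petersenPartner_spec hab h.2
    rw [pairPartner, if_pos h]
    omega
  · rw [pairPartner, if_neg h]
    split_ifs <;> simp only <;> omega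

theorem pairPartner_pairPartner {k a b : ℕ} (hab : a < b) (hb : b < k) :
    pairPartner k (pairPartner k a b).1 (pairPartner k a b).2 = (a, b) := by
  by_cases h : k % 2 = 1 ∧ b < 5
  · obtain ⟨-, h2, h3, -⟩ := petersenPartner_spec hab h.2
    rw [show pairPartner k a b = petersenPartner a b from if_pos h, pairPartner,
      if_pos ⟨h.1, h2⟩, h3]
  · have key : ¬ (k % 2 = 1 ∧ (pairPartner k a b).2 < 5) := by
      rw [pairPartner, if_neg h]
      split_ifs <;> simp only <;> omega
    rw [pairPartner, if_neg key, pairPartner, if_neg h]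
    split_ifs <;> simp only [Prod.mk.injEq, not_true_eq_false] at * <;> omega

theorem pairPartner_disjoint {k a b : ℕ} (hab : a < b)
    (hne : ¬ ((k % 4 = 2 ∨ k % 4 = 3) ∧ a + 2 = k ∧ b + 1 = k)) :
    (pairPartner k a b).1 ≠ a ∧ (pairPartner k a b).1 ≠ b ∧
    (pairPartner k a b).2 ≠ a ∧ (pairPartner k a b).2 ≠ b := by
  by_cases h : k % 2 = 1 ∧ b < 5
  · have := petersenPartner_spec hab h.2
    rw [pairPartner, if_pos h]
    omega
  · rw [pairPartner, if_neg h]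
    split_ifs <;> simp only <;> omega

theorem pairPartner_eq_self {k a b : ℕ} (hk : 5 ≤ k)
    (h : (k % 4 = 2 ∨ k % 4 = 3) ∧ a + 2 = k ∧ b + 1 = k) : pairPartner k a b = (a, b) := by
  rw [pairPartner, if_neg (by omega), if_neg (by omega), if_pos (by omega), if_pos (by omega),
    if_pos (by omega)]

/-- The pairs of natural numbers `a < b < k`. -/
abbrev LtPair (k : ℕ) := {p : ℕ × ℕ // p.1 < p.2 ∧ p.2 < k}

/-- The two-element subset of `Fin k` given by a pair `a < b < k`. -/
def LtPair.toFinset {k : ℕ} (p : LtPair k) : Finset (Fin k) :=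
  {⟨p.1.1, p.2.1.trans p.2.2⟩, ⟨p.1.2, p.2.2⟩}

theorem LtPair.card_toFinset {k : ℕ} (p : LtPair k) : p.toFinset.card = 2 :=
  Finset.card_pair (by simpa [Fin.ext_iff] using p.2.1.ne)

theorem LtPair.toFinset_injective {k : ℕ} :
    Function.Injective (LtPair.toFinset : LtPair k → Finset (Fin k)) := by
  rintro ⟨⟨a, b⟩, hab, hb⟩ ⟨⟨c, d⟩, hcd, hd⟩ h
  have h1 := Finset.ext_iff.1 h ⟨a, hab.trans hb⟩
  have h2 := Finset.ext_iff.1 h ⟨b, hb⟩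
  simp only [LtPair.toFinset, Finset.mem_insert, Finset.mem_singleton, Fin.ext_iff, true_or, or_true,
    true_iff] at h1 h2
  simp only at hab hcd
  simp only [Subtype.mk.injEq, Prod.mk.injEq]
  omega

theorem LtPair.exists_toFinset_eq {k : ℕ} {s : Finset (Fin k)} (hs : s.card = 2) :
    ∃ p : LtPair k, p.toFinset = s := by
  obtain ⟨x, y, hxy, rfl⟩ := Finset.card_eq_two.1 hs
  rcases lt_or_gt_of_ne hxy with h | h
  · exact ⟨⟨(x, y), h, y.2⟩, rfl⟩
  · exact ⟨⟨(y, x), h, x.2⟩, Finset.pair_comm _ _⟩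

/-- Pairs `a < b < k` correspond to `(k - 2)`-element subsets of `Fin k` by complementation. -/
noncomputable def ltPairEquiv {k : ℕ} (hk : 2 ≤ k) :
    LtPair k ≃ {A : Finset (Fin k) // A.card = k - 2} :=
  Equiv.ofBijective
    (fun p => ⟨p.toFinsetᶜ, by rw [Finset.card_compl, Fintype.card_fin, p.card_toFinset]⟩) <| by
    constructor
    · intro p q h
      exact LtPair.toFinset_injective (compl_injective (congrArg Subtype.val h))
    · rintro ⟨A, hA⟩
      obtain ⟨p, hp⟩ := LtPair.exists_toFinset_eq (s := Aᶜ)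
        (by rw [Finset.card_compl, Fintype.card_fin, hA]; omega)
      exact ⟨p, Subtype.ext (by simp [hp])⟩

theorem kGraph_adj_ltPairEquiv {k : ℕ} (hk : 2 ≤ k) {p q : LtPair k}
    (h : Disjoint p.toFinset q.toFinset) :
    (kGraph k).Adj (ltPairEquiv hk p) (ltPairEquiv hk q) := by
  rw [kGraph, SimpleGraph.fromRel_adj]
  refine ⟨fun e => ?_, Or.inl ?_⟩
  · rw [(ltPairEquiv hk).injective e, disjoint_self, Finset.bot_eq_empty] at h
    simpa [h] using q.card_toFinset
  · change (p.toFinsetᶜ ∩ q.toFinsetᶜ).card = k - 4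
    rw [← Finset.compl_union, Finset.card_compl, Fintype.card_fin, Finset.card_union_of_disjoint h,
      p.card_toFinset, q.card_toFinset]

theorem Nat.even_choose_two_iff (k : ℕ) : Even (k.choose 2) ↔ k % 4 = 0 ∨ k % 4 = 1 := by
  have h2 : k.choose 2 * 2 = k * (k - 1) := by
    rw [Nat.choose_two_right, Nat.div_mul_cancel (Nat.even_mul_pred_self k).two_dvd]
  obtain ⟨m, r, hr, rfl⟩ : ∃ m r, r < 4 ∧ k = 4 * m + r :=
    ⟨k / 4, k % 4, Nat.mod_lt _ (by norm_num), (Nat.div_add_mod k 4).symm⟩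
  rw [Nat.even_iff]
  generalize (4 * m + r).choose 2 = c at *
  interval_cases r
  · cases m with
    | zero => omega
    | succ n =>
      rw [show 4 * (n + 1) + 0 - 1 = 4 * n + 3 by omega] at h2
      ring_nf at h2
      omega
  all_goals
    simp only [Nat.add_sub_cancel, show 4 * m + 2 - 1 = 4 * m + 1 by omega,
      show 4 * m + 3 - 1 = 4 * m + 2 by omega] at h2
    ring_nf at h2
    omega

/-- `kGraph k` has a matching whose unsaturated vertices are, up to complementation, the pair
`{k - 2, k - 1}` if `k` is `2` or `3` modulo `4`, and none otherwise. -/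
theorem kGraph_exists_isMatching {k : ℕ} (hk : 5 ≤ k) :
    ∃ M : (kGraph k).Subgraph, M.IsMatching ∧ ∀ p : LtPair k,
      ltPairEquiv (by omega) p ∉ M.verts ↔
        (k % 4 = 2 ∨ k % 4 = 3) ∧ p.1.1 + 2 = k ∧ p.1.2 + 1 = k := by
  let e := ltPairEquiv (k := k) (by omega)
  let g : LtPair k → LtPair k := fun p =>
    ⟨pairPartner k p.1.1 p.1.2, pairPartner_lt hk p.2.1 p.2.2⟩
  have hg : Function.Involutive g := fun p => Subtype.ext (pairPartner_pairPartner p.2.1 p.2.2)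
  have hfix : ∀ p, g p = p ↔ (k % 4 = 2 ∨ k % 4 = 3) ∧ p.1.1 + 2 = k ∧ p.1.2 + 1 = k := by
    refine fun p => ⟨fun h => ?_, fun h => Subtype.ext (pairPartner_eq_self hk h)⟩
    by_contra hne
    exact (pairPartner_disjoint p.2.1 hne).1 (congrArg (fun q : LtPair k => q.1.1) h)
  obtain ⟨M, hM, hv⟩ := (kGraph k).exists_isMatching_of_involutive (fun v => e (g (e.symm v)))
    (fun v => by simp [hg _]) (fun v hv => by
      obtain ⟨p, rfl⟩ := e.surjective v
      simp only [Equiv.symm_apply_apply, ne_eq, EmbeddingLike.apply_eq_iff_eq] at hv ⊢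
      refine kGraph_adj_ltPairEquiv _ ?_
      obtain ⟨h1, h2, h3, h4⟩ := pairPartner_disjoint p.2.1 ((hfix p).not.1 hv)
      simp only [g, LtPair.toFinset, Finset.disjoint_insert_left, Finset.disjoint_singleton_left,
        Finset.mem_insert, Finset.mem_singleton, Fin.ext_iff]
      omega)
  refine ⟨M, hM, fun p => ?_⟩
  rw [hv, ← hfix]
  change ¬ e (g (e.symm (e p))) ≠ e p ↔ _
  simp

/-- For `k ≥ 5`, the graph `kGraph k` has a perfect matching when `C(k,2)` is even, and a
matching leaving exactly one vertex unsaturated when `C(k,2)` is odd. -/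
theorem stmt17 (k : ℕ) (hk : 5 ≤ k) :
    (Even (k.choose 2) → ∃ M : (kGraph k).Subgraph, M.IsPerfectMatching) ∧
    (¬ Even (k.choose 2) →
      ∃ M : (kGraph k).Subgraph, M.IsMatching ∧ ∃! v : {A : Finset (Fin k) // A.card = k - 2},
        v ∉ M.verts) := by
  have hk2 : 2 ≤ k := by omega
  obtain ⟨M, hM, hv⟩ := kGraph_exists_isMatching hk
  rw [Nat.even_choose_two_iff]
  refine ⟨fun h => ⟨M, hM, fun v => ?_⟩, fun h => ⟨M, hM, ?_⟩⟩
  · obtain ⟨p, rfl⟩ := (ltPairEquiv hk2).surjective v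
    by_contra hp
    have := (hv p).1 hp
    omega
  · refine ⟨ltPairEquiv hk2 ⟨(k - 2, k - 1), by simp only; omega⟩,
      (hv _).2 (by simp only; omega), fun v hp => ?_⟩
    obtain ⟨p, rfl⟩ := (ltPairEquiv hk2).surjective v
    have := (hv p).1 hp
    exact congrArg _ (Subtype.ext (Prod.ext (by simp only; omega) (by simp only; omega)))
end

section
/- Let k ≥ 5 and let H be a k-uniform hypergraph with ν^(k−2)(H) = 1. If there exists an edge e ∈ H such that every edge f ∈ H with f ≠ e satisfies |e ∩ f| = k−2, then τ^(k−2)(H) ≤ ⌈(C(k,2) + 1)/2⌉, where C(k,2) denotes the binomial coefficient k choose 2. -/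
open Finset

/-- A family whose members pairwise meet in at least `m` vertices has an `m`-cover using one set
for every two members. -/
theorem exists_isCover_of_pairwise_inter {V : Type*} [DecidableEq V] (m n : ℕ)
    (L : Finset (Finset V)) (hn : L.card ≤ n)
    (hL : ∀ f ∈ L, ∀ g ∈ L, m ≤ (f ∩ g).card) :
    ∃ C, IsCover m L C ∧ C.card ≤ (n + 1) / 2 := by
  induction n using Nat.strong_induction_on generalizing L with
  | _ n ih =>
    rcases L.eq_empty_or_nonempty with rfl | ⟨f, hf⟩
    · exact ⟨∅, ⟨by simp, by simp⟩, by simp⟩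
    have hpos : 0 < L.card := card_pos.2 ⟨f, hf⟩
    have hcf := card_erase_of_mem hf
    rcases (L.erase f).eq_empty_or_nonempty with h | ⟨g, hg⟩
    · obtain ⟨c, hcs, hc⟩ := exists_subset_card_eq (hL f hf f hf)
      refine ⟨{c}, ⟨by simpa using hc, fun e he => ⟨c, by simp, ?_⟩⟩, by simp; omega⟩
      have hef : e = f := by
        by_contra hne
        exact notMem_empty e (h ▸ mem_erase.2 ⟨hne, he⟩)
      subst hef
      exact hcs.trans inter_subset_left
    · have hcg := card_erase_of_mem hg
      have hgpos : 0 < (L.erase f).card := card_pos.2 ⟨g, hg⟩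
      obtain ⟨c, hcs, hc⟩ := exists_subset_card_eq (hL f hf g (mem_of_mem_erase hg))
      obtain ⟨C, ⟨hC1, hC2⟩, hC⟩ := ih (n - 2) (by omega) ((L.erase f).erase g) (by omega)
        (fun a ha b hb => hL a (mem_of_mem_erase (mem_of_mem_erase ha)) b
          (mem_of_mem_erase (mem_of_mem_erase hb)))
      refine ⟨insert c C, ⟨?_, fun e he => ?_⟩, ?_⟩
      · intro d hd
        rcases mem_insert.1 hd with rfl | hd
        exacts [hc, hC1 d hd]
      · by_cases h1 : e = f
        · exact ⟨c, mem_insert_self _ _, h1 ▸ hcs.trans inter_subset_left⟩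
        by_cases h2 : e = g
        · exact ⟨c, mem_insert_self _ _, h2 ▸ hcs.trans inter_subset_right⟩
        obtain ⟨d, hd, hde⟩ := hC2 e (mem_erase.2 ⟨h2, mem_erase.2 ⟨h1, he⟩⟩)
        exact ⟨d, mem_insert_of_mem hd, hde⟩
      · have := card_insert_le c C
        omega

/-- The number of `n`-subsets of `e` whose union with a fixed `t ⊆ e` is all of `e`. -/
theorem card_filter_powersetCard_union_eq {V : Type*} [DecidableEq V] (n : ℕ) (e t : Finset V)
    (ht : t ⊆ e) (hn : (e \ t).card ≤ n) :
    ((e.powersetCard n).filter (fun z => e ⊆ t ∪ z)).card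
      = t.card.choose (n - (e \ t).card) := by
  rw [← card_powersetCard]
  refine card_bij' (fun z _ => z ∩ t) (fun w _ => w ∪ e \ t) ?_ ?_ ?_ ?_
  · intro z hz
    simp only [mem_filter, mem_powersetCard] at hz ⊢
    obtain ⟨⟨hze, hzc⟩, hu⟩ := hz
    refine ⟨inter_subset_right, ?_⟩
    have h1 : z \ t = e \ t := by
      ext x
      have := @hze x
      have := @hu x
      simp only [mem_sdiff, mem_union] at *
      tauto
    have := card_inter_add_card_sdiff z t
    rw [h1] at this
    omega
  · intro w hw
    simp only [mem_filter, mem_powersetCard] at hw ⊢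
    obtain ⟨hwt, hwc⟩ := hw
    refine ⟨⟨union_subset (hwt.trans ht) sdiff_subset, ?_⟩, ?_⟩
    · rw [card_union_of_disjoint (disjoint_sdiff.mono_left hwt), hwc]
      omega
    · intro x hx
      simp only [mem_union, mem_sdiff]
      tauto
  · intro z hz
    simp only [mem_filter, mem_powersetCard] at hz
    ext x
    have := @hz.1.1 x
    have := @hz.2 x
    have := @ht x
    simp only [mem_sdiff, mem_union, mem_inter] at *
    tauto
  · intro w hw
    simp only [mem_powersetCard] at hw
    ext x
    have := @hw.1 x
    simp only [mem_sdiff, mem_union, mem_inter] at *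
    tauto

/-- If the traces of `f` and `g` on `e` together cover `e`, both of size `k - 2`, and `f`, `g` meet
in at least `k - 2` vertices, then `f` and `g` agree outside `e`. -/
theorem sdiff_eq_sdiff_of_subset_union {V : Type*} [DecidableEq V] {k : ℕ}
    {e f g : Finset V} (he : e.card = k) (hf : f.card = k) (hg : g.card = k)
    (hef : (e ∩ f).card = k - 2) (heg : (e ∩ g).card = k - 2)
    (hfg : k - 2 ≤ (f ∩ g).card) (hu : e ⊆ (e ∩ f) ∪ (e ∩ g)) : f \ e = g \ e := by
  have h1 := card_inter_add_card_sdiff f e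
  have h2 := card_inter_add_card_sdiff g e
  rw [inter_comm] at h1 h2
  have h3 := card_union_add_card_inter (e ∩ f) (e ∩ g)
  have h4 := card_inter_add_card_sdiff (f ∩ g) e
  have h5 : (e ∩ f) ∪ (e ∩ g) = e :=
    Subset.antisymm (union_subset inter_subset_left inter_subset_left) hu
  have h6 : (e ∩ f) ∩ (e ∩ g) = (f ∩ g) ∩ e := by
    ext x
    simp only [mem_inter]
    tauto
  rw [h5, h6] at h3
  have hF : (f ∩ g) \ e = f \ e :=
    eq_of_subset_of_card_le (sdiff_subset_sdiff inter_subset_left Subset.rfl) (by omega)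
  have hG : (f ∩ g) \ e = g \ e :=
    eq_of_subset_of_card_le (sdiff_subset_sdiff inter_subset_right Subset.rfl) (by omega)
  exact hF.symm.trans hG

/-- Let `k ≥ 5` and let `H` be a `k`-uniform hypergraph with `ν^(k-2)(H) = 1`. If some edge
`e ∈ H` intersects every other edge in exactly `k - 2` vertices, then
`τ^(k-2)(H) ≤ ⌈(C(k,2) + 1)/2⌉` (i.e. `(C(k,2) + 2)/2` in natural division). -/
theorem stmt18 {V : Type*} [DecidableEq V] (k : ℕ) (hk : 5 ≤ k)
    (H : Finset (Finset V)) (hH : ∀ e ∈ H, e.card = k)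
    (hex : ∃ M, IsMatching (k - 2) H M ∧ M.card = 1)
    (hmax : ∀ M, IsMatching (k - 2) H M → M.card ≤ 1)
    (hedge : ∃ e ∈ H, ∀ f ∈ H, f ≠ e → (e ∩ f).card = k - 2) :
    ∃ C, IsCover (k - 2) H C ∧ C.card ≤ (k.choose 2 + 2) / 2 := by
  classical
  obtain ⟨e, he, hint⟩ := hedge
  have hek := hH e he
  have hpair : ∀ f ∈ H, ∀ g ∈ H, k - 2 ≤ (f ∩ g).card := by
    intro f hf g hg
    by_contra! hlt
    have hne : f ≠ g := by
      rintro rfl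
      rw [inter_self, hH f hf] at hlt
      omega
    have := hmax {f, g} ⟨by simp [insert_subset_iff, hf, hg], by
      intro a ha b hb hab
      simp only [mem_insert, mem_singleton] at ha hb
      rcases ha with rfl | rfl <;> rcases hb with rfl | rfl
      · exact absurd rfl hab
      · exact hlt
      · rwa [inter_comm]
      · exact absurd rfl hab⟩
    rw [card_pair hne] at this
    omega
  have hint' : ∀ f ∈ H.erase e, (e ∩ f).card = k - 2 := fun f hf =>
    hint f (mem_of_mem_erase hf) (ne_of_mem_erase hf)
  set S := e.powersetCard (k - 2) with hS
  have hScard : S.card = k.choose 2 := by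
    rw [hS, card_powersetCard, hek, Nat.choose_symm (by omega)]
  set G := (H.erase e).image (fun f => e ∩ f) with hG
  have hGS : G ⊆ S := by
    intro t ht
    obtain ⟨f, hf, rfl⟩ := mem_image.1 ht
    exact mem_powersetCard.2 ⟨inter_subset_left, hint' f hf⟩
  let P : Finset V → Prop := fun f => ∀ g ∈ H.erase e, e ∩ g = e ∩ f → g = f
  set L := (H.erase e).filter P with hL
  set T := ((H.erase e).filter (fun f => ¬ P f)).image (fun f => e ∩ f) with hT
  have hTG : T ⊆ G := image_subset_image (filter_subset _ _)
  have hLcard : (L.image (fun f => e ∩ f)).card = L.card := by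
    refine card_image_of_injOn fun f hf g hg hfg => ?_
    exact (mem_filter.1 hg).2 f (mem_filter.1 hf).1 hfg
  have hdisj : Disjoint T (L.image (fun f => e ∩ f)) := by
    rw [disjoint_left]
    intro t ht ht'
    obtain ⟨f, hf, rfl⟩ := mem_image.1 ht
    obtain ⟨g, hg, hgf⟩ := mem_image.1 ht'
    obtain ⟨hf1, hf2⟩ := mem_filter.1 hf
    obtain ⟨hg1, hg2⟩ := mem_filter.1 hg
    have := hg2 f hf1 hgf.symm
    subst this
    exact hf2 hg2
  have hTL : T.card + L.card ≤ G.card := by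
    rw [← hLcard, ← card_union_of_disjoint hdisj]
    exact card_le_card (union_subset hTG (image_subset_image (filter_subset _ _)))
  have hcount : ∀ t ∈ S, (S.filter (fun z => e ⊆ t ∪ z)).card = (k - 2).choose (k - 4) := by
    intro t ht
    obtain ⟨hte, htc⟩ := mem_powersetCard.1 ht
    have hd : (e \ t).card = 2 := by
      rw [card_sdiff_of_subset hte]
      omega
    rw [hS, card_filter_powersetCard_union_eq _ _ _ hte (by omega), htc, hd]
    congr 1
  have hvoid : T.card ≤ (S \ G).card := by
    have hpos : 0 < (k - 2).choose (k - 4) := Nat.choose_pos (by omega)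
    refine Nat.le_of_mul_le_mul_right
      (card_mul_le_card_mul (fun t z => e ⊆ t ∪ z) (fun t ht => ?_) (fun z hz => ?_)) hpos
    · rw [← hcount t (hGS (hTG ht))]
      refine card_le_card fun z hz => ?_
      obtain ⟨hzS, hz⟩ := mem_filter.1 hz
      refine mem_filter.2 ⟨mem_sdiff.2 ⟨hzS, fun hzG => ?_⟩, hz⟩
      obtain ⟨g, hg, rfl⟩ := mem_image.1 hzG
      obtain ⟨f, hf, rfl⟩ := mem_image.1 ht
      obtain ⟨hf, hfP⟩ := mem_filter.1 hf
      refine hfP fun f' hf' hff' => ?_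
      have key : ∀ a ∈ H.erase e, e ∩ a = e ∩ f → a \ e = g \ e := fun a ha haf =>
        sdiff_eq_sdiff_of_subset_union hek (hH a (mem_of_mem_erase ha))
          (hH g (mem_of_mem_erase hg)) (hint' a ha) (hint' g hg)
          (hpair a (mem_of_mem_erase ha) g (mem_of_mem_erase hg)) (by rw [haf]; exact hz)
      have hs : f' \ e = f \ e := (key f' hf' hff').trans (key f hf rfl).symm
      rw [← sdiff_union_inter f' e, ← sdiff_union_inter f e, hs, inter_comm f', hff',
        inter_comm f]
    · rw [← hcount z (mem_sdiff.1 hz).1]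
      refine card_le_card fun t ht => ?_
      obtain ⟨htT, ht⟩ := mem_filter.1 ht
      exact mem_filter.2 ⟨hGS (hTG htT), by rwa [union_comm]⟩
  have hSG := card_sdiff_add_card_eq_card hGS
  have hLH : insert e L ⊆ H :=
    insert_subset he ((filter_subset _ _).trans (erase_subset _ _))
  obtain ⟨C, ⟨hC1, hC2⟩, hC⟩ := exists_isCover_of_pairwise_inter (k - 2) (L.card + 1)
    (insert e L) (card_insert_le _ _) (fun f hf g hg => hpair f (hLH hf) g (hLH hg))
  refine ⟨T ∪ C, ⟨fun c hc => ?_, fun f hf => ?_⟩, ?_⟩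
  · rcases mem_union.1 hc with hc | hc
    exacts [(mem_powersetCard.1 (hGS (hTG hc))).2, hC1 c hc]
  · by_cases hfL : f ∈ insert e L
    · obtain ⟨c, hc, hcf⟩ := hC2 f hfL
      exact ⟨c, mem_union_right _ hc, hcf⟩
    · rw [mem_insert, not_or] at hfL
      have hfe : f ∈ H.erase e := mem_erase.2 ⟨hfL.1, hf⟩
      refine ⟨e ∩ f, mem_union_left _ (mem_image_of_mem _ (mem_filter.2 ⟨hfe, fun hP => ?_⟩)),
        inter_subset_right⟩
      exact hfL.2 (mem_filter.2 ⟨hfe, hP⟩)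
  · have := card_union_le T C
    omega
end

section
/- Let 2 ≤ m < k, let H be a k-uniform hypergraph, and let c be a nonnegative real number such that every subcollection H' of the edges of H with ν^(m)(H') = 1 satisfies τ*^(m)(H') ≤ c. Then τ*^(m)(H) ≤ (1/2)·(C(k,m) + c)·ν^(m)(H), where C(k,m) denotes the binomial coefficient k choose m. -/
open Finset

/-- If an edge `e` of a maximum matching `M` is the only edge of `M` that two edges `f`, `g` of `H`
meet in at least `m` vertices, then `f` and `g` meet each other in at least `m` vertices. -/
theorem le_card_inter_of_private {V : Type*} [DecidableEq V] {m : ℕ} {H M : Finset (Finset V)}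
    (hM : IsMatching m H M) (hmax : ∀ N, IsMatching m H N → N.card ≤ M.card) {e f g : Finset V}
    (he : e ∈ M) (hf : f ∈ H) (hg : g ∈ H) (hfm : m ≤ f.card) (hgm : m ≤ g.card) (hfg : f ≠ g)
    (hfe : ∀ e' ∈ M, e' ≠ e → (f ∩ e').card < m) (hge : ∀ e' ∈ M, e' ≠ e → (g ∩ e').card < m) :
    m ≤ (f ∩ g).card := by
  by_contra! hlt
  have hfn : f ∉ M.erase e := fun h => by
    have := hfe f (mem_of_mem_erase h) (ne_of_mem_erase h)
    rw [inter_self] at this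
    omega
  have hgn : g ∉ M.erase e := fun h => by
    have := hge g (mem_of_mem_erase h) (ne_of_mem_erase h)
    rw [inter_self] at this
    omega
  have hN : IsMatching m H (insert f (insert g (M.erase e))) := by
    refine ⟨?_, ?_⟩
    · intro x hx
      simp only [mem_insert, mem_erase] at hx
      rcases hx with rfl | rfl | hx
      exacts [hf, hg, hM.1 hx.2]
    · intro x hx y hy hxy
      simp only [mem_insert, mem_erase] at hx hy
      rcases hx with rfl | rfl | hx <;> rcases hy with rfl | rfl | hy
      · exact absurd rfl hxy
      · exact hlt
      · exact hfe y hy.2 hy.1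
      · rwa [inter_comm]
      · exact absurd rfl hxy
      · exact hge y hy.2 hy.1
      · rw [inter_comm]; exact hfe x hx.2 hx.1
      · rw [inter_comm]; exact hge x hx.2 hx.1
      · exact hM.2 x hx.2 y hy.2 hxy
  have hcard := hmax _ hN
  rw [card_insert_of_notMem (by simp [hfg, hfn]), card_insert_of_notMem hgn,
    card_erase_of_mem he] at hcard
  have := card_pos.mpr ⟨e, he⟩
  omega

/-- Every edge of `H` meets some edge of a maximum matching in at least `m` vertices. -/
theorem exists_le_card_inter {V : Type*} [DecidableEq V] {m : ℕ} {H M : Finset (Finset V)}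
    (hM : IsMatching m H M) (hmax : ∀ N, IsMatching m H N → N.card ≤ M.card) {f : Finset V}
    (hf : f ∈ H) (hfm : m ≤ f.card) : ∃ e ∈ M, m ≤ (f ∩ e).card := by
  by_contra! hlt
  have hfn : f ∉ M := fun h => by
    have := hlt f h
    rw [inter_self] at this
    omega
  have hN : IsMatching m H (insert f M) := by
    refine ⟨insert_subset hf hM.1, ?_⟩
    intro x hx y hy hxy
    rw [mem_insert] at hx hy
    rcases hx with rfl | hx <;> rcases hy with rfl | hy
    · exact absurd rfl hxy
    · exact hlt y hy
    · rw [inter_comm]; exact hlt x hx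
    · exact hM.2 x hx y hy hxy
  have hcard := hmax _ hN
  rw [card_insert_of_notMem hfn] at hcard
  omega

/-- The indicator of the subsets of `e` gives weight at least one to every set that meets `e` in
at least `m` vertices. -/
theorem one_le_sum_indicator_subset {V : Type*} [DecidableEq V] {m : ℕ} {e f : Finset V}
    (h : m ≤ (f ∩ e).card) :
    (1 : ℝ) ≤ ∑ S ∈ f.powersetCard m, if S ⊆ e then 1 else 0 := by
  obtain ⟨S, hS, hSm⟩ := exists_subset_card_eq h
  have hSf : S ∈ f.powersetCard m := mem_powersetCard.2 ⟨hS.trans inter_subset_left, hSm⟩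
  calc (1 : ℝ) = if S ⊆ e then 1 else 0 := by rw [if_pos (hS.trans inter_subset_right)]
    _ ≤ _ := single_le_sum (f := fun S => if S ⊆ e then (1 : ℝ) else 0)
      (fun _ _ => by positivity) hSf

/-- Let `2 ≤ m < k`, let `H` be a `k`-uniform hypergraph, and suppose `c ≥ 0` is such that
every subcollection `H'` of the edges of `H` with `ν^(m)(H') = 1` satisfies `τ*^(m)(H') ≤ c`.
Then `τ*^(m)(H) ≤ (1/2)(C(k,m) + c) · ν^(m)(H)`. -/
theorem stmt19 {V : Type*} [Fintype V] [DecidableEq V] (k m : ℕ) (hm : 2 ≤ m) (hmk : m < k)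
    (H : Finset (Finset V)) (hH : ∀ e ∈ H, e.card = k)
    (c : ℝ) (hc : 0 ≤ c)
    (hsub : ∀ H' ⊆ H, (∃ M, IsMatching m H' M ∧ M.card = 1) →
      (∀ M, IsMatching m H' M → M.card ≤ 1) →
      ∃ w, IsFracCover m H' w ∧ fracSize m w ≤ c)
    (n : ℕ) (hex : ∃ M, IsMatching m H M ∧ M.card = n)
    (hmax : ∀ M, IsMatching m H M → M.card ≤ n) :
    ∃ w, IsFracCover m H w ∧
      fracSize m w ≤ ((k.choose m : ℝ) + c) / 2 * (n : ℝ) := by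
  obtain ⟨M, hM, rfl⟩ := hex
  have hle : ∀ f ∈ H, m ≤ f.card := fun f hf => by rw [hH f hf]; omega
  have hcov : ∀ e ∈ M, ∃ w, IsFracCover m
      (H.filter fun f => ∀ e' ∈ M, e' ≠ e → (f ∩ e').card < m) w ∧ fracSize m w ≤ c := by
    intro e he
    refine hsub _ (filter_subset _ _) ⟨{e}, ⟨?_, ?_⟩, card_singleton e⟩ ?_
    · rw [singleton_subset_iff, mem_filter]
      exact ⟨hM.1 he, fun e' he' hne => hM.2 e he e' he' hne.symm⟩
    · intro x hx y hy hxy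
      rw [mem_singleton] at hx hy
      exact absurd (hx.trans hy.symm) hxy
    · intro N hN
      refine card_le_one.2 fun f hf g hg => ?_
      by_contra hfg
      have hf' := mem_filter.1 (hN.1 hf)
      have hg' := mem_filter.1 (hN.1 hg)
      have := le_card_inter_of_private hM hmax he hf'.1 hg'.1 (hle f hf'.1) (hle g hg'.1) hfg
        hf'.2 hg'.2
      exact absurd (hN.2 f hf g hg hfg) (not_lt.2 this)
  choose! w hw hwc using hcov
  have hind : ∀ e f : Finset V, (0 : ℝ) ≤ ∑ S ∈ f.powersetCard m, if S ⊆ e then 1 else 0 :=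
    fun e f => sum_nonneg fun _ _ => by positivity
  have hwn : ∀ e ∈ M, ∀ f : Finset V, 0 ≤ ∑ S ∈ f.powersetCard m, w e S :=
    fun e he f => sum_nonneg fun S _ => (hw e he).1 S
  have hsum : ∀ f : Finset V,
      ∑ S ∈ f.powersetCard m, (∑ e ∈ M, ((if S ⊆ e then (1 : ℝ) else 0) + w e S)) / 2 =
      (∑ e ∈ M, ((∑ S ∈ f.powersetCard m, if S ⊆ e then (1 : ℝ) else 0) +
        ∑ S ∈ f.powersetCard m, w e S)) / 2 := by
    intro f
    rw [← sum_div, sum_comm]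
    simp only [sum_add_distrib]
  refine ⟨fun S => (∑ e ∈ M, ((if S ⊆ e then (1 : ℝ) else 0) + w e S)) / 2, ⟨?_, ?_⟩, ?_⟩
  · intro S
    refine div_nonneg (sum_nonneg fun e he => add_nonneg ?_ ((hw e he).1 S)) zero_le_two
    positivity
  · intro f hf
    rw [hsum, le_div_iff₀ two_pos, one_mul]
    have hnn : ∀ e ∈ M, (0 : ℝ) ≤ (∑ S ∈ f.powersetCard m, if S ⊆ e then (1 : ℝ) else 0) +
        ∑ S ∈ f.powersetCard m, w e S := fun e he => add_nonneg (hind e f) (hwn e he f)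
    obtain ⟨e, he, hfe⟩ := exists_le_card_inter hM hmax hf (hle f hf)
    have h1 := one_le_sum_indicator_subset hfe
    by_cases hp : ∀ e' ∈ M, e' ≠ e → (f ∩ e').card < m
    · have h2 := (hw e he).2 f (mem_filter.2 ⟨hf, hp⟩)
      have h3 := single_le_sum hnn he
      linarith
    · push Not at hp
      obtain ⟨e', he', hne, hfe'⟩ := hp
      have h2 := one_le_sum_indicator_subset hfe'
      have h3 := add_le_sum hnn he he' hne.symm
      linarith [hwn e he f, hwn e' he' f]
  · have hchoose : ∀ e ∈ M,
        (∑ S ∈ (univ : Finset V).powersetCard m, if S ⊆ e then (1 : ℝ) else 0) = k.choose m := by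
      intro e he
      have hfil : ((univ : Finset V).powersetCard m).filter (· ⊆ e) = e.powersetCard m := by
        ext S
        simp [mem_powersetCard, and_comm]
      rw [sum_boole, hfil, card_powersetCard, hH e (hM.1 he)]
    rw [fracSize, hsum]
    have hbound := sum_le_card_nsmul M (fun e =>
      (∑ S ∈ (univ : Finset V).powersetCard m, if S ⊆ e then (1 : ℝ) else 0) +
        ∑ S ∈ (univ : Finset V).powersetCard m, w e S) ((k.choose m : ℝ) + c)
      fun e he => add_le_add (hchoose e he).le (hwc e he)
    rw [nsmul_eq_mul] at hbound
    linarith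
end
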